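/- Let (ΛV,d) be a pure elliptic minimal Sullivan model whose differential has constant length l, i.e. dV ⊆ Λ^l V for some l ≥ 2. Then for every integer r ≥ 2, TC_r(ΛV) ≤ r·cat(ΛV) + χ_π(ΛV). -/

import Mathlib

noncomputable section

namespace RHT

/-- A graded-commutative differential graded algebra over `ℚ`, graded by `ℕ`,
with a degree `+1` differential satisfying the graded Leibniz rule. -/
class GCDGA (A : Type) extends Ring A, Algebra ℚ A where
  grading : ℕ → Submodule ℚ A
  gradedAlgebra : GradedAlgebra grading
  grading_comm : ∀ (i j : ℕ) (a b : A), a ∈ grading i → b ∈ grading j →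
    a * b = ((-1 : ℚ) ^ (i * j)) • (b * a)
  d : A →ₗ[ℚ] A
  d_sq : ∀ a : A, d (d a) = 0
  d_grading : ∀ (i : ℕ) (a : A), a ∈ grading i → d a ∈ grading (i + 1)
  d_leibniz : ∀ (i : ℕ) (a b : A), a ∈ grading i →
    d (a * b) = d a * b + ((-1 : ℚ) ^ i) • (a * d b)

/-- The grading of a gcdga, with the algebra explicit. -/
def Gr (A : Type) [GCDGA A] : ℕ → Submodule ℚ A := GCDGA.grading

/-- The differential of a gcdga, with the algebra explicit. -/
def Dd (A : Type) [GCDGA A] : A →ₗ[ℚ] A := GCDGA.d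

/-- Morphisms of cdga's: `ℚ`-algebra morphisms preserving the grading and
commuting with the differentials. -/
def IsDGAHom {A B : Type} [GCDGA A] [GCDGA B] (f : A →ₐ[ℚ] B) : Prop :=
  (∀ a : A, f (Dd A a) = Dd B (f a)) ∧
    ∀ (i : ℕ) (a : A), a ∈ Gr A i → f a ∈ Gr B i

theorem isDGAHom_id (A : Type) [GCDGA A] : IsDGAHom (AlgHom.id ℚ A) :=
  ⟨fun _ => rfl, fun _ _ h => h⟩

/-- A quasi-isomorphism: a morphism inducing an isomorphism in cohomology
(stated elementwise: surjectivity and injectivity on cohomology classes). -/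
def QuasiIso {A B : Type} [GCDGA A] [GCDGA B] (f : A →ₐ[ℚ] B) : Prop :=
  (∀ b : B, Dd B b = 0 → ∃ a : A, Dd A a = 0 ∧ ∃ c : B, f a - b = Dd B c) ∧
    ∀ a : A, Dd A a = 0 → (∃ c : B, f a = Dd B c) → ∃ e : A, a = Dd A e

/-- Injectivity in cohomology, stated elementwise. -/
def CohomologyInjective {A B : Type} [GCDGA A] [GCDGA B] (f : A →ₐ[ℚ] B) : Prop :=
  ∀ a : A, Dd A a = 0 → (∃ c : B, f a = Dd B c) → ∃ e : A, a = Dd A e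

/-- A homotopy retraction for a morphism `ρ` of cdga's: a factorization of `ρ`
through a surjective quasi-isomorphism `q : C → Q` (playing the role of the
relative Sullivan model of `ρ`) together with a cdga retraction `τ`. -/
structure HtpyRetraction {T Q : Type} [GCDGA T] [GCDGA Q] (ρ : T →ₐ[ℚ] Q) where
  C : Type
  [instC : GCDGA C]
  j : T →ₐ[ℚ] C
  q : C →ₐ[ℚ] Q
  τ : C →ₐ[ℚ] T
  j_dga : IsDGAHom j
  q_dga : IsDGAHom q
  τ_dga : IsDGAHom τ
  q_surj : Function.Surjective q
  q_quasi : QuasiIso q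
  hqj : q.comp j = ρ
  hτj : τ.comp j = AlgHom.id ℚ T

attribute [instance] HtpyRetraction.instC

/-- A homotopy retraction of `T`-modules for a morphism `ρ : T → Q` of cdga's:
as above, but the retraction `τ` is only required to be a morphism of
differential `T`-modules. -/
structure ModHtpyRetraction {T Q : Type} [GCDGA T] [GCDGA Q] (ρ : T →ₐ[ℚ] Q) where
  C : Type
  [instC : GCDGA C]
  j : T →ₐ[ℚ] C
  q : C →ₐ[ℚ] Q
  τ : C →ₗ[ℚ] T
  j_dga : IsDGAHom j
  q_dga : IsDGAHom q
  q_surj : Function.Surjective q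
  q_quasi : QuasiIso q
  hqj : q.comp j = ρ
  τ_chain : ∀ c : C, τ (Dd C c) = Dd T (τ c)
  τ_mod : ∀ (t : T) (c : C), τ (j t * c) = t * τ c
  hτj : ∀ t : T, τ (j t) = t

attribute [instance] ModHtpyRetraction.instC

/-- `T`, together with the morphisms `ι j : A → T`, is the `r`-fold (graded)
tensor power of `A`, characterized as the `r`-fold coproduct of copies of `A`
in the category of cdga's. -/
structure TensorPower (A : Type) [GCDGA A] (r : ℕ) (T : Type) [GCDGA T] where
  ι : Fin r → (A →ₐ[ℚ] T)
  ι_dga : ∀ j, IsDGAHom (ι j)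
  coprod : ∀ (B : Type) [GCDGA B] (f : Fin r → (A →ₐ[ℚ] B)), (∀ j, IsDGAHom (f j)) →
    ∃! g : T →ₐ[ℚ] B, IsDGAHom g ∧ ∀ j, g.comp (ι j) = f j

/-- The `r`-fold multiplication morphism `μ : A^{⊗ r} → A`, i.e. the fold map
of the coproduct. -/
noncomputable def TensorPower.mu {A : Type} [GCDGA A] {r : ℕ} {T : Type} [GCDGA T]
    (TP : TensorPower A r T) : T →ₐ[ℚ] A :=
  (TP.coprod A (fun _ => AlgHom.id ℚ A) (fun _ => isDGAHom_id A)).choose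

/-- The kernel of the `r`-fold multiplication, as a `ℚ`-submodule (ideal). -/
noncomputable def TensorPower.kerMu {A : Type} [GCDGA A] {r : ℕ} {T : Type} [GCDGA T]
    (TP : TensorPower A r T) : Submodule ℚ T :=
  LinearMap.ker TP.mu.toLinearMap

/-- A witness that `TC_r(ΛV) ≤ n`: the projection
`ρ^r_n : (ΛV)^{⊗ r} → (ΛV)^{⊗ r}/(ker μ^r)^{n+1}` admits a homotopy retraction
of cdga's.  The quotient is encoded as a surjective cdga morphism with kernel
`(ker μ^r)^{n+1}`. -/
structure TCWitness (A : Type) [GCDGA A] (r n : ℕ) where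
  T : Type
  [instT : GCDGA T]
  TP : TensorPower A r T
  Q : Type
  [instQ : GCDGA Q]
  ρ : T →ₐ[ℚ] Q
  ρ_dga : IsDGAHom ρ
  ρ_surj : Function.Surjective ρ
  ρ_ker : LinearMap.ker ρ.toLinearMap = TP.kerMu ^ (n + 1)
  retr : Nonempty (HtpyRetraction ρ)

/-- The higher rational topological complexity `TC_r`. -/
noncomputable def TC (A : Type) [GCDGA A] (r : ℕ) : ℕ :=
  sInf {n | Nonempty (TCWitness A r n)}

/-- A witness that `MTC_r(ΛV) ≤ n`: `ρ^r_n` admits a homotopy retraction of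
`(ΛV)^{⊗ r}`-modules. -/
structure MTCWitness (A : Type) [GCDGA A] (r n : ℕ) where
  T : Type
  [instT : GCDGA T]
  TP : TensorPower A r T
  Q : Type
  [instQ : GCDGA Q]
  ρ : T →ₐ[ℚ] Q
  ρ_dga : IsDGAHom ρ
  ρ_surj : Function.Surjective ρ
  ρ_ker : LinearMap.ker ρ.toLinearMap = TP.kerMu ^ (n + 1)
  retr : Nonempty (ModHtpyRetraction ρ)

/-- The higher module rational topological complexity `MTC_r`. -/
noncomputable def MTC (A : Type) [GCDGA A] (r : ℕ) : ℕ :=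
  sInf {n | Nonempty (MTCWitness A r n)}

/-- A witness that `HTC_r(ΛV) ≤ n`: `ρ^r_n` is injective in cohomology. -/
structure HTCWitness (A : Type) [GCDGA A] (r n : ℕ) where
  T : Type
  [instT : GCDGA T]
  TP : TensorPower A r T
  Q : Type
  [instQ : GCDGA Q]
  ρ : T →ₐ[ℚ] Q
  ρ_dga : IsDGAHom ρ
  ρ_surj : Function.Surjective ρ
  ρ_ker : LinearMap.ker ρ.toLinearMap = TP.kerMu ^ (n + 1)
  inj : CohomologyInjective ρ

/-- The invariant `HTC_r`. -/
noncomputable def HTC (A : Type) [GCDGA A] (r : ℕ) : ℕ :=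
  sInf {n | Nonempty (HTCWitness A r n)}

/-- A minimal Sullivan model structure on a gcdga `A`: a simply-connected
graded space of generators `V` of finite type, the word-length grading `lam`
(`lam k` is `Λ^k V`), freeness of `A` over `V` as a graded-commutative
algebra (expressed by the universal property), and minimality `d V ⊆ Λ^{≥2}V`. -/
structure MinimalSullivan (A : Type) [GCDGA A] where
  V : ℕ → Submodule ℚ A
  lam : ℕ → Submodule ℚ A
  V_le : ∀ n, V n ≤ Gr A n
  V0 : V 0 = ⊥
  V1 : V 1 = ⊥
  V_fin : ∀ n, FiniteDimensional ℚ (V n)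
  lam_zero : lam 0 = 1
  lam_one : lam 1 = ⨆ n, V n
  lam_mul : ∀ p q, lam p * lam q ≤ lam (p + q)
  lam_internal : DirectSum.IsInternal lam
  minimal : ∀ (n : ℕ), ∀ v ∈ V n, Dd A v ∈ ⨆ k, ⨆ (_ : 2 ≤ k), lam k
  free : ∀ (B : Type) [GCDGA B] (f : ∀ n, V n →ₗ[ℚ] B),
    (∀ (n : ℕ) (v : V n), f n v ∈ Gr B n) →
    ∃! g : A →ₐ[ℚ] B, (∀ (i : ℕ) (a : A), a ∈ Gr A i → g a ∈ Gr B i) ∧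
      ∀ (n : ℕ) (v : V n), g (v : A) = f n v

namespace MinimalSullivan

variable {A : Type} [GCDGA A] (S : MinimalSullivan A)

/-- The even part of the space of generators. -/
def Veven : Submodule ℚ A := ⨆ n, S.V (2 * n)

/-- The odd part of the space of generators. -/
def Vodd : Submodule ℚ A := ⨆ n, S.V (2 * n + 1)

/-- The homotopy characteristic `χ_π = dim V^even - dim V^odd`. -/
noncomputable def chiPi : ℤ :=
  (Module.finrank ℚ S.Veven : ℤ) - (Module.finrank ℚ S.Vodd : ℤ)

/-- Purity: `d V^even = 0` and `d V^odd ⊆ Λ V^even`. -/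
def Pure : Prop :=
  (∀ a ∈ S.Veven, Dd A a = 0) ∧
    ∀ a ∈ S.Vodd, Dd A a ∈ Algebra.adjoin ℚ (S.Veven : Set A)

/-- Coformality: the differential is quadratic, `d V ⊆ Λ² V`. -/
def Coformal : Prop := ∀ (n : ℕ), ∀ v ∈ S.V n, Dd A v ∈ S.lam 2

/-- Constant length `l` of the differential: `d V ⊆ Λ^l V`. -/
def ConstantLength (l : ℕ) : Prop := ∀ (n : ℕ), ∀ v ∈ S.V n, Dd A v ∈ S.lam l

end MinimalSullivan

/-- The cohomology of a gcdga, as a `ℚ`-module. -/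
def CohClasses (A : Type) [GCDGA A] :=
  LinearMap.ker (Dd A) ⧸ ((LinearMap.range (Dd A)).comap (LinearMap.ker (Dd A)).subtype)

instance (A : Type) [GCDGA A] : AddCommGroup (CohClasses A) := by
  unfold CohClasses; infer_instance

instance (A : Type) [GCDGA A] : Module ℚ (CohClasses A) := by
  unfold CohClasses; infer_instance

/-- Ellipticity: both the generating space `V` and the cohomology are
finite-dimensional. -/
def Elliptic (A : Type) [GCDGA A] (S : MinimalSullivan A) : Prop :=
  FiniteDimensional ℚ (⨆ n, S.V n : Submodule ℚ A) ∧ FiniteDimensional ℚ (CohClasses A)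

/-- A witness of formality: a quasi-isomorphism to a gcdga with zero
differential. -/
structure FormalityWitness (A : Type) [GCDGA A] where
  B : Type
  [instB : GCDGA B]
  hd : Dd B = 0
  ψ : A →ₐ[ℚ] B
  ψ_dga : IsDGAHom ψ
  ψ_quasi : QuasiIso ψ

/-- Formality of a (Sullivan) cdga. -/
def Formal (A : Type) [GCDGA A] : Prop := Nonempty (FormalityWitness A)

/-- A witness that `cat(ΛV) ≤ n`: the projection `ΛV → ΛV/Λ^{>n}V` admits a
homotopy retraction.  The quotient is encoded as a surjective cdga morphism
whose kernel is `Λ^{>n}V`. -/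
structure CatWitness (A : Type) [GCDGA A] (S : MinimalSullivan A) (n : ℕ) where
  Q : Type
  [instQ : GCDGA Q]
  π : A →ₐ[ℚ] Q
  π_dga : IsDGAHom π
  π_surj : Function.Surjective π
  π_ker : LinearMap.ker π.toLinearMap = ⨆ k, ⨆ (_ : n < k), S.lam k
  retr : Nonempty (HtpyRetraction π)

/-- The rational LS-category. -/
noncomputable def cat (A : Type) [GCDGA A] (S : MinimalSullivan A) : ℕ :=
  sInf {n | Nonempty (CatWitness A S n)}

/-- A witness that `zcl_r(ΛV) ≥ p`: `p` cocycles in `(ΛV)^{⊗ r}` whose classes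
are zero-divisors (killed by `H(μ^r)`) and whose product is not exact. -/
structure ZclWitness (A : Type) [GCDGA A] (r p : ℕ) where
  T : Type
  [instT : GCDGA T]
  TP : TensorPower A r T
  a : Fin p → T
  closed : ∀ i, Dd T (a i) = 0
  zero_div : ∀ i, ∃ b : A, TP.mu (a i) = Dd A b
  prod_ne : ∀ b : T, (List.ofFn a).prod ≠ Dd T b

/-- The `r`-zero-divisor-cuplength `zcl_r`. -/
noncomputable def zcl (A : Type) [GCDGA A] (r : ℕ) : ℕ :=
  sSup {p | Nonempty (ZclWitness A r p)}

/-- A witness that `cl_ℚ(ΛV) ≥ p`: `p` cocycles of positive degree with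
non-exact product. -/
structure ClWitness (A : Type) [GCDGA A] (p : ℕ) where
  a : Fin p → A
  pos : ∀ i, a i ∈ ⨆ k, ⨆ (_ : 0 < k), Gr A k
  closed : ∀ i, Dd A (a i) = 0
  prod_ne : ∀ b : A, (List.ofFn a).prod ≠ Dd A b

/-- The rational cuplength `cl_ℚ`. -/
noncomputable def clQ (A : Type) [GCDGA A] : ℕ :=
  sSup {p | Nonempty (ClWitness A p)}

section

open MvPolynomial

/-! ### Gradings given by projections -/

/-- A family of submodules closed under multiplication is a grading as soon as it spans and
has a system of projections. -/
@[reducible]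
def gradedAlgebraOfProj {A : Type} [Ring A] [Algebra ℚ A] (G : ℕ → Submodule ℚ A)
    (hone : (1 : A) ∈ G 0) (hmul : ∀ i j a b, a ∈ G i → b ∈ G j → a * b ∈ G (i + j))
    (p : ℕ → A →ₗ[ℚ] A) (hsame : ∀ i, ∀ a ∈ G i, p i a = a)
    (hne : ∀ i j, i ≠ j → ∀ a ∈ G i, p j a = 0) (htop : ∀ a, a ∈ ⨆ i, G i) :
    GradedAlgebra G :=
  haveI : SetLike.GradedMonoid G := { one_mem := hone, mul_mem := fun i j a b => hmul i j a b }
  DirectSum.IsInternal.gradedAlgebra <| by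
    rw [DirectSum.isInternal_submodule_iff_iSupIndep_and_iSup_eq_top]
    refine ⟨?_, eq_top_iff.2 fun a _ => htop a⟩
    intro i
    rw [Submodule.disjoint_def]
    intro x hx hx'
    have hker : (⨆ j, ⨆ (_ : j ≠ i), G j) ≤ LinearMap.ker (p i) :=
      iSup₂_le fun j hj a ha => hne j i hj a ha
    rw [← hsame i x hx]
    exact hker hx'

section Basics

variable {A B : Type} [GCDGA A] [GCDGA B]

instance : GradedAlgebra (Gr A) := GCDGA.gradedAlgebra

/-- The projection onto the part of degree `i`. -/
def pr (A : Type) [GCDGA A] (i : ℕ) : A →ₗ[ℚ] A := GradedAlgebra.proj (Gr A) i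

theorem pr_mem (i : ℕ) (a : A) : pr A i a ∈ Gr A i := by
  rw [pr, GradedAlgebra.proj_apply]; exact Subtype.mem _

theorem pr_same {i : ℕ} {a : A} (h : a ∈ Gr A i) : pr A i a = a := by
  rw [pr, GradedAlgebra.proj_apply]; exact DirectSum.decompose_of_mem_same _ h

theorem pr_ne {i j : ℕ} {a : A} (h : a ∈ Gr A i) (hij : i ≠ j) : pr A j a = 0 := by
  rw [pr, GradedAlgebra.proj_apply]; exact DirectSum.decompose_of_mem_ne _ h hij

@[elab_as_elim]
theorem gr_induction {motive : A → Prop} (a : A) (hom : ∀ i, ∀ x ∈ Gr A i, motive x)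
    (add : ∀ x y, motive x → motive y → motive (x + y)) : motive a :=
  DirectSum.Decomposition.inductionOn (Gr A) (hom 0 0 (zero_mem _))
    (fun {i} m => hom i m m.2) add a

theorem one_mem_gr : (1 : A) ∈ Gr A 0 := SetLike.GradedOne.one_mem

theorem mul_mem_gr {i j : ℕ} {a b : A} (ha : a ∈ Gr A i) (hb : b ∈ Gr A j) :
    a * b ∈ Gr A (i + j) := SetLike.mul_mem_graded ha hb

theorem mem_iSup_gr (a : A) : a ∈ ⨆ i, Gr A i := by
  induction a using gr_induction with
  | hom i x hx => exact Submodule.mem_iSup_of_mem i hx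
  | add x y hx hy => exact add_mem hx hy

theorem gr_comm {i j : ℕ} {a b : A} (ha : a ∈ Gr A i) (hb : b ∈ Gr A j) :
    a * b = ((-1 : ℚ) ^ (i * j)) • (b * a) := GCDGA.grading_comm i j a b ha hb

theorem Dd_sq (a : A) : Dd A (Dd A a) = 0 := GCDGA.d_sq a

theorem Dd_mem {i : ℕ} {a : A} (ha : a ∈ Gr A i) : Dd A a ∈ Gr A (i + 1) :=
  GCDGA.d_grading i a ha

theorem Dd_mul {i : ℕ} {a : A} (ha : a ∈ Gr A i) (b : A) :
    Dd A (a * b) = Dd A a * b + ((-1 : ℚ) ^ i) • (a * Dd A b) := GCDGA.d_leibniz i a b ha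

theorem Dd_one : Dd A 1 = 0 := by
  have h := Dd_mul (one_mem_gr (A := A)) 1
  simpa using h

/-- Homogeneous linear maps commute with projections. -/
theorem map_pr (f : A →ₗ[ℚ] B) (k : ℕ) (hf : ∀ i, ∀ a ∈ Gr A i, f a ∈ Gr B (i + k)) (i : ℕ)
    (a : A) : f (pr A i a) = pr B (i + k) (f a) := by
  induction a using gr_induction with
  | hom j x hx =>
    rcases eq_or_ne j i with rfl | h
    · rw [pr_same hx, pr_same (hf _ _ hx)]
    · rw [pr_ne hx h, pr_ne (hf _ _ hx) (by omega), map_zero]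
  | add x y hx hy => simp only [map_add, hx, hy]

theorem Dd_pr (i : ℕ) (a : A) : Dd A (pr A i a) = pr A (i + 1) (Dd A a) :=
  map_pr (Dd A) 1 (fun _ _ h => Dd_mem h) i a

theorem map_pr_alg (f : A →ₐ[ℚ] B) (hf : ∀ (i : ℕ) (a : A), a ∈ Gr A i → f a ∈ Gr B i) (i : ℕ)
    (a : A) : f (pr A i a) = pr B i (f a) :=
  map_pr f.toLinearMap 0 (fun i a h => hf i a h) i a

/-- Homogeneous elements of even degree are central. -/
theorem even_comm {i : ℕ} (hi : Even i) {a : A} (ha : a ∈ Gr A i) (b : A) : a * b = b * a := by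
  induction b using gr_induction with
  | hom j x hx =>
    rw [gr_comm ha hx, (hi.mul_right j).neg_one_pow, one_smul]
  | add x y hx hy => rw [mul_add, add_mul, hx, hy]

theorem odd_sq {i : ℕ} (hi : Odd i) {a : A} (ha : a ∈ Gr A i) : a * a = 0 := by
  have h := gr_comm ha ha
  rw [(hi.mul hi).neg_one_pow, neg_one_smul] at h
  have h2 : (2 : ℚ) • (a * a) = 0 := by rw [two_smul]; nth_rewrite 2 [h]; exact add_neg_cancel _
  exact (smul_eq_zero.1 h2).resolve_left two_ne_zero

theorem IsDGAHom.comp {C : Type} [GCDGA C] {g : B →ₐ[ℚ] C} {f : A →ₐ[ℚ] B} (hg : IsDGAHom g)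
    (hf : IsDGAHom f) : IsDGAHom (g.comp f) :=
  ⟨fun a => by simp [hf.1, hg.1], fun i a h => hg.2 _ _ (hf.2 _ _ h)⟩

/-! ### The parity involution -/

/-- The linear map equal to `(-1)^i` in degree `i`. -/
def parLin (A : Type) [GCDGA A] : A →ₗ[ℚ] A :=
  (DirectSum.toModule ℚ ℕ A fun i => ((-1 : ℚ) ^ i) • (Gr A i).subtype) ∘ₗ
    (DirectSum.decomposeLinearEquiv (Gr A)).toLinearMap

theorem parLin_of_mem {i : ℕ} {a : A} (h : a ∈ Gr A i) : parLin A a = ((-1 : ℚ) ^ i) • a := by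
  lift a to Gr A i using h
  rw [parLin, LinearMap.comp_apply, LinearEquiv.coe_coe, DirectSum.decomposeLinearEquiv_apply_coe,
    DirectSum.toModule_lof]
  rfl

theorem parLin_mul (a b : A) : parLin A (a * b) = parLin A a * parLin A b := by
  induction a using gr_induction with
  | hom i x hx =>
    induction b using gr_induction with
    | hom j y hy =>
      rw [parLin_of_mem (mul_mem_gr hx hy), parLin_of_mem hx, parLin_of_mem hy, smul_mul_smul_comm,
        pow_add]
    | add x y hx hy => rw [mul_add, map_add, map_add, mul_add, hx, hy]
  | add x y hx hy => rw [add_mul, map_add, map_add, add_mul, hx, hy]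

/-- The parity involution `a ↦ (-1)^{|a|} a`. -/
def par (A : Type) [GCDGA A] : A →ₐ[ℚ] A :=
  AlgHom.ofLinearMap (parLin A) (by simp [parLin_of_mem one_mem_gr]) parLin_mul

theorem par_of_mem {i : ℕ} {a : A} (h : a ∈ Gr A i) : par A a = ((-1 : ℚ) ^ i) • a :=
  parLin_of_mem h

theorem par_of_even {i : ℕ} (hi : Even i) {a : A} (h : a ∈ Gr A i) : par A a = a := by
  rw [par_of_mem h, hi.neg_one_pow, one_smul]

theorem par_mem {i : ℕ} {a : A} (h : a ∈ Gr A i) : par A a ∈ Gr A i := by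
  rw [par_of_mem h]; exact Submodule.smul_mem _ _ h

theorem par_par (a : A) : par A (par A a) = a := by
  induction a using gr_induction with
  | hom i x hx => rw [par_of_mem (par_mem hx), par_of_mem hx, smul_smul, ← mul_pow]; simp
  | add x y hx hy => simp only [map_add, hx, hy]

theorem Dd_par (a : A) : Dd A (par A a) = -par A (Dd A a) := by
  induction a using gr_induction with
  | hom i x hx => rw [par_of_mem (Dd_mem hx), par_of_mem hx, pow_succ]; simp
  | add x y hx hy => simp only [map_add, hx, hy, neg_add]

theorem map_par (f : A →ₐ[ℚ] B) (hf : ∀ (i : ℕ) (a : A), a ∈ Gr A i → f a ∈ Gr B i) (a : A) :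
    f (par A a) = par B (f a) := by
  induction a using gr_induction with
  | hom i x hx => rw [par_of_mem hx, par_of_mem (hf _ _ hx), map_smul]
  | add x y hx hy => simp only [map_add, hx, hy]

theorem Dd_mul' (a b : A) : Dd A (a * b) = Dd A a * b + par A a * Dd A b := by
  induction a using gr_induction with
  | hom i x hx => rw [Dd_mul hx, par_of_mem hx, smul_mul_assoc]
  | add x y hx hy => rw [add_mul, map_add, hx, hy, map_add, map_add]; noncomm_ring

/-- Multiplication by an odd element on the right, up to the parity involution. -/
theorem mul_odd {i : ℕ} (hi : Odd i) {y : A} (hy : y ∈ Gr A i) (a : A) : a * y = y * par A a := by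
  induction a using gr_induction with
  | hom j x hx =>
    rw [gr_comm hx hy, par_of_mem hx, mul_smul_comm, mul_comm j i, pow_mul, hi.neg_one_pow]
  | add x y hx hy => rw [add_mul, map_add, mul_add, hx, hy]

end Basics

/-! ### Adjoining an odd generator -/

/-- The underlying space `B ⊕ B·y` of the extension of `B` by an odd generator `y`;
`⟨a, b⟩` stands for `a + b·y`. -/
@[ext]
structure Adj (B : Type) : Type where
  /-- The coefficient of `1`. -/
  fst : B
  /-- The coefficient of `y`. -/
  snd : B

namespace Adj

variable {B : Type} [GCDGA B]

/-- The underlying space as a product. -/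
def equivProd (B : Type) : Adj B ≃ B × B where
  toFun u := (u.fst, u.snd)
  invFun p := ⟨p.1, p.2⟩

instance : AddCommGroup (Adj B) := (equivProd B).addCommGroup

instance : Module ℚ (Adj B) := (equivProd B).module ℚ

instance : Mul (Adj B) := ⟨fun u v => mk (u.1 * v.1) (u.1 * v.2 + u.2 * par B v.1)⟩

instance : One (Adj B) := ⟨mk 1 0⟩

@[simp] theorem mul_fst (u v : Adj B) : (u * v).1 = u.1 * v.1 := rfl
@[simp] theorem mul_snd (u v : Adj B) : (u * v).2 = u.1 * v.2 + u.2 * par B v.1 := rfl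
@[simp] theorem one_fst : (1 : Adj B).1 = 1 := rfl
@[simp] theorem one_snd : (1 : Adj B).2 = 0 := rfl
@[simp] theorem add_fst (u v : Adj B) : (u + v).1 = u.1 + v.1 := rfl
@[simp] theorem add_snd (u v : Adj B) : (u + v).2 = u.2 + v.2 := rfl
@[simp] theorem zero_fst : (0 : Adj B).1 = 0 := rfl
@[simp] theorem zero_snd : (0 : Adj B).2 = 0 := rfl
@[simp] theorem smul_fst (c : ℚ) (u : Adj B) : (c • u).1 = c • u.1 := rfl
@[simp] theorem smul_snd (c : ℚ) (u : Adj B) : (c • u).2 = c • u.2 := rfl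

instance : Ring (Adj B) :=
  { (inferInstance : AddCommGroup (Adj B)) with
    mul := (· * ·)
    one := 1
    left_distrib := fun u v w => Adj.ext (by simp [mul_add]) (by simp [mul_add]; abel)
    right_distrib := fun u v w => Adj.ext (by simp [add_mul]) (by simp [add_mul]; abel)
    zero_mul := fun u => Adj.ext (by simp) (by simp)
    mul_zero := fun u => Adj.ext (by simp) (by simp)
    mul_assoc := fun u v w => Adj.ext (by simp [mul_assoc])
      (by simp [mul_add, add_mul, mul_assoc, add_assoc])
    one_mul := fun u => Adj.ext (by simp) (by simp)
    mul_one := fun u => Adj.ext (by simp) (by simp) }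

instance : Algebra ℚ (Adj B) :=
  Algebra.ofModule (fun r u v => Adj.ext (by simp) (by simp [smul_add]))
    (fun r u v => Adj.ext (by simp) (by simp [smul_add]))

/-- The inclusion of `B`. -/
def inl : B →ₐ[ℚ] Adj B where
  toFun b := mk b 0
  map_one' := rfl
  map_mul' a b := Adj.ext rfl (by simp)
  map_zero' := rfl
  map_add' a b := Adj.ext rfl (by simp)
  commutes' c := Adj.ext (by simp [Algebra.algebraMap_eq_smul_one])
    (by simp [Algebra.algebraMap_eq_smul_one])

theorem inl_apply (b : B) : inl b = mk b 0 := rfl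

/-- The new generator. -/
def y : Adj B := mk 0 1

theorem eq_inl_add (u : Adj B) : u = inl u.1 + inl u.2 * y :=
  Adj.ext (by simp [inl_apply, y]) (by simp [inl_apply, y])

/-- The degree `i` part of `B·y`, as a subspace of `B`. -/
def shift (n i : ℕ) : Submodule ℚ B := if n ≤ i then Gr B (i - n) else ⊥

theorem mem_shift_add (n i : ℕ) (b : B) : b ∈ (shift n (i + n) : Submodule ℚ B) ↔ b ∈ Gr B i := by
  simp [shift]

theorem shift_cases {n i : ℕ} {b : B} (h : b ∈ (shift n i : Submodule ℚ B)) :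
    b = 0 ∨ ∃ k, i = k + n ∧ b ∈ Gr B k := by
  unfold shift at h
  split_ifs at h with hi
  · exact Or.inr ⟨i - n, by omega, h⟩
  · exact Or.inl ((Submodule.mem_bot ℚ).1 h)

/-- The grading of the extension when the new generator has degree `n`. -/
def gr (B : Type) [GCDGA B] (n i : ℕ) : Submodule ℚ (Adj B) where
  carrier := {u | u.1 ∈ Gr B i ∧ u.2 ∈ (shift n i : Submodule ℚ B)}
  zero_mem' := ⟨zero_mem _, zero_mem _⟩
  add_mem' hu hv := ⟨add_mem hu.1 hv.1, add_mem hu.2 hv.2⟩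
  smul_mem' c _ hu := ⟨Submodule.smul_mem _ c hu.1, Submodule.smul_mem _ c hu.2⟩

/-- The projection onto the degree `i` part. -/
def proj (B : Type) [GCDGA B] (n i : ℕ) : Adj B →ₗ[ℚ] Adj B where
  toFun u := ⟨pr B i u.1, (if n ≤ i then pr B (i - n) else 0) u.2⟩
  map_add' u v := Adj.ext (by simp) (by simp)
  map_smul' c u := Adj.ext (by simp) (by simp)

theorem inl_mem {n i : ℕ} {b : B} (h : b ∈ Gr B i) : inl b ∈ gr B n i := ⟨h, zero_mem _⟩

theorem mk_zero_mem {n i : ℕ} {b : B} (h : b ∈ Gr B i) : mk 0 b ∈ gr B n (i + n) :=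
  ⟨zero_mem _, (mem_shift_add _ _ _).2 h⟩

theorem gr_mul {n : ℕ} (i j : ℕ) (u v : Adj B) (hu : u ∈ gr B n i) (hv : v ∈ gr B n j) :
    u * v ∈ gr B n (i + j) := by
  refine ⟨mul_mem_gr hu.1 hv.1, add_mem ?_ ?_⟩
  · rcases shift_cases hv.2 with h | ⟨k, rfl, h⟩
    · rw [show v.2 = 0 from h]; simp
    · rw [← add_assoc]; exact (mem_shift_add _ _ _).2 (mul_mem_gr hu.1 h)
  · rcases shift_cases hu.2 with h | ⟨k, rfl, h⟩
    · rw [show u.2 = 0 from h]; simp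
    · rw [add_right_comm]; exact (mem_shift_add _ _ _).2 (mul_mem_gr h (par_mem hv.1))

/-- The grading of the extension by a generator of degree `n`. -/
@[reducible]
def gradedAlgebra (B : Type) [GCDGA B] (n : ℕ) : GradedAlgebra (gr B n) :=
  gradedAlgebraOfProj (gr B n) ⟨one_mem_gr, zero_mem _⟩ gr_mul (proj B n)
    (fun i u hu => by
      refine Adj.ext (pr_same hu.1) ?_
      change (if n ≤ i then pr B (i - n) else 0) u.2 = u.2
      rcases shift_cases hu.2 with h | ⟨k, rfl, h⟩
      · rw [show u.2 = 0 from h, map_zero]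
      · simp only [Nat.le_add_left, if_true, Nat.add_sub_cancel]; exact pr_same h)
    (fun i j hij u hu => by
      refine Adj.ext (pr_ne hu.1 hij) ?_
      change (if n ≤ j then pr B (j - n) else 0) u.2 = 0
      rcases shift_cases hu.2 with h | ⟨k, rfl, h⟩
      · rw [show u.2 = 0 from h, map_zero]
      · split_ifs with hj
        · exact pr_ne h (by omega)
        · rfl)
    (fun u => by
      have h₁ : ∀ a : B, mk a 0 ∈ ⨆ i, gr B n i := fun a => by
        induction a using gr_induction with
        | hom i x hx => exact Submodule.mem_iSup_of_mem i (inl_mem hx)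
        | add x y hx hy =>
          have := add_mem hx hy
          rwa [show mk x 0 + mk y 0 = mk (x + y) 0 from Adj.ext rfl (add_zero (0 : B))] at this
      have h₂ : ∀ a : B, mk 0 a ∈ ⨆ i, gr B n i := fun a => by
        induction a using gr_induction with
        | hom i x hx => exact Submodule.mem_iSup_of_mem _ (mk_zero_mem hx)
        | add x y hx hy =>
          have := add_mem hx hy
          rwa [show mk 0 x + mk 0 y = mk 0 (x + y) from Adj.ext (add_zero (0 : B)) rfl] at this
      have h := add_mem (h₁ u.1) (h₂ u.2)
      rwa [show mk u.1 0 + mk 0 u.2 = u from Adj.ext (add_zero _) (zero_add _)] at h)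

/-- The differential of the extension with `d y = f`. -/
def diff (f : B) : Adj B →ₗ[ℚ] Adj B where
  toFun u := mk (Dd B u.1 + par B u.2 * f) (Dd B u.2)
  map_add' u v := Adj.ext (by simp [add_mul]; abel) (by simp)
  map_smul' c u := Adj.ext (by simp) (by simp)

theorem diff_apply (f : B) (u : Adj B) :
    diff f u = mk (Dd B u.1 + par B u.2 * f) (Dd B u.2) := rfl

theorem neg_one_pow_smul_smul_congr {i j : ℕ} (h : Even (i + j)) (b : B) :
    ((-1 : ℚ) ^ i) • b = ((-1 : ℚ) ^ j) • b := by
  congr 1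
  rw [neg_one_pow_eq_pow_mod_two, neg_one_pow_eq_pow_mod_two (n := j)]
  congr 1
  have := Nat.even_iff.1 h
  omega

/-- The extension `B ⊗ Λ(y)` of a gcdga by an odd generator `y` with `d y = f`. -/
@[reducible]
def gcdga {n : ℕ} (hn : Odd n) {f : B} (hf : f ∈ Gr B (n + 1)) (hdf : Dd B f = 0) :
    GCDGA (Adj B) where
  grading := gr B n
  gradedAlgebra := gradedAlgebra B n
  grading_comm := by
    intro i j u v hu hv
    refine Adj.ext (gr_comm hu.1 hv.1) ?_
    simp only [mul_snd, smul_snd, smul_add]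
    rw [add_comm]
    congr 1
    · rcases shift_cases hu.2 with h | ⟨k, rfl, h⟩
      · rw [show u.2 = 0 from h]; simp
      · rw [par_of_mem hv.1, mul_smul_comm, gr_comm h hv.1, smul_smul, ← pow_add]
        refine neg_one_pow_smul_smul_congr ?_ _
        obtain ⟨t, rfl⟩ := hn
        exact ⟨j + k * j + t * j, by ring⟩
    · rcases shift_cases hv.2 with h | ⟨k, rfl, h⟩
      · rw [show v.2 = 0 from h]; simp
      · rw [par_of_mem hu.1, mul_smul_comm, gr_comm hu.1 h, smul_smul, ← pow_add]
        refine neg_one_pow_smul_smul_congr ?_ _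
        obtain ⟨t, rfl⟩ := hn
        exact ⟨i * k + i * t + i, by ring⟩
  d := diff f
  d_sq := by
    intro u
    refine Adj.ext ?_ (Dd_sq _)
    change Dd B (Dd B u.1 + par B u.2 * f) + par B (Dd B u.2) * f = 0
    rw [map_add, Dd_sq, Dd_mul', hdf, Dd_par]
    simp
  d_grading := by
    intro i u hu
    refine ⟨add_mem (Dd_mem hu.1) ?_, ?_⟩
    · rcases shift_cases hu.2 with h | ⟨k, rfl, h⟩
      · rw [show u.2 = 0 from h]; simp
      · rw [add_assoc]; exact mul_mem_gr (par_mem h) hf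
    · change Dd B u.2 ∈ _
      rcases shift_cases hu.2 with h | ⟨k, rfl, h⟩
      · rw [show u.2 = 0 from h]; simp
      · rw [add_right_comm]; exact (mem_shift_add _ _ _).2 (Dd_mem h)
  d_leibniz := by
    intro i u v hu
    have he : Even (n + 1) := hn.add_one
    have hp : par B u.2 = -((-1 : ℚ) ^ i) • u.2 := by
      rcases shift_cases hu.2 with h | ⟨k, rfl, h⟩
      · rw [show u.2 = 0 from h]; simp
      · rw [par_of_mem h, pow_add, hn.neg_one_pow]; simp
    have hpf : par B f = f := par_of_even he hf
    have hfc : ∀ b, f * b = b * f := even_comm he hf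
    refine Adj.ext ?_ ?_
    · simp only [diff_apply, mul_fst, add_fst, smul_fst, mul_snd, map_add, map_mul,
        par_par]
      rw [Dd_mul hu.1, par_of_mem hu.1, mul_add, add_mul, smul_add, add_mul, mul_assoc _ f,
        hfc v.1, smul_mul_assoc, smul_mul_assoc, mul_assoc, mul_assoc]
      abel
    · simp only [diff_apply, mul_snd, add_snd, smul_snd, mul_fst, map_add, map_mul,
        par_par, hpf]
      rw [Dd_mul hu.1, Dd_mul', Dd_par, hp, add_mul, smul_add, smul_mul_assoc, mul_add,
        smul_add]
      simp only [mul_neg, neg_smul, neg_mul, smul_mul_assoc, mul_assoc, hfc]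
      module

section Structure

variable {n : ℕ} (hn : Odd n) {f : B} (hf : f ∈ Gr B (n + 1)) (hdf : Dd B f = 0)

theorem isDGAHom_inl : let _ := gcdga hn hf hdf; IsDGAHom (inl : B →ₐ[ℚ] Adj B) := by
  let _ := gcdga hn hf hdf
  refine ⟨fun b => ?_, fun i b hb => inl_mem hb⟩
  change inl (Dd B b) = diff f (inl b)
  rw [diff_apply]
  exact Adj.ext (by simp [inl_apply]) (by simp [inl_apply])

theorem y_mem : let _ := gcdga hn hf hdf; (y : Adj B) ∈ Gr (Adj B) n := by
  have := mk_zero_mem (n := n) (one_mem_gr (A := B))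
  rwa [zero_add] at this

theorem Dd_y : let _ := gcdga hn hf hdf; Dd (Adj B) y = inl f := by
  change diff f y = inl f
  rw [diff_apply]
  exact Adj.ext (by simp [inl_apply, y]) (by simp [inl_apply, y, Dd_one])

/-- The algebra morphism extending `h : B → C` by `y ↦ c`. -/
def lift {C : Type} [GCDGA C] (h : B →ₐ[ℚ] C)
    (hh : ∀ (i : ℕ) (a : B), a ∈ Gr B i → h a ∈ Gr C i) {n : ℕ} (hn : Odd n) {c : C}
    (hc : c ∈ Gr C n) : Adj B →ₐ[ℚ] C :=
  AlgHom.ofLinearMap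
    { toFun := fun u => h u.1 + h u.2 * c
      map_add' := fun u v => by simp [add_mul]; abel
      map_smul' := fun r u => by simp }
    (by change h (1 : B) + h (0 : B) * c = 1; simp)
    (fun u v => by
      change h (u.1 * v.1) + h (u.1 * v.2 + u.2 * par B v.1) * c =
        (h u.1 + h u.2 * c) * (h v.1 + h v.2 * c)
      have h₁ : h v.1 * c = c * h (par B v.1) := by rw [map_par h hh]; exact mul_odd hn hc _
      have h₂ : c * h (par B v.1) = h v.1 * c := h₁.symm
      have h₃ : c * h v.1 = h (par B v.1) * c := by
        rw [map_par h hh, mul_odd hn hc, par_par]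
      have h₄ : c * (h v.2 * c) = 0 := by
        rw [mul_odd hn hc, ← mul_assoc, odd_sq hn hc, zero_mul]
      simp only [map_add, map_mul, add_mul, mul_add, mul_assoc, h₃, h₄, mul_zero, add_zero]
      abel)

theorem lift_apply {C : Type} [GCDGA C] (h : B →ₐ[ℚ] C)
    (hh : ∀ (i : ℕ) (a : B), a ∈ Gr B i → h a ∈ Gr C i) {c : C}
    (hc : c ∈ Gr C n) (u : Adj B) : lift h hh hn hc u = h u.1 + h u.2 * c := rfl

theorem isDGAHom_lift {C : Type} [GCDGA C] (h : B →ₐ[ℚ] C) (hh : IsDGAHom h) {c : C}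
    (hc : c ∈ Gr C n) (hdc : Dd C c = h f) :
    let _ := gcdga hn hf hdf; IsDGAHom (lift h hh.2 hn hc) := by
  let _ := gcdga hn hf hdf
  refine ⟨fun u => ?_, fun i u hu => ?_⟩
  · change lift h hh.2 hn hc (diff f u) = _
    rw [lift_apply, lift_apply, diff_apply, map_add (Dd C), Dd_mul', hdc]
    simp only [map_add, map_mul, hh.1, map_par h hh.2]
    abel
  · change u ∈ gr B n i at hu
    rw [lift_apply]
    refine add_mem (hh.2 _ _ hu.1) ?_
    rcases shift_cases hu.2 with h' | ⟨k, rfl, h'⟩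
    · rw [show u.2 = 0 from h']; simp
    · exact mul_mem_gr (hh.2 _ _ h') hc

end Structure

end Adj

/-! ### Quotients -/

section Quotient

variable {A : Type} [GCDGA A] {Q : Type} [Ring Q] [Algebra ℚ Q]

/-- The map induced on the target of a surjection by a linear map killing the kernel. -/
def descend {A Q X : Type} [Ring A] [Algebra ℚ A] [Ring Q] [Algebra ℚ Q] [AddCommGroup X]
    [Module ℚ X] (ρ : A →ₐ[ℚ] Q)
    (hρ : Function.Surjective ρ) (f : A →ₗ[ℚ] X) (hf : ∀ a, ρ a = 0 → f a = 0) : Q →ₗ[ℚ] X :=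
  have key : ∀ a b, ρ a = ρ b → f a = f b := fun a b h => by
    have := hf (a - b) (by rw [map_sub, h, sub_self])
    rwa [map_sub, sub_eq_zero] at this
  { toFun := fun x => f (Function.surjInv hρ x)
    map_add' := fun x y => by
      rw [← map_add]
      exact key _ _ (by simp [Function.surjInv_eq])
    map_smul' := fun c x => by
      rw [RingHom.id_apply, ← map_smul]
      exact key _ _ (by simp [Function.surjInv_eq]) }

theorem descend_apply {A Q X : Type} [Ring A] [Algebra ℚ A] [Ring Q] [Algebra ℚ Q] [AddCommGroup X]
    [Module ℚ X] (ρ : A →ₐ[ℚ] Q)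
    (hρ : Function.Surjective ρ) (f : A →ₗ[ℚ] X) (hf : ∀ a, ρ a = 0 → f a = 0) (a : A) :
    descend ρ hρ f hf (ρ a) = f a := by
  change f (Function.surjInv hρ (ρ a)) = f a
  rw [← sub_eq_zero, ← map_sub]
  exact hf _ (by rw [map_sub, Function.surjInv_eq hρ, sub_self])

theorem descend_comp_apply (ρ : A →ₐ[ℚ] Q) (hρ : Function.Surjective ρ) (f : A →ₗ[ℚ] A)
    (hf : ∀ a, ρ a = 0 → ρ (f a) = 0) (a : A) :
    descend ρ hρ (ρ.toLinearMap ∘ₗ f) hf (ρ a) = ρ (f a) :=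
  descend_apply ρ hρ (ρ.toLinearMap ∘ₗ f) hf a

/-- The gcdga structure on a quotient of a gcdga by a homogeneous differential ideal. -/
@[reducible]
def gcdgaOfSurjective (ρ : A →ₐ[ℚ] Q) (hρ : Function.Surjective ρ)
    (hp : ∀ i a, ρ a = 0 → ρ (pr A i a) = 0) (hd : ∀ a, ρ a = 0 → ρ (Dd A a) = 0) : GCDGA Q where
  grading i := (Gr A i).map ρ.toLinearMap
  gradedAlgebra := gradedAlgebraOfProj _ ⟨1, one_mem_gr, map_one ρ⟩
    (by
      rintro i j _ _ ⟨a, ha, rfl⟩ ⟨b, hb, rfl⟩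
      exact ⟨a * b, mul_mem_gr ha hb, map_mul ρ a b⟩)
    (fun i => descend ρ hρ (ρ.toLinearMap ∘ₗ pr A i) (hp i))
    (by
      rintro i _ ⟨a, ha, rfl⟩
      exact (descend_comp_apply ρ hρ _ _ a).trans (congrArg ρ (pr_same ha)))
    (by
      rintro i j hij _ ⟨a, ha, rfl⟩
      exact (descend_comp_apply ρ hρ _ _ a).trans ((congrArg ρ (pr_ne ha hij)).trans (map_zero ρ)))
    (by
      intro x
      obtain ⟨a, rfl⟩ := hρ x
      have := Submodule.mem_map_of_mem (f := ρ.toLinearMap) (mem_iSup_gr a)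
      rwa [Submodule.map_iSup] at this)
  grading_comm := by
    rintro i j _ _ ⟨a, ha, rfl⟩ ⟨b, hb, rfl⟩
    have := congrArg ρ (gr_comm ha hb)
    rwa [map_smul, map_mul, map_mul] at this
  d := descend ρ hρ (ρ.toLinearMap ∘ₗ Dd A) hd
  d_sq := by
    intro x
    obtain ⟨a, rfl⟩ := hρ x
    rw [descend_comp_apply, descend_comp_apply, Dd_sq, map_zero]
  d_grading := by
    rintro i _ ⟨a, ha, rfl⟩
    exact ⟨Dd A a, Dd_mem ha, (descend_comp_apply ρ hρ _ _ a).symm⟩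
  d_leibniz := by
    rintro i _ x ⟨a, ha, rfl⟩
    obtain ⟨b, rfl⟩ := hρ x
    change descend ρ hρ (ρ.toLinearMap ∘ₗ Dd A) hd (ρ a * ρ b) =
      descend ρ hρ (ρ.toLinearMap ∘ₗ Dd A) hd (ρ a) * ρ b + ((-1 : ℚ) ^ i) •
        (ρ a * descend ρ hρ (ρ.toLinearMap ∘ₗ Dd A) hd (ρ b))
    rw [← map_mul, descend_comp_apply, descend_comp_apply, descend_comp_apply, Dd_mul ha]
    simp

theorem exists_quotient (K : Submodule ℚ A) (hl : ∀ a, ∀ k ∈ K, a * k ∈ K)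
    (hr : ∀ a, ∀ k ∈ K, k * a ∈ K) (hp : ∀ i, ∀ k ∈ K, pr A i k ∈ K)
    (hd : ∀ k ∈ K, Dd A k ∈ K) :
    ∃ (Q : Type) (_ : GCDGA Q) (ρ : A →ₐ[ℚ] Q), IsDGAHom ρ ∧ Function.Surjective ρ ∧
      LinearMap.ker ρ.toLinearMap = K := by
  let I : Ideal A := { K with smul_mem' := fun a k hk => hl a k hk }
  have : I.IsTwoSided := ⟨fun {a} b ha => hr b a ha⟩
  let ρ : A →ₐ[ℚ] A ⧸ I := Ideal.Quotient.mkₐ ℚ I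
  have hρ : Function.Surjective ρ := Ideal.Quotient.mkₐ_surjective ℚ I
  have hker : ∀ a, ρ a = 0 ↔ a ∈ K := fun a => Ideal.Quotient.eq_zero_iff_mem
  have hp' : ∀ i a, ρ a = 0 → ρ (pr A i a) = 0 := fun i a h => (hker _).2 (hp i a ((hker a).1 h))
  have hd' : ∀ a, ρ a = 0 → ρ (Dd A a) = 0 := fun a h => (hker _).2 (hd a ((hker a).1 h))
  refine ⟨A ⧸ I, gcdgaOfSurjective ρ hρ hp' hd', ρ,
    ⟨fun a => (descend_comp_apply ρ hρ (Dd A) hd' a).symm, fun i a ha => ⟨a, ha, rfl⟩⟩, hρ, ?_⟩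
  ext a
  exact hker a

end Quotient

/-! ### Polynomial algebras on even generators -/

section Poly

variable {σ : Type} {w : σ → ℕ}

theorem even_weight (hw : ∀ s, Even (w s)) {i : ℕ} {p : MvPolynomial σ ℚ}
    (hp : MvPolynomial.IsWeightedHomogeneous w p i) (h0 : p ≠ 0) : Even i := by
  obtain ⟨e, he⟩ := MvPolynomial.ne_zero_iff.1 h0
  rw [← hp he, Finsupp.weight_apply, Finsupp.sum]
  exact Finset.even_sum _ fun s _ => (hw s).mul_left _

/-- The polynomial algebra on generators of even degree, with zero differential. -/
@[reducible]
def polyGCDGA (hw : ∀ s, Even (w s)) : GCDGA (MvPolynomial σ ℚ) where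
  grading := MvPolynomial.weightedHomogeneousSubmodule ℚ w
  gradedAlgebra := MvPolynomial.weightedGradedAlgebra ℚ w
  grading_comm := by
    intro i j a b ha hb
    rcases eq_or_ne a 0 with rfl | h0
    · simp
    · rw [((even_weight hw ha h0).mul_right j).neg_one_pow, one_smul, mul_comm]
  d := 0
  d_sq _ := rfl
  d_grading _ _ _ := zero_mem _
  d_leibniz := by intros; simp

/-- The algebra morphism out of a polynomial algebra given by even elements of a gcdga. -/
def polyLift {C : Type} [GCDGA C] (hw : ∀ s, Even (w s)) (c : σ → C)
    (hc : ∀ s, c s ∈ Gr C (w s)) : MvPolynomial σ ℚ →ₐ[ℚ] C :=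
  (Subalgebra.center ℚ C).val.comp
    (MvPolynomial.aeval fun s => (⟨c s, Subalgebra.mem_center_iff.2 fun b =>
      (even_comm (hw s) (hc s) b).symm⟩ : Subalgebra.center ℚ C))

section

variable {C : Type} [GCDGA C]

@[simp] theorem polyLift_X (hw : ∀ s, Even (w s)) {c : σ → C} (hc : ∀ s, c s ∈ Gr C (w s))
    (s : σ) : polyLift hw c hc (MvPolynomial.X s) = c s := by
  simp [polyLift]

variable {h : MvPolynomial σ ℚ →ₐ[ℚ] C}

theorem poly_mem (hc : ∀ s, h (MvPolynomial.X s) ∈ Gr C (w s)) {i : ℕ} {p : MvPolynomial σ ℚ}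
    (hp : MvPolynomial.IsWeightedHomogeneous w p i) : h p ∈ Gr C i := by
  have hmon : ∀ e : σ →₀ ℕ, h (MvPolynomial.monomial e 1) ∈ Gr C (Finsupp.weight w e) := by
    intro e
    induction e using Finsupp.induction_linear with
    | zero => simpa using one_mem_gr
    | add e f he hf =>
      rw [map_add, ← one_mul (1 : ℚ), ← MvPolynomial.monomial_mul, map_mul]
      exact mul_mem_gr he hf
    | single s n =>
      rw [← MvPolynomial.X_pow_eq_monomial, map_pow, Finsupp.weight_single]
      exact SetLike.pow_mem_graded n (hc s)
  rw [p.as_sum, map_sum]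
  refine Submodule.sum_mem _ fun e he => ?_
  rw [← mul_one (p.coeff e), ← smul_eq_mul, ← MvPolynomial.smul_monomial, map_smul,
    ← hp (MvPolynomial.mem_support_iff.1 he)]
  exact Submodule.smul_mem _ _ (hmon e)

theorem poly_central (hw : ∀ s, Even (w s)) (hc : ∀ s, h (MvPolynomial.X s) ∈ Gr C (w s))
    (p : MvPolynomial σ ℚ) (b : C) : h p * b = b * h p := by
  induction p using MvPolynomial.induction_on with
  | C a =>
    rw [← MvPolynomial.algebraMap_eq, AlgHom.commutes]
    exact Algebra.commutes a b
  | add p q hp hq => rw [map_add, add_mul, mul_add, hp, hq]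
  | mul_X p s hp => rw [map_mul, mul_assoc, even_comm (hw s) (hc s), ← mul_assoc, hp, mul_assoc]

theorem poly_par (hw : ∀ s, Even (w s)) (hc : ∀ s, h (MvPolynomial.X s) ∈ Gr C (w s))
    (p : MvPolynomial σ ℚ) : par C (h p) = h p := by
  have : (par C).comp h = h := MvPolynomial.algHom_ext fun s => par_of_even (hw s) (hc s)
  exact DFunLike.congr_fun this p

theorem poly_closed (hd : ∀ s, Dd C (h (MvPolynomial.X s)) = 0) (p : MvPolynomial σ ℚ) :
    Dd C (h p) = 0 := by
  induction p using MvPolynomial.induction_on with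
  | C a =>
    rw [← MvPolynomial.algebraMap_eq, AlgHom.commutes, Algebra.algebraMap_eq_smul_one, map_smul,
      Dd_one, smul_zero]
  | add p q hp hq => rw [map_add, map_add, hp, hq, add_zero]
  | mul_X p s hp => rw [map_mul, Dd_mul', hp, hd]; simp

theorem isDGAHom_poly (hw : ∀ s, Even (w s)) (hc : ∀ s, h (MvPolynomial.X s) ∈ Gr C (w s))
    (hd : ∀ s, Dd C (h (MvPolynomial.X s)) = 0) :
    let _ := polyGCDGA hw
    IsDGAHom h :=
  let _ := polyGCDGA hw
  ⟨fun p => (map_zero _).trans (poly_closed hd p).symm, fun _ _ hp => poly_mem hc hp⟩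

end

end Poly

theorem exists_sum_pr {A : Type} [GCDGA A] (a : A) :
    ∃ N, ∀ M, N ≤ M → ∑ i ∈ Finset.range M, pr A i a = a := by
  induction a using gr_induction with
  | hom i x hx =>
    refine ⟨i + 1, fun M hM => ?_⟩
    rw [Finset.sum_eq_single_of_mem i (Finset.mem_range.2 hM) fun j _ hj => pr_ne hx hj.symm,
      pr_same hx]
  | add x y hx hy =>
    obtain ⟨N, hN⟩ := hx
    obtain ⟨N', hN'⟩ := hy
    refine ⟨max N N', fun M hM => ?_⟩
    simp only [map_add, Finset.sum_add_distrib]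
    rw [hN M (le_trans (le_max_left _ _) hM), hN' M (le_trans (le_max_right _ _) hM)]

/-! ### Pullbacks and homotopy retractions -/

section Pullback

variable {T Q B : Type} [GCDGA T] [GCDGA Q] [GCDGA B]

/-- The fibre product of two morphisms with the same target. -/
abbrev Pullback (φ : T →ₐ[ℚ] B) (χ : Q →ₐ[ℚ] B) : Type :=
  AlgHom.equalizer (φ.comp (AlgHom.fst ℚ T Q)) (χ.comp (AlgHom.snd ℚ T Q))

namespace Pullback

variable {φ : T →ₐ[ℚ] B} {χ : Q →ₐ[ℚ] B}

/-- The linear endomorphism of a pullback induced by compatible linear maps. -/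
def map (f : T →ₗ[ℚ] T) (g : Q →ₗ[ℚ] Q) (h : ∀ t q, φ t = χ q → φ (f t) = χ (g q)) :
    Pullback φ χ →ₗ[ℚ] Pullback φ χ where
  toFun u := ⟨(f u.1.1, g u.1.2), h _ _ u.2⟩
  map_add' _ _ := Subtype.ext (Prod.ext (map_add f _ _) (map_add g _ _))
  map_smul' _ _ := Subtype.ext (Prod.ext (map_smul f _ _) (map_smul g _ _))

/-- The grading of a pullback. -/
def gr (φ : T →ₐ[ℚ] B) (χ : Q →ₐ[ℚ] B) (i : ℕ) : Submodule ℚ (Pullback φ χ) where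
  carrier := {u | u.1.1 ∈ Gr T i ∧ u.1.2 ∈ Gr Q i}
  zero_mem' := ⟨zero_mem _, zero_mem _⟩
  add_mem' hu hv := ⟨add_mem hu.1 hv.1, add_mem hu.2 hv.2⟩
  smul_mem' c _ hu := ⟨Submodule.smul_mem _ c hu.1, Submodule.smul_mem _ c hu.2⟩

/-- The homogeneous projections of a pullback. -/
def proj (hφ : IsDGAHom φ) (hχ : IsDGAHom χ) (i : ℕ) : Pullback φ χ →ₗ[ℚ] Pullback φ χ :=
  map (pr T i) (pr Q i) fun t q h => by
    rw [map_pr_alg φ hφ.2, map_pr_alg χ hχ.2, h]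

theorem mem_iSup_of_snd (hφ : IsDGAHom φ) (hχ : IsDGAHom χ) (u : Pullback φ χ) :
    u ∈ ⨆ i, gr φ χ i := by
  obtain ⟨N, hN⟩ := exists_sum_pr u.1.1
  obtain ⟨N', hN'⟩ := exists_sum_pr u.1.2
  have h : ∑ i ∈ Finset.range (max N N'), proj hφ hχ i u = u := by
    refine Subtype.ext (Prod.ext ?_ ?_)
    · rw [AddSubmonoidClass.coe_finsetSum, Prod.fst_sum]
      exact hN _ (le_max_left _ _)
    · rw [AddSubmonoidClass.coe_finsetSum, Prod.snd_sum]
      exact hN' _ (le_max_right _ _)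
  rw [← h]
  exact Submodule.sum_mem _ fun i _ => Submodule.mem_iSup_of_mem i ⟨pr_mem i _, pr_mem i _⟩

/-- The gcdga structure on a pullback. -/
@[reducible]
def gcdga (hφ : IsDGAHom φ) (hχ : IsDGAHom χ) : GCDGA (Pullback φ χ) where
  grading := gr φ χ
  gradedAlgebra := gradedAlgebraOfProj _ ⟨one_mem_gr, one_mem_gr⟩
    (fun i j a b ha hb => ⟨mul_mem_gr ha.1 hb.1, mul_mem_gr ha.2 hb.2⟩) (proj hφ hχ)
    (fun i a ha => Subtype.ext (Prod.ext (pr_same ha.1) (pr_same ha.2)))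
    (fun i j hij a ha => Subtype.ext (Prod.ext (pr_ne ha.1 hij) (pr_ne ha.2 hij)))
    (mem_iSup_of_snd hφ hχ)
  grading_comm i j a b ha hb :=
    Subtype.ext (Prod.ext (gr_comm ha.1 hb.1) (gr_comm ha.2 hb.2))
  d := map (Dd T) (Dd Q) fun t q h => by rw [hφ.1, hχ.1, h]
  d_sq a := Subtype.ext (Prod.ext (Dd_sq _) (Dd_sq _))
  d_grading i a ha := ⟨Dd_mem ha.1, Dd_mem ha.2⟩
  d_leibniz i a b ha := Subtype.ext (Prod.ext (Dd_mul ha.1 _) (Dd_mul ha.2 _))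

end Pullback

/-- A surjective morphism of gcdga's has a homotopy retraction as soon as some surjective
quasi-isomorphism factors through it. -/
theorem nonempty_htpyRetraction {φ : T →ₐ[ℚ] B} (hφ : IsDGAHom φ)
    (hφs : Function.Surjective φ) (hφq : QuasiIso φ) {ρ : T →ₐ[ℚ] Q} (hρ : IsDGAHom ρ)
    (hρs : Function.Surjective ρ) (hker : ∀ t, ρ t = 0 → φ t = 0) :
    Nonempty (HtpyRetraction ρ) := by
  let χ₀ : Q →ₗ[ℚ] B := descend ρ hρs φ.toLinearMap hker
  have hχ₀ : ∀ t, χ₀ (ρ t) = φ t := fun t => descend_apply ρ hρs φ.toLinearMap hker t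
  let χ : Q →ₐ[ℚ] B := AlgHom.ofLinearMap χ₀ (by rw [← map_one ρ, hχ₀, map_one])
    (fun x y => by
      obtain ⟨a, rfl⟩ := hρs x
      obtain ⟨b, rfl⟩ := hρs y
      rw [← map_mul, hχ₀, hχ₀, hχ₀, map_mul])
  have hχρ : ∀ t, χ (ρ t) = φ t := hχ₀
  have hχ : IsDGAHom χ := by
    refine ⟨fun x => ?_, fun i x hx => ?_⟩
    · obtain ⟨a, rfl⟩ := hρs x
      rw [← hρ.1, hχρ, hχρ, hφ.1]
    · obtain ⟨a, rfl⟩ := hρs x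
      rw [← pr_same hx, ← map_pr_alg ρ hρ.2, hχρ]
      exact hφ.2 _ _ (pr_mem i a)
  let _ := Pullback.gcdga hφ hχ
  have hd : ∀ u : Pullback φ χ, (Dd (Pullback φ χ) u).1 = (Dd T u.1.1, Dd Q u.1.2) :=
    fun _ => rfl
  refine ⟨{
    C := Pullback φ χ
    j := ((AlgHom.id ℚ T).prod ρ).codRestrict _ fun t => (hχρ t).symm
    q := (AlgHom.snd ℚ T Q).comp (Subalgebra.val _)
    τ := (AlgHom.fst ℚ T Q).comp (Subalgebra.val _)
    j_dga := ⟨fun t => Subtype.ext (Prod.ext rfl (hρ.1 t)), fun i t ht => ⟨ht, hρ.2 i t ht⟩⟩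
    q_dga := ⟨fun _ => rfl, fun _ _ h => h.2⟩
    τ_dga := ⟨fun _ => rfl, fun _ _ h => h.1⟩
    q_surj := fun x => ?_
    q_quasi := ⟨fun x hx => ?_, fun u hu => ?_⟩
    hqj := rfl
    hτj := rfl }⟩
  · obtain ⟨t, ht⟩ := hφs (χ x)
    exact ⟨⟨(t, x), ht⟩, rfl⟩
  · obtain ⟨t, ht, b, hb⟩ := hφq.1 (χ x) (by rw [← hχ.1, hx, map_zero])
    obtain ⟨s, rfl⟩ := hφs b
    have h : φ (t - Dd T s) = χ x := by
      rw [map_sub, hφ.1, ← hb, sub_sub_cancel]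
    refine ⟨⟨(t - Dd T s, x), h⟩, Subtype.ext (Prod.ext ?_ hx), 0, ?_⟩
    · change Dd T (t - Dd T s) = 0
      rw [map_sub, ht, Dd_sq, sub_zero]
    · rw [map_zero]; exact sub_self x
  · rintro ⟨x, hx⟩
    obtain ⟨⟨t, x'⟩, htx⟩ := u
    change x' = Dd Q x at hx
    subst hx
    have htx : φ t = χ (Dd Q x) := htx
    have ht : Dd T t = 0 := congrArg (fun v : Pullback φ χ => v.1.1) hu
    obtain ⟨s, rfl⟩ := hφq.2 t ht ⟨χ x, by rw [htx, hχ.1]⟩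
    obtain ⟨s', hs', b, hb⟩ := hφq.1 (φ s - χ x) (by
      rw [map_sub, ← hφ.1, ← hχ.1, htx, sub_self])
    obtain ⟨s'', rfl⟩ := hφs b
    refine ⟨⟨(s - s' + Dd T s'', x), ?_⟩, Subtype.ext (Prod.ext ?_ rfl)⟩
    · change φ (s - s' + Dd T s'') = χ x
      rw [map_add, map_sub, hφ.1, ← hb]
      abel
    · change Dd T s = Dd T (s - s' + Dd T s'')
      rw [map_add, map_sub, hs', Dd_sq, sub_zero, add_zero]

end Pullback

/-! ### Koszul complexes -/

/-- A complex of `P`-modules: a module with a differential of degree `-1` and a system of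
homogeneous projections. -/
structure Cx (P : Type) [CommRing P] where
  /-- The total module. -/
  M : Type
  [acg : AddCommGroup M]
  [mod : Module P M]
  /-- The differential. -/
  d : M →ₗ[P] M
  d_d : ∀ z, d (d z) = 0
  /-- The projection onto the part of degree `i`. -/
  proj : ℤ → M →ₗ[P] M
  proj_proj : ∀ i z, proj i (proj i z) = proj i z
  d_proj : ∀ i z, d (proj i z) = proj (i - 1) (d z)
  sum_proj : ∃ S : Finset ℤ, ∀ S', S ⊆ S' → ∀ z, ∑ i ∈ S', proj i z = z

attribute [instance] Cx.acg Cx.mod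

namespace Cx

variable {P : Type} [CommRing P]

/-- The mapping cone of multiplication by `g`. -/
def cone (g : P) (K : Cx P) : Cx P where
  M := K.M × K.M
  d := LinearMap.prod (K.d ∘ₗ LinearMap.fst P K.M K.M + g • LinearMap.snd P K.M K.M)
    (-(K.d ∘ₗ LinearMap.snd P K.M K.M))
  d_d z := by ext <;> simp [K.d_d]
  proj i := LinearMap.prodMap (K.proj i) (K.proj (i - 1))
  proj_proj i z := by ext <;> simp [K.proj_proj]
  d_proj i z := by ext <;> simp [K.d_proj]
  sum_proj := by
    obtain ⟨S, hS⟩ := K.sum_proj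
    refine ⟨S ∪ S.image (· + 1), fun S' hS' z => Prod.ext ?_ ?_⟩
    · rw [Prod.fst_sum]
      exact hS S' (Finset.union_subset_left hS') z.1
    · rw [Prod.snd_sum, ← hS (S'.image (· - 1)) (fun i hi => Finset.mem_image.2
        ⟨i + 1, hS' (Finset.mem_union_right _ (Finset.mem_image_of_mem _ hi)), by simp⟩) z.2,
        Finset.sum_image (fun _ _ _ _ h => by simpa using h)]
      rfl

/-- The base ring as a complex concentrated in degree `0`. -/
def base (P : Type) [CommRing P] : Cx P where
  M := P
  d := 0
  d_d _ := rfl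
  proj i := if i = 0 then LinearMap.id else 0
  proj_proj i z := by split_ifs <;> simp
  d_proj i z := by simp
  sum_proj := ⟨{0}, fun S' hS' z => by
    rw [Finset.sum_eq_single_of_mem 0 (hS' (by simp)) fun i _ hi => by simp [hi]]
    simp⟩

/-- The Koszul complex of a list of elements. -/
def koszul : List P → Cx P
  | [] => base P
  | g :: L => cone g (koszul L)

theorem koszul_nil_proj {i : ℤ} (hi : i ≠ 0) (z : (koszul ([] : List P)).M) :
    (koszul ([] : List P)).proj i z = 0 := by
  change (if i = 0 then LinearMap.id else 0 : P →ₗ[P] P) z = 0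
  rw [if_neg hi]
  rfl

/-- Vanishing of homology in degree `i`. -/
def Exact (K : Cx P) (i : ℤ) : Prop :=
  ∀ z, K.proj i z = z → K.d z = 0 → ∃ w, K.proj (i + 1) w = w ∧ K.d w = z

theorem cone_exact_of_lift {K : Cx P} {g : P} {i : ℤ} (hK : K.Exact i)
    (h : ∀ a b, K.proj i a = a → K.proj (i - 1) b = b → K.d a + g • b = 0 → K.d b = 0 →
      ∃ w, K.proj i w = w ∧ K.d w = b) : (cone g K).Exact i := by
  rintro ⟨a, b⟩ hz hdz
  have hz1 : K.proj i a = a := congrArg Prod.fst hz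
  have hz2 : K.proj (i - 1) b = b := congrArg Prod.snd hz
  have hd1 : K.d a + g • b = 0 := congrArg Prod.fst hdz
  have hd2 : -K.d b = 0 := congrArg Prod.snd hdz
  obtain ⟨w, hw, rfl⟩ := h a b hz1 hz2 hd1 (neg_eq_zero.1 hd2)
  obtain ⟨v, hv, hdv⟩ := hK (a + g • w) (by rw [map_add, map_smul, hz1, hw])
    (by rw [map_add, map_smul, hd1])
  refine ⟨(v, -w), Prod.ext hv ?_, Prod.ext ?_ ?_⟩
  · change K.proj (i + 1 - 1) (-w) = -w
    rw [add_sub_cancel_right, map_neg, hw]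
  · change K.d v + g • -w = a
    rw [hdv, smul_neg, add_neg_cancel_right]
  · change -K.d (-w) = K.d w
    rw [map_neg, neg_neg]

theorem cone_exact {K : Cx P} {g : P} {i : ℤ} (hK : K.Exact i) (hK' : K.Exact (i - 1)) :
    (cone g K).Exact i :=
  cone_exact_of_lift hK fun _ b _ hb _ hdb => by
    obtain ⟨w, hw, hdw⟩ := hK' b hb hdb
    exact ⟨w, by rwa [sub_add_cancel] at hw, hdw⟩

theorem koszul_append_exact {L : List P} (hL : ∀ i, 0 < i → (koszul L).Exact i) (G : List P) :
    ∀ i : ℤ, G.length < i → (koszul (G ++ L)).Exact i := by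
  induction G with
  | nil => simpa using hL
  | cons g G ih =>
    intro i hi
    rw [List.length_cons, Nat.cast_succ] at hi
    exact cone_exact (ih i (by omega)) (ih (i - 1) (by omega))

/-! #### The bottom of the Koszul complex -/

/-- The coefficient of `1`. -/
def aug : (L : List P) → (koszul L).M →ₗ[P] P
  | [] => LinearMap.id
  | _ :: L => (aug L) ∘ₗ LinearMap.fst P (koszul L).M (koszul L).M

/-- The inclusion of scalars. -/
def unit : (L : List P) → P →ₗ[P] (koszul L).M
  | [] => LinearMap.id
  | _ :: L => LinearMap.inl P (koszul L).M (koszul L).M ∘ₗ unit L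

theorem unit_cons (g : P) (L : List P) (p : P) : unit (g :: L) p = (unit L p, 0) := rfl

theorem aug_cons (g : P) (L : List P) (a b : (koszul L).M) :
    aug (g :: L) ((a, b) : (koszul L).M × (koszul L).M) = aug L a := rfl

theorem aug_unit (L : List P) (p : P) : aug L (unit L p) = p := by
  induction L with
  | nil => rfl
  | cons g L ih => rw [unit_cons, aug_cons, ih]

theorem proj_neg (L : List P) : ∀ (i : ℤ) (_ : i < 0) (z), (koszul L).proj i z = 0 := by
  induction L with
  | nil => exact fun i hi z => koszul_nil_proj hi.ne z
  | cons g L ih =>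
    rintro i hi ⟨a, b⟩
    exact Prod.ext (ih i hi a) (ih (i - 1) (by omega) b)

theorem proj_zero (L : List P) (z : (koszul L).M) :
    (koszul L).proj 0 z = unit L (aug L z) := by
  induction L with
  | nil => rfl
  | cons g L ih =>
    obtain ⟨a, b⟩ := z
    exact Prod.ext (ih a) (proj_neg L (0 - 1) (by omega) b)

theorem d_unit (L : List P) (p : P) : (koszul L).d (unit L p) = 0 := by
  have h := (koszul L).d_proj 0 (unit L p)
  rwa [proj_zero, aug_unit, proj_neg L _ (by omega)] at h

theorem exists_d_eq_unit_iff (L : List P) (p : P) :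
    (∃ w, (koszul L).proj 1 w = w ∧ (koszul L).d w = unit L p) ↔
      p ∈ Ideal.span {x | x ∈ L} := by
  induction L generalizing p with
  | nil =>
    have h0 : {x : P | x ∈ []} = ∅ := by ext; simp
    rw [h0, Ideal.span_empty, Ideal.mem_bot]
    constructor
    · rintro ⟨w, -, hw⟩
      exact hw.symm
    · rintro rfl
      exact ⟨0, map_zero _, by simp⟩
  | cons g L ih =>
    have hs : {x | x ∈ g :: L} = insert g {x | x ∈ L} := by ext; simp
    rw [hs, Ideal.mem_span_insert]
    constructor
    · rintro ⟨⟨a, b⟩, hw, hd⟩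
      have hw1 : (koszul L).proj 1 a = a := congrArg Prod.fst hw
      have hw2 : (koszul L).proj (1 - 1) b = b := congrArg Prod.snd hw
      have hd1 : (koszul L).d a + g • b = unit L p := congrArg Prod.fst hd
      rw [sub_self, proj_zero] at hw2
      refine ⟨aug L b, p - aug L b * g, (ih _).1 ⟨a, hw1, ?_⟩, by ring⟩
      rw [map_sub, ← hd1, mul_comm, ← smul_eq_mul, map_smul, hw2, add_sub_cancel_right]
    · rintro ⟨c, q, hq, rfl⟩
      obtain ⟨w, hw, hd⟩ := (ih q).2 hq
      refine ⟨(w, unit L c), Prod.ext hw ?_, Prod.ext ?_ ?_⟩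
      · change (koszul L).proj (1 - 1) (unit L c) = unit L c
        rw [sub_self, proj_zero, aug_unit]
      · change (koszul L).d w + g • unit L c = unit L (c * g + q)
        rw [hd, ← map_smul, smul_eq_mul, map_add, mul_comm g, add_comm]
      · change -(koszul L).d (unit L c) = 0
        rw [d_unit, neg_zero]

/-! #### Sequences of variables -/

theorem koszul_variables_exact {σ : Type} (l : List σ) (hl : l.Nodup) : ∀ i : ℤ, 0 < i →
    (koszul (l.map (MvPolynomial.X : σ → MvPolynomial σ ℚ))).Exact i := by
  induction l with
  | nil =>
    intro i hi z hz _
    have : z = 0 := by rw [← hz]; exact koszul_nil_proj hi.ne' z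
    exact ⟨0, map_zero _, by rw [map_zero, this]⟩
  | cons s l ih =>
    intro i hi
    obtain ⟨hs, hl⟩ := List.nodup_cons.1 hl
    refine cone_exact_of_lift (ih hl i hi) fun a b ha hb hab hdb => ?_
    rcases (show i = 1 ∨ 0 < i - 1 by omega) with rfl | h
    · rw [sub_self, proj_zero] at hb
      rw [← hb, exists_d_eq_unit_iff]
      have h1 := (exists_d_eq_unit_iff _ (MvPolynomial.X s * aug _ b)).1
        ⟨-a, by rw [map_neg, ha], by
        rw [map_neg, eq_comm, eq_neg_iff_add_eq_zero, add_comm, ← hab, ← hb, ← map_smul,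
          smul_eq_mul, hb]⟩
      have hset : {x | x ∈ l.map (MvPolynomial.X : σ → MvPolynomial σ ℚ)} =
        MvPolynomial.X '' {t | t ∈ l} := by ext; simp
      rw [hset, MvPolynomial.mem_ideal_span_X_image] at h1 ⊢
      intro m hm
      obtain ⟨t, ht, htm⟩ := h1 (m + Finsupp.single s 1) (by
        rw [MvPolynomial.mem_support_iff] at hm ⊢
        rwa [mul_comm, MvPolynomial.coeff_mul_X])
      refine ⟨t, ht, ?_⟩
      have hts : s ≠ t := fun h => hs (h ▸ ht)
      rwa [Finsupp.add_apply, Finsupp.single_eq_of_ne hts.symm, add_zero] at htm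
    · obtain ⟨w, hw, hdw⟩ := ih hl (i - 1) h b hb hdb
      exact ⟨w, by rwa [sub_add_cancel] at hw, hdw⟩

/-! #### Elements of the ideal act trivially in homology -/

theorem exists_homotopy (L : List P) {h : P} (hh : h ∈ Ideal.span {x | x ∈ L}) :
    ∃ s : (koszul L).M →ₗ[P] (koszul L).M,
      (∀ i z, s ((koszul L).proj i z) = (koszul L).proj (i + 1) (s z)) ∧
      ∀ z, (koszul L).d (s z) + s ((koszul L).d z) = h • z := by
  induction hh using Submodule.span_induction with
  | zero => exact ⟨0, by simp, by simp⟩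
  | add x y _ _ hx hy =>
    obtain ⟨s, hs, hs'⟩ := hx
    obtain ⟨t, ht, ht'⟩ := hy
    refine ⟨s + t, fun i z => by simp [hs, ht], fun z => ?_⟩
    rw [add_smul, ← hs', ← ht', LinearMap.add_apply, LinearMap.add_apply, map_add]
    abel
  | smul c x _ hx =>
    obtain ⟨s, hs, hs'⟩ := hx
    refine ⟨c • s, fun i z => by simp [hs], fun z => ?_⟩
    rw [smul_eq_mul, mul_smul, ← hs', LinearMap.smul_apply, LinearMap.smul_apply, map_smul,
      smul_add]
  | mem h hh =>
    induction L with
    | nil => simp at hh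
    | cons g L ih =>
      rcases List.mem_cons.1 hh with rfl | hh
      · refine ⟨LinearMap.inr P _ _ ∘ₗ LinearMap.fst P _ _, ?_, ?_⟩
        · rintro i ⟨a, b⟩
          refine Prod.ext (map_zero ((koszul L).proj (i + 1))).symm ?_
          change (koszul L).proj i a = (koszul L).proj (i + 1 - 1) a
          rw [add_sub_cancel_right]
        · rintro ⟨a, b⟩
          refine Prod.ext ?_ ?_
          · change (koszul L).d 0 + h • a + 0 = h • a
            rw [map_zero, zero_add, add_zero]
          · change -(koszul L).d a + ((koszul L).d a + h • b) = h • b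
            rw [neg_add_cancel_left]
      · obtain ⟨s, hs, hs'⟩ := ih hh
        refine ⟨LinearMap.prodMap s (-s), ?_, ?_⟩
        · rintro i ⟨a, b⟩
          refine Prod.ext (hs i a) ?_
          change -s ((koszul L).proj (i - 1) b) = (koszul L).proj (i + 1 - 1) (-s b)
          rw [hs, map_neg, sub_add_cancel, add_sub_cancel_right]
        · rintro ⟨a, b⟩
          refine Prod.ext ?_ ?_
          · change (koszul L).d (s a) + g • -s b + s ((koszul L).d a + g • b) = h • a
            rw [← hs', map_add, map_smul, smul_neg]
            abel
          · change -(koszul L).d (-s b) + -s (-(koszul L).d b) = h • b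
            rw [← hs', map_neg, map_neg, neg_neg, neg_neg]

theorem exists_d_eq_smul {L : List P} {h : P} (hh : h ∈ Ideal.span {x | x ∈ L}) {i : ℤ}
    {z : (koszul L).M} (hz : (koszul L).proj i z = z) (hdz : (koszul L).d z = 0) :
    ∃ w, (koszul L).proj (i + 1) w = w ∧ (koszul L).d w = h • z := by
  obtain ⟨s, hs, hs'⟩ := exists_homotopy L hh
  exact ⟨s z, by rw [← hs, hz], by rw [← hs' z, hdz, map_zero, add_zero]⟩

theorem not_cone_exact {L : List P} {x : P} {e : ℕ} (he : x ^ e ∈ Ideal.span {x | x ∈ L})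
    {i : ℤ} (hL : ¬ (koszul L).Exact i) : ¬ (koszul (x :: L)).Exact (i + 1) := by
  intro hE
  refine hL fun z hz hdz => ?_
  have key : ∀ e : ℕ, (∃ w, (koszul L).proj (i + 1) w = w ∧ (koszul L).d w = x ^ e • z) →
      ∃ w, (koszul L).proj (i + 1) w = w ∧ (koszul L).d w = z := by
    intro e
    induction e with
    | zero => simp
    | succ e ih =>
      rintro ⟨w, hw, hdw⟩
      refine ih ?_
      obtain ⟨⟨p, q⟩, hv, hdv⟩ := hE ((-w, x ^ e • z) : (koszul L).M × (koszul L).M)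
        (Prod.ext ((map_neg _ _).trans (congrArg _ hw)) (by
          change (koszul L).proj (i + 1 - 1) (x ^ e • z) = x ^ e • z
          rw [add_sub_cancel_right, map_smul, hz]))
        (Prod.ext (by
          change (koszul L).d (-w) + x • x ^ e • z = 0
          rw [map_neg, hdw, smul_smul, ← pow_succ', neg_add_cancel]) (by
          change -(koszul L).d (x ^ e • z) = 0
          rw [map_smul, hdz, smul_zero, neg_zero]))
      have h1 : (koszul L).proj (i + 1 + 1 - 1) q = q := congrArg Prod.snd hv
      have h2 : -(koszul L).d q = x ^ e • z := congrArg Prod.snd hdv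
      rw [add_sub_cancel_right] at h1
      exact ⟨-q, by rw [map_neg, h1], by rw [map_neg, h2]⟩
  exact key e (exists_d_eq_smul he hz hdz)

theorem not_koszul_append_exact {L : List P} (X : List P)
    (hX : ∀ x ∈ X, ∃ e : ℕ, x ^ e ∈ Ideal.span {x | x ∈ L}) {i : ℤ}
    (hL : ¬ (koszul L).Exact i) : ¬ (koszul (X ++ L)).Exact (i + X.length) := by
  induction X with
  | nil => simpa using hL
  | cons x X ih =>
    obtain ⟨e, he⟩ := hX x List.mem_cons_self
    have hle : Ideal.span {x | x ∈ L} ≤ Ideal.span {x | x ∈ X ++ L} :=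
      Ideal.span_mono fun y hy => List.mem_append_right _ hy
    have := not_cone_exact (hle he) (ih fun y hy => hX y (List.mem_cons_of_mem _ hy))
    rwa [List.length_cons, Nat.cast_succ, ← add_assoc]

/-! #### Reordering -/

/-- Two complexes are isomorphic. -/
def IsIso (K K' : Cx P) : Prop :=
  ∃ f : K.M ≃ₗ[P] K'.M, (∀ z, f (K.d z) = K'.d (f z)) ∧ ∀ i z, f (K.proj i z) = K'.proj i (f z)

theorem IsIso.trans {K K' K'' : Cx P} (h : IsIso K K') (h' : IsIso K' K'') : IsIso K K'' := by
  obtain ⟨f, hf, hf'⟩ := h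
  obtain ⟨g, hg, hg'⟩ := h'
  exact ⟨f.trans g, fun z => by simp [hf, hg], fun i z => by simp [hf', hg']⟩

theorem IsIso.exact {K K' : Cx P} (h : IsIso K K') {i : ℤ} (hK : K.Exact i) : K'.Exact i := by
  obtain ⟨f, hf, hf'⟩ := h
  intro z hz hdz
  obtain ⟨z, rfl⟩ := f.surjective z
  obtain ⟨w, hw, hdw⟩ := hK z (f.injective (by rw [hf', hz]))
    (f.injective (by rw [hf, hdz, map_zero]))
  exact ⟨f w, by rw [← hf', hw], by rw [← hf, hdw]⟩

theorem IsIso.cone {K K' : Cx P} (g : P) (h : IsIso K K') : IsIso (cone g K) (cone g K') := by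
  obtain ⟨f, hf, hf'⟩ := h
  refine ⟨LinearEquiv.prodCongr f f, ?_, ?_⟩
  · rintro ⟨a, b⟩
    refine Prod.ext ?_ ?_
    · change f (K.d a + g • b) = K'.d (f a) + g • f b
      rw [map_add, hf, map_smul]
    · change f (-K.d b) = -K'.d (f b)
      rw [map_neg, hf]
  · rintro i ⟨a, b⟩
    exact Prod.ext (hf' i a) (hf' (i - 1) b)

theorem isIso_cone_cone (g h : P) (K : Cx P) : IsIso (Cx.cone g (Cx.cone h K))
    (Cx.cone h (Cx.cone g K)) := by
  refine ⟨(LinearEquiv.prodProdProdComm P K.M K.M K.M K.M).trans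
    (LinearEquiv.prodCongr (LinearEquiv.refl P _)
      (LinearEquiv.prodCongr (LinearEquiv.refl P _) (LinearEquiv.neg P))), ?_, ?_⟩
  · rintro ⟨⟨a, b⟩, c, e⟩
    refine Prod.ext (Prod.ext ?_ ?_) (Prod.ext ?_ ?_)
    · change K.d a + h • b + g • c = K.d a + g • c + h • b
      abel
    · change -(K.d c + h • e) = -K.d c + h • -e
      rw [neg_add, smul_neg]
    · change -K.d b + g • e = -(K.d b + g • -e)
      rw [smul_neg, neg_add, neg_neg]
    · change -(- -K.d e) = -(-K.d (-e))
      rw [map_neg]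
  · rintro i ⟨⟨a, b⟩, c, e⟩
    refine Prod.ext (Prod.ext rfl rfl) (Prod.ext rfl ?_)
    exact (map_neg (K.proj (i - 1 - 1)) e).symm

theorem isIso_of_perm {L L' : List P} (h : L.Perm L') : IsIso (koszul L) (koszul L') := by
  induction h with
  | nil => exact ⟨LinearEquiv.refl P _, fun _ => rfl, fun _ _ => rfl⟩
  | cons g _ ih => exact ih.cone g
  | swap g h L => exact isIso_cone_cone h g (koszul L)
  | trans _ _ ih ih' => exact ih.trans ih'

/-- The Koszul complex of at most as many polynomials as there are variables is acyclic in
positive degrees as soon as the variables are nilpotent modulo these polynomials. -/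
theorem koszul_exact {σ : Type} [Fintype σ] (L : List (MvPolynomial σ ℚ))
    (hL : L.length ≤ Fintype.card σ)
    (hX : ∀ s, ∃ e : ℕ, MvPolynomial.X s ^ e ∈ Ideal.span {x | x ∈ L}) {i : ℤ} (hi : 0 < i) :
    (koszul L).Exact i := by
  classical
  by_contra hE
  set X : List (MvPolynomial σ ℚ) := (Finset.univ : Finset σ).toList.map MvPolynomial.X with hXdef
  have hlen : X.length = Fintype.card σ := by simp [hXdef]
  refine not_koszul_append_exact X (fun x hx => ?_) hE
    ((isIso_of_perm List.perm_append_comm).exact (koszul_append_exact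
      (koszul_variables_exact _ (Finset.nodup_toList _)) L _ (by omega)))
  obtain ⟨s, -, rfl⟩ := List.mem_map.1 hx
  exact hX s

theorem koszul_exact_of_aug {σ : Type} [Fintype σ] (L : List (MvPolynomial σ ℚ))
    (hL : L.length ≤ Fintype.card σ)
    (hX : ∀ s, ∃ e : ℕ, MvPolynomial.X s ^ e ∈ Ideal.span {x | x ∈ L})
    {z : (koszul L).M} (hdz : (koszul L).d z = 0) (hz : aug L z ∈ Ideal.span {x | x ∈ L}) :
    ∃ w, (koszul L).d w = z := by
  have key : ∀ i : ℤ, ∃ w, (koszul L).d w = (koszul L).proj i z := by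
    intro i
    have hcl : (koszul L).d ((koszul L).proj i z) = 0 := by rw [d_proj, hdz, map_zero]
    rcases lt_trichotomy i 0 with h | rfl | h
    · exact ⟨0, by rw [map_zero, proj_neg L i h]⟩
    · obtain ⟨w, -, hw⟩ := (exists_d_eq_unit_iff L _).2 hz
      exact ⟨w, by rw [hw, proj_zero]⟩
    · obtain ⟨w, -, hw⟩ := koszul_exact L hL hX h _ ((koszul L).proj_proj i z) hcl
      exact ⟨w, hw⟩
  choose w hw using key
  obtain ⟨S, hS⟩ := (koszul L).sum_proj
  exact ⟨∑ i ∈ S, w i, by rw [map_sum, Finset.sum_congr rfl fun i _ => hw i, hS S subset_rfl]⟩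

end Cx

/-! ### Surjective quasi-isomorphisms -/

section Quasi

variable {B B' : Type} [GCDGA B] [GCDGA B'] {φ : B →ₐ[ℚ] B'}

theorem QuasiIso.exists_closed (hφ : IsDGAHom φ) (hs : Function.Surjective φ) (hq : QuasiIso φ)
    {b' : B'} (hb : Dd B' b' = 0) : ∃ b, Dd B b = 0 ∧ φ b = b' := by
  obtain ⟨b, hdb, c', hc⟩ := hq.1 b' hb
  obtain ⟨c, rfl⟩ := hs c'
  exact ⟨b - Dd B c, by rw [map_sub, hdb, Dd_sq, sub_zero],
    by rw [map_sub, hφ.1, ← hc, sub_sub_cancel]⟩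

theorem QuasiIso.exists_primitive (hφ : IsDGAHom φ) (hs : Function.Surjective φ)
    (hq : QuasiIso φ) {b : B} (hb : Dd B b = 0) {c' : B'} (hc : φ b = Dd B' c') :
    ∃ c, Dd B c = b ∧ φ c = c' := by
  obtain ⟨e, rfl⟩ := hq.2 b hb ⟨c', hc⟩
  obtain ⟨u, hu, hφu⟩ := hq.exists_closed hφ hs (b' := φ e - c') (by
    rw [map_sub, ← hφ.1, hc, sub_self])
  exact ⟨e - u, by rw [map_sub, hu, sub_zero], by rw [map_sub, hφu, sub_sub_cancel]⟩

namespace Adj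

/-- The morphism of extensions induced by a morphism of the base algebras. -/
def map (φ : B →ₐ[ℚ] B') (hφ : IsDGAHom φ) : Adj B →ₐ[ℚ] Adj B' :=
  AlgHom.ofLinearMap
    { toFun := fun u => ⟨φ u.1, φ u.2⟩
      map_add' := fun u v => Adj.ext (by simp) (by simp)
      map_smul' := fun c u => Adj.ext (by simp) (by simp) }
    (Adj.ext (map_one φ) (map_zero φ))
    (fun u v => Adj.ext (map_mul φ _ _) (by
      change φ (u.1 * v.2 + u.2 * par B v.1) = φ u.1 * φ v.2 + φ u.2 * par B' (φ v.1)
      rw [map_add, map_mul, map_mul, map_par φ hφ.2]))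

theorem map_apply (hφ : IsDGAHom φ) (u : Adj B) : map φ hφ u = ⟨φ u.1, φ u.2⟩ := rfl

theorem map_surjective (hφ : IsDGAHom φ) (hs : Function.Surjective φ) :
    Function.Surjective (map φ hφ) := by
  rintro ⟨a', b'⟩
  obtain ⟨a, rfl⟩ := hs a'
  obtain ⟨b, rfl⟩ := hs b'
  exact ⟨⟨a, b⟩, rfl⟩

theorem isDGAHom_map {n : ℕ} (hn : Odd n) {f : B} {f' : B'} (hff : φ f = f')
    (hf : f ∈ Gr B (n + 1)) (hdf : Dd B f = 0) (hf' : f' ∈ Gr B' (n + 1)) (hdf' : Dd B' f' = 0)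
    (hφ : IsDGAHom φ) :
    let _ := gcdga hn hf hdf
    let _ := gcdga hn hf' hdf'
    IsDGAHom (map φ hφ) := by
  let _ := gcdga hn hf hdf
  let _ := gcdga hn hf' hdf'
  refine ⟨fun u => Adj.ext ?_ (hφ.1 _), fun i u hu => ⟨hφ.2 _ _ hu.1, ?_⟩⟩
  · change φ (Dd B u.1 + par B u.2 * f) = Dd B' (φ u.1) + par B' (φ u.2) * f'
    rw [map_add, map_mul, hφ.1, map_par φ hφ.2, hff]
  · change φ u.2 ∈ _
    rcases shift_cases hu.2 with h | ⟨k, rfl, h⟩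
    · rw [show u.2 = 0 from h, map_zero]; exact zero_mem _
    · exact (mem_shift_add _ _ _).2 (hφ.2 _ _ h)

theorem quasiIso_map {n : ℕ} (hn : Odd n) {f : B} {f' : B'} (hff : φ f = f')
    (hf : f ∈ Gr B (n + 1)) (hdf : Dd B f = 0) (hf' : f' ∈ Gr B' (n + 1)) (hdf' : Dd B' f' = 0)
    (hφ : IsDGAHom φ) (hs : Function.Surjective φ) (hq : QuasiIso φ) :
    let _ := gcdga hn hf hdf
    let _ := gcdga hn hf' hdf'
    QuasiIso (map φ hφ) := by
  let _ := gcdga hn hf hdf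
  let _ := gcdga hn hf' hdf'
  have hpar : ∀ b : B, Dd B (par B b * f) = -(par B (Dd B b) * f) := fun b => by
    rw [Dd_mul', hdf, mul_zero, add_zero, Dd_par, neg_mul]
  have hφpar : ∀ b : B, φ (par B b * f) = par B' (φ b) * f' := fun b => by
    rw [map_mul, map_par φ hφ.2, hff]
  constructor
  · rintro ⟨a', b'⟩ hab
    have h1 : Dd B' a' + par B' b' * f' = 0 := congrArg Adj.fst hab
    have h2 : Dd B' b' = 0 := congrArg Adj.snd hab
    obtain ⟨b, hb, rfl⟩ := hq.exists_closed hφ hs h2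
    obtain ⟨a, ha, rfl⟩ := hq.exists_primitive hφ hs (b := -(par B b * f)) (c' := a')
      (by rw [map_neg, hpar, hb]; simp)
      (by rw [map_neg, hφpar, neg_eq_iff_add_eq_zero, add_comm, h1])
    refine ⟨⟨a, b⟩, Adj.ext ?_ hb, 0, ?_⟩
    · change Dd B a + par B b * f = 0
      rw [ha, neg_add_cancel]
    · rw [map_zero, map_apply, sub_self]
  · rintro ⟨a, b⟩ hab ⟨⟨p', q'⟩, hc⟩
    have h1 : Dd B a + par B b * f = 0 := congrArg Adj.fst hab
    have h2 : Dd B b = 0 := congrArg Adj.snd hab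
    have h3 : φ a = Dd B' p' + par B' q' * f' := congrArg Adj.fst hc
    have h4 : φ b = Dd B' q' := congrArg Adj.snd hc
    obtain ⟨q, rfl, rfl⟩ := hq.exists_primitive hφ hs h2 h4
    obtain ⟨p, hp⟩ := hq.2 (a - par B q * f)
      (by rw [map_sub, hpar, sub_neg_eq_add, h1])
      ⟨p', by rw [map_sub, hφpar, h3, add_sub_cancel_right]⟩
    refine ⟨⟨p, q⟩, Adj.ext ?_ rfl⟩
    change a = Dd B p + par B q * f
    rw [← hp, sub_add_cancel]

end Adj

end Quasi

/-! ### Pure extensions of polynomial algebras -/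

section Pure

variable {σ J : Type} (w : σ → ℕ) (n : J → ℕ) (f : J → MvPolynomial σ ℚ)

/-- `B` is the extension of the polynomial algebra on `σ` by the odd generators `y j`, `j ∈ S`,
with `d (y j) = f j`. -/
structure IsExt (S : Finset J) (B : Type) [GCDGA B] (i : MvPolynomial σ ℚ →ₐ[ℚ] B) (y : J → B) :
    Prop where
  X_mem : ∀ s, i (X s) ∈ Gr B (w s)
  d_X : ∀ s, Dd B (i (X s)) = 0
  y_mem : ∀ j ∈ S, y j ∈ Gr B (n j)
  d_y : ∀ j ∈ S, Dd B (y j) = i (f j)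
  gen : ∀ T : Subalgebra ℚ B, (∀ p, i p ∈ T) → (∀ j ∈ S, y j ∈ T) → ∀ b, b ∈ T
  lift : ∀ (C : Type) [GCDGA C] (h : MvPolynomial σ ℚ →ₐ[ℚ] C) (Y : J → C),
    (∀ s, h (X s) ∈ Gr C (w s)) → (∀ s, Dd C (h (X s)) = 0) → (∀ j ∈ S, Y j ∈ Gr C (n j)) →
    (∀ j ∈ S, Dd C (Y j) = h (f j)) →
      ∃ g : B →ₐ[ℚ] C, IsDGAHom g ∧ (∀ p, g (i p) = h p) ∧ ∀ j ∈ S, g (y j) = Y j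

variable {w n f}

theorem isExt_empty (hw : ∀ s, Even (w s)) (y : J → MvPolynomial σ ℚ) :
    let _ := polyGCDGA hw
    IsExt w n f ∅ (MvPolynomial σ ℚ) (AlgHom.id ℚ _) y := by
  let _ := polyGCDGA hw
  exact
  { X_mem := fun s => MvPolynomial.isWeightedHomogeneous_X ℚ w s
    d_X := fun s => rfl
    y_mem := by simp
    d_y := by simp
    gen := fun T hT _ b => hT b
    lift := fun C _ h Y hX hd _ _ => ⟨h, isDGAHom_poly hw hX hd, fun _ => rfl, by simp⟩ }

variable {S : Finset J} {B : Type} [GCDGA B] {i : MvPolynomial σ ℚ →ₐ[ℚ] B} {y : J → B}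

open Classical in
theorem IsExt.adj (h : IsExt w n f S B i y) {j : J} (hj : j ∉ S) (hn : Odd (n j))
    (hf : i (f j) ∈ Gr B (n j + 1)) (hdf : Dd B (i (f j)) = 0) :
    let _ := Adj.gcdga hn hf hdf
    IsExt w n f (insert j S) (Adj B) (Adj.inl.comp i)
      (Function.update (fun k => Adj.inl (y k)) j Adj.y) := by
  let _ := Adj.gcdga hn hf hdf
  have hinl := Adj.isDGAHom_inl hn hf hdf
  have hne : ∀ k ∈ S, k ≠ j := fun k hk hkj => hj (hkj ▸ hk)
  constructor
  · exact fun s => hinl.2 _ _ (h.X_mem s)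
  · exact fun s => (hinl.1 _).symm.trans ((congrArg _ (h.d_X s)).trans (map_zero _))
  · intro k hk
    rcases Finset.mem_insert.1 hk with rfl | hk
    · rw [Function.update_self]; exact Adj.y_mem hn hf hdf
    · rw [Function.update_of_ne (hne k hk)]; exact hinl.2 _ _ (h.y_mem k hk)
  · intro k hk
    rcases Finset.mem_insert.1 hk with rfl | hk
    · rw [Function.update_self]; exact Adj.Dd_y hn hf hdf
    · rw [Function.update_of_ne (hne k hk), ← hinl.1, h.d_y k hk]; rfl
  · intro T hT hy u
    have hB : ∀ b, Adj.inl b ∈ T := h.gen (T.comap Adj.inl) hT fun k hk => by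
      have := hy k (Finset.mem_insert_of_mem hk)
      rwa [Function.update_of_ne (hne k hk)] at this
    have hyj := hy j (Finset.mem_insert_self _ _)
    rw [Function.update_self] at hyj
    rw [Adj.eq_inl_add u]
    exact T.add_mem (hB _) (T.mul_mem (hB _) hyj)
  · intro C _ h' Y hX hd hY hdY
    obtain ⟨g, hg, hgi, hgy⟩ := h.lift C h' Y hX hd
      (fun k hk => hY k (Finset.mem_insert_of_mem hk))
      (fun k hk => hdY k (Finset.mem_insert_of_mem hk))
    have hYj := hY j (Finset.mem_insert_self _ _)
    have hlift : ∀ b, Adj.lift g hg.2 hn hYj (Adj.inl b) = g b := fun b => by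
      rw [Adj.lift_apply, Adj.inl_apply, map_zero, zero_mul, add_zero]
    refine ⟨Adj.lift g hg.2 hn hYj, Adj.isDGAHom_lift hn hf hdf g hg hYj (by
      rw [hdY j (Finset.mem_insert_self _ _), hgi]), fun p => (hlift _).trans (hgi p), ?_⟩
    intro k hk
    rcases Finset.mem_insert.1 hk with rfl | hk
    · rw [Function.update_self, Adj.lift_apply]
      simp [Adj.y]
    · rw [Function.update_of_ne (hne k hk), hlift, hgy k hk]

end Pure

theorem Adj.par_eq {B : Type} [GCDGA B] {n : ℕ} (hn : Odd n) {f : B} (hf : f ∈ Gr B (n + 1))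
    (hdf : Dd B f = 0) (u : Adj B) :
    let _ := Adj.gcdga hn hf hdf
    par (Adj B) u = ⟨par B u.1, -par B u.2⟩ := by
  let _ := Adj.gcdga hn hf hdf
  change par (Adj B) u = ⟨par B u.1, -par B u.2⟩
  induction u using gr_induction with
  | hom i u hu =>
    rw [par_of_mem hu]
    refine Adj.ext (par_of_mem hu.1).symm ?_
    change ((-1 : ℚ) ^ i) • u.2 = -par B u.2
    rcases Adj.shift_cases hu.2 with h | ⟨k, rfl, h⟩
    · rw [show u.2 = 0 from h, map_zero, smul_zero, neg_zero]
    · rw [par_of_mem h, pow_add, hn.neg_one_pow, mul_neg_one, neg_smul]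
  | add u v hu hv =>
    rw [map_add, hu, hv]
    exact Adj.ext (map_add (par B) _ _).symm (by
      change -par B u.2 + -par B v.2 = -par B (u.2 + v.2)
      rw [map_add, neg_add])

/-! ### Comparison with the Koszul complex -/

section Koszul

variable {σ J : Type} (w : σ → ℕ) (n : J → ℕ) (f : J → MvPolynomial σ ℚ)

/-- An identification of a pure extension of a polynomial algebra with a Koszul complex. -/
structure KoszulStage (js : List J) (S : Finset J) (B : Type) [GCDGA B]
    (i : MvPolynomial σ ℚ →ₐ[ℚ] B) (y : J → B) (Θ : B →+ (Cx.koszul (js.map f)).M) : Prop where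
  ext : IsExt w n f S B i y
  bij : Function.Bijective Θ
  d : ∀ b, Θ (Dd B b) = (Cx.koszul (js.map f)).d (Θ b)
  smul : ∀ p b, Θ (i p * b) = p • Θ b
  one : Θ 1 = Cx.unit _ 1
  aug_mul : ∀ a b, Cx.aug _ (Θ (a * b)) = Cx.aug _ (Θ a) * Cx.aug _ (Θ b)
  aug_y : ∀ j ∈ S, Cx.aug _ (Θ (y j)) = 0

variable {w n f}

theorem exists_koszulStage (hw : ∀ s, Even (w s)) (hn : ∀ j, Odd (n j))
    (hf : ∀ j, IsWeightedHomogeneous w (f j) (n j + 1)) (js : List J) (hjs : js.Nodup) :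
    ∃ (S : Finset J), (∀ k, k ∈ S ↔ k ∈ js) ∧ ∃ (B : Type) (_ : GCDGA B)
      (i : MvPolynomial σ ℚ →ₐ[ℚ] B) (y : J → B) (Θ : B →+ (Cx.koszul (js.map f)).M),
      KoszulStage w n f js S B i y Θ := by
  classical
  induction js with
  | nil =>
    refine ⟨∅, by simp, MvPolynomial σ ℚ, polyGCDGA hw, AlgHom.id ℚ _, 0,
      AddMonoidHom.id (MvPolynomial σ ℚ), ?_⟩
    let _ := polyGCDGA hw
    exact
    { ext := isExt_empty hw 0
      bij := Function.bijective_id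
      d := fun b => rfl
      smul := fun p b => rfl
      one := rfl
      aug_mul := fun a b => rfl
      aug_y := by simp }
  | cons j js ih =>
    obtain ⟨hj, hjs⟩ := List.nodup_cons.1 hjs
    obtain ⟨S, hS, B, _, i, y, Θ, h⟩ := ih hjs
    have hjS : j ∉ S := fun hh => hj ((hS j).1 hh)
    have hfj : i (f j) ∈ Gr B (n j + 1) := poly_mem h.ext.X_mem (hf j)
    have hdf : Dd B (i (f j)) = 0 := poly_closed h.ext.d_X _
    let K := (Cx.koszul (js.map f)).M
    let Θ' : Adj B →+ K × K :=
      { toFun := fun u => (Θ u.1, Θ (par B u.2))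
        map_zero' := by simp
        map_add' := fun u v => by simp }
    refine ⟨insert j S, by simp [hS], Adj B, Adj.gcdga (hn j) hfj hdf, Adj.inl.comp i,
      Function.update (fun k => Adj.inl (y k)) j Adj.y, Θ', ?_⟩
    let _ := Adj.gcdga (hn j) hfj hdf
    have hpar : Function.Bijective (par B) := ⟨fun a b hab => by
      rw [← par_par a, hab, par_par], fun b => ⟨par B b, par_par b⟩⟩
    have hc := fun p b => poly_central hw h.ext.X_mem p b
    refine
    { ext := h.ext.adj hjS (hn j) hfj hdf
      bij := ⟨fun u v huv => Adj.ext (h.bij.1 (congrArg Prod.fst huv))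
          (hpar.1 (h.bij.1 (congrArg Prod.snd huv))), ?_⟩
      d := ?_
      smul := ?_
      one := Prod.ext h.one (by change Θ (par B 0) = 0; simp)
      aug_mul := fun a b => h.aug_mul a.1 b.1
      aug_y := ?_ }
    · rintro ⟨a, b⟩
      obtain ⟨a, rfl⟩ := h.bij.2 a
      obtain ⟨b, rfl⟩ := h.bij.2 b
      obtain ⟨b, rfl⟩ := hpar.2 b
      exact ⟨⟨a, b⟩, rfl⟩
    · intro u
      refine Prod.ext ?_ ?_
      · change Θ (Dd B u.1 + par B u.2 * i (f j)) =
          (Cx.koszul (js.map f)).d (Θ u.1) + f j • Θ (par B u.2)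
        rw [map_add, h.d, ← hc, h.smul]
      · change Θ (par B (Dd B u.2)) = -(Cx.koszul (js.map f)).d (Θ (par B u.2))
        rw [← h.d, Dd_par, map_neg, neg_neg]
    · intro p u
      refine Prod.ext (h.smul p u.1) ?_
      change Θ (par B (i p * u.2 + 0 * par B u.1)) = p • Θ (par B u.2)
      rw [zero_mul, add_zero, map_mul, poly_par hw h.ext.X_mem, h.smul]
    · intro k hk
      rcases Finset.mem_insert.1 hk with rfl | hk
      · rw [Function.update_self]
        change Cx.aug _ (Θ 0) = 0
        rw [map_zero, map_zero]
      · rw [Function.update_of_ne (show k ≠ j from fun hkj => hjS (hkj ▸ hk))]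
        exact h.aug_y k hk

theorem weightedHomogeneousComponent_mem_span {s : Set (MvPolynomial σ ℚ)}
    (hs : ∀ p ∈ s, ∃ N, IsWeightedHomogeneous w p N) {p : MvPolynomial σ ℚ}
    (hp : p ∈ Ideal.span s) (N : ℕ) : weightedHomogeneousComponent w N p ∈ Ideal.span s :=
  let _ := weightedGradedAlgebra ℚ w
  weightedHomogeneousComponent_mem_of_mem ℚ w (Ideal.homogeneous_span _ s hs) hp N

/-- The quotient of a polynomial algebra by a weighted homogeneous ideal. -/
theorem exists_poly_quotient (hw : ∀ s, Even (w s)) (I : Ideal (MvPolynomial σ ℚ))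
    (hI : ∀ N, ∀ p ∈ I, weightedHomogeneousComponent w N p ∈ I) :
    ∃ (R : Type) (_ : GCDGA R) (ρ : MvPolynomial σ ℚ →ₐ[ℚ] R), Function.Surjective ρ ∧
      (∀ p, ρ p = 0 ↔ p ∈ I) ∧ (∀ s, ρ (X s) ∈ Gr R (w s)) ∧ ∀ x, Dd R x = 0 := by
  let _ := polyGCDGA hw
  obtain ⟨R, _, ρ, hρ, hs, hk⟩ := exists_quotient (A := MvPolynomial σ ℚ) (I.restrictScalars ℚ)
    (fun a k hk => I.mul_mem_left a hk) (fun a k hk => I.mul_mem_right a hk)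
    (fun N k hk => by
      have hp : pr (MvPolynomial σ ℚ) N k = weightedHomogeneousComponent w N k := by
        clear hk
        induction k using gr_induction with
        | hom M x hx =>
          rw [weightedHomogeneousComponent_of_mem hx]
          split_ifs with h
          · rw [h, pr_same hx]
          · exact pr_ne hx (Ne.symm h)
        | add x y hx hy => rw [map_add, map_add, hx, hy]
      rw [hp]; exact hI N k hk)
    (fun k _ => I.zero_mem)
  refine ⟨R, _, ρ, hs, fun p => ?_, fun s => hρ.2 _ _ (isWeightedHomogeneous_X ℚ w s), fun x => ?_⟩
  · rw [← AlgHom.toLinearMap_apply, ← LinearMap.mem_ker, hk]; rfl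
  · obtain ⟨p, rfl⟩ := hs x
    rw [← hρ.1]; exact map_zero ρ

/-- A pure extension by at most as many odd generators as even ones, with all even generators
nilpotent modulo the differentials, is quasi-isomorphic to a quotient of a polynomial algebra. -/
theorem exists_koszul_quasiIso [Fintype σ] (hw : ∀ s, Even (w s)) (hn : ∀ j, Odd (n j))
    (hf : ∀ j, IsWeightedHomogeneous w (f j) (n j + 1)) (S : Finset J)
    (hS : S.card ≤ Fintype.card σ)
    (hX : ∀ s, ∃ e : ℕ, (X s : MvPolynomial σ ℚ) ^ e ∈ Ideal.span (f '' S)) :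
    ∃ (B : Type) (_ : GCDGA B) (i : MvPolynomial σ ℚ →ₐ[ℚ] B) (y : J → B) (R : Type) (_ : GCDGA R)
      (ρ : MvPolynomial σ ℚ →ₐ[ℚ] R) (φ : B →ₐ[ℚ] R), IsExt w n f S B i y ∧
      Function.Surjective ρ ∧ (∀ p, ρ p = 0 ↔ p ∈ Ideal.span (f '' S)) ∧
      (∀ s, ρ (X s) ∈ Gr R (w s)) ∧ (∀ x, Dd R x = 0) ∧ IsDGAHom φ ∧ Function.Surjective φ ∧
      QuasiIso φ ∧ (∀ p, φ (i p) = ρ p) ∧ ∀ j ∈ S, φ (y j) = 0 := by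
  obtain ⟨S', hS', B, _, i, y, Θ, h⟩ := exists_koszulStage hw hn hf S.toList S.nodup_toList
  obtain rfl : S' = S := by ext k; rw [hS', Finset.mem_toList]
  have hspan : Ideal.span {x | x ∈ S'.toList.map f} = Ideal.span (f '' S') := by
    congr 1; ext x; simp
  obtain ⟨R, _, ρ, hs, hk, hρX, hR⟩ := exists_poly_quotient hw (Ideal.span (f '' S')) (by
    intro N p hp
    exact weightedHomogeneousComponent_mem_span (by rintro _ ⟨j, -, rfl⟩; exact ⟨_, hf j⟩) hp N)
  obtain ⟨φ, hφ, hφi, hφy⟩ := h.ext.lift R ρ 0 hρX (fun s => hR _) (fun j _ => zero_mem _)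
    (fun j hj => by
      rw [hR, (hk _).2 (Ideal.subset_span ⟨j, hj, rfl⟩)])
  have hΘi : ∀ p, Θ (i p) = Cx.unit _ p := fun p => by
    rw [← mul_one (i p), h.smul, h.one, ← map_smul, smul_eq_mul, mul_one]
  have hφρ : ∀ b, φ b = ρ (Cx.aug _ (Θ b)) := h.ext.gen
    { carrier := {b | φ b = ρ (Cx.aug _ (Θ b))}
      mul_mem' := fun {a b} ha hb => by
        change φ _ = _
        rw [map_mul, h.aug_mul, map_mul, ← ha, ← hb]
      add_mem' := fun {a b} ha hb => by
        change φ _ = _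
        rw [map_add, map_add, map_add, map_add, ← ha, ← hb]
      algebraMap_mem' := fun c => by
        change φ _ = _
        rw [← AlgHom.commutes i, hφi, hΘi, Cx.aug_unit] }
    (fun p => by change φ _ = _; rw [hφi, hΘi, Cx.aug_unit])
    (fun j hj => by change φ _ = _; rw [hφy j hj, h.aug_y j hj, map_zero]; rfl)
  refine ⟨B, _, i, y, R, _, ρ, φ, h.ext, hs, hk, hρX, hR, hφ, fun x => ?_, ⟨fun x hx => ?_, ?_⟩,
    hφi, hφy⟩
  · obtain ⟨p, rfl⟩ := hs x
    exact ⟨i p, hφi p⟩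
  · obtain ⟨p, rfl⟩ := hs x
    exact ⟨i p, poly_closed h.ext.d_X p, 0, by rw [hφi, map_zero, sub_self]⟩
  · rintro a ha ⟨c, hc⟩
    rw [hR, hφρ, hk, ← hspan] at hc
    obtain ⟨v, hv⟩ := Cx.koszul_exact_of_aug (S'.toList.map f) (by simpa using hS)
      (fun s => by rw [hspan]; exact hX s) (by rw [← h.d, ha, map_zero]) hc
    obtain ⟨v, rfl⟩ := h.bij.2 v
    exact ⟨v, h.bij.1 (by rw [h.d, hv])⟩

end Koszul

/-! ### Multiplicative filtrations -/

/-- A multiplicative family of subspaces which vanishes beyond `N`. -/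
structure MulFam {B : Type} [GCDGA B] (F : ℤ → Submodule ℚ B) (N : ℤ) : Prop where
  one : 1 ∈ F 0
  mul : ∀ p q a b, a ∈ F p → b ∈ F q → a * b ∈ F (p + q)
  par : ∀ p, ∀ a ∈ F p, par B a ∈ F p
  eq_zero : ∀ p, N < p → ∀ a ∈ F p, a = 0

/-- The family induced on an extension when the new generator has weight `c`. -/
def Adj.fam {B : Type} [GCDGA B] (F : ℤ → Submodule ℚ B) (c p : ℤ) : Submodule ℚ (Adj B) where
  carrier := {u | u.1 ∈ F p ∧ u.2 ∈ F (p - c)}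
  zero_mem' := ⟨zero_mem _, zero_mem _⟩
  add_mem' hu hv := ⟨add_mem hu.1 hv.1, add_mem hu.2 hv.2⟩
  smul_mem' c _ hu := ⟨Submodule.smul_mem _ c hu.1, Submodule.smul_mem _ c hu.2⟩

/-- The coefficient of the new generator. -/
def Adj.sndLin {B : Type} [GCDGA B] : Adj B →ₗ[ℚ] B where
  toFun u := u.2
  map_add' _ _ := rfl
  map_smul' _ _ := rfl

theorem MulFam.adj {B : Type} [GCDGA B] {F : ℤ → Submodule ℚ B} {N c : ℤ} (h : MulFam F N)
    (hc : 0 ≤ c) {n : ℕ} (hn : Odd n) {f : B} (hf : f ∈ Gr B (n + 1)) (hdf : Dd B f = 0) :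
    let _ := Adj.gcdga hn hf hdf
    MulFam (Adj.fam F c) (N + c) := by
  let _ := Adj.gcdga hn hf hdf
  refine ⟨⟨h.one, zero_mem _⟩, ?_, ?_, ?_⟩
  · intro p q u v hu hv
    refine ⟨h.mul p q _ _ hu.1 hv.1, ?_⟩
    change u.1 * v.2 + u.2 * RHT.par B v.1 ∈ F (p + q - c)
    refine add_mem ?_ ?_
    · rw [add_sub_assoc]; exact h.mul _ _ _ _ hu.1 hv.2
    · rw [add_sub_right_comm]; exact h.mul _ _ _ _ hu.2 (h.par _ _ hv.1)
  · intro p u hu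
    rw [Adj.par_eq hn hf hdf]
    exact ⟨h.par _ _ hu.1, neg_mem (h.par _ _ hu.2)⟩
  · intro p hp u hu
    exact Adj.ext (h.eq_zero p (by omega) _ hu.1) (h.eq_zero _ (by omega) _ hu.2)

/-! ### Filtered models of pure extensions -/

section Stage

variable {σ J : Type} (w : σ → ℕ) (n : J → ℕ) (f : J → MvPolynomial σ ℚ) (wt : J → ℤ)

/-- A surjective quasi-isomorphism from a pure extension onto a filtered gcdga, such that
the generators have prescribed filtration weight. -/
structure FilteredModel (S : Finset J) (B B' : Type) [GCDGA B] [GCDGA B']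
    (i : MvPolynomial σ ℚ →ₐ[ℚ] B) (y : J → B) (φ : B →ₐ[ℚ] B') (F : ℤ → Submodule ℚ B')
    (N : ℤ) : Prop where
  ext : IsExt w n f S B i y
  hom : IsDGAHom φ
  surj : Function.Surjective φ
  quasi : QuasiIso φ
  fam : MulFam F N
  X_mem : ∀ s, φ (i (X s)) ∈ F 1
  y_mem : ∀ j ∈ S, φ (y j) ∈ F (wt j)

/-- A functional and a cocycle witnessing that the family `F` has a nontrivial cohomology class
concentrated in filtration weight `p`. -/
structure TopClass {B' : Type} [GCDGA B'] (h : MvPolynomial σ ℚ →ₐ[ℚ] B')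
    (F : ℤ → Submodule ℚ B') (p : ℤ) (ε : B' →ₗ[ℚ] ℚ) (θ : B') : Prop where
  exact : ∀ b, ε (Dd B' b) = 0
  eq_zero : ∀ q, q ≠ p → ∀ b ∈ F q, ε b = 0
  closed : Dd B' θ = 0
  one : ε θ = 1
  mul : ∀ g ∈ Ideal.span (Set.range X), θ * h g = 0

variable {w n f wt}

section

variable {S : Finset J} {B B' : Type} [GCDGA B] [GCDGA B']
    {i : MvPolynomial σ ℚ →ₐ[ℚ] B} {y : J → B} {φ : B →ₐ[ℚ] B'} {F : ℤ → Submodule ℚ B'}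
    {N : ℤ}

open Classical in
theorem FilteredModel.adj (h : FilteredModel w n f wt S B B' i y φ F N) {j : J} (hj : j ∉ S)
    (hn : Odd (n j)) (hwt : 0 ≤ wt j) (hf : i (f j) ∈ Gr B (n j + 1)) (hdf : Dd B (i (f j)) = 0)
    (hf' : φ (i (f j)) ∈ Gr B' (n j + 1)) (hdf' : Dd B' (φ (i (f j))) = 0) :
    let _ := Adj.gcdga hn hf hdf
    let _ := Adj.gcdga hn hf' hdf'
    FilteredModel w n f wt (insert j S) (Adj B) (Adj B') (Adj.inl.comp i)
      (Function.update (fun k => Adj.inl (y k)) j Adj.y) (Adj.map φ h.hom)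
      (Adj.fam F (wt j)) (N + wt j) := by
  let _ := Adj.gcdga hn hf hdf
  let _ := Adj.gcdga hn hf' hdf'
  refine ⟨h.ext.adj hj hn hf hdf, Adj.isDGAHom_map hn rfl hf hdf hf' hdf' h.hom,
    Adj.map_surjective h.hom h.surj, Adj.quasiIso_map hn rfl hf hdf hf' hdf' h.hom h.surj h.quasi,
    h.fam.adj hwt hn hf' hdf', fun s => ⟨h.X_mem s, ?_⟩, fun k hk => ?_⟩
  · change φ 0 ∈ _
    rw [map_zero]; exact zero_mem _
  · rcases Finset.mem_insert.1 hk with rfl | hk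
    · rw [Function.update_self]
      refine ⟨?_, ?_⟩
      · change φ 0 ∈ _
        rw [map_zero]; exact zero_mem _
      · change φ 1 ∈ _
        rw [map_one, sub_self]; exact h.fam.one
    · rw [Function.update_of_ne (show k ≠ j from fun hkj => hj (hkj ▸ hk))]
      refine ⟨h.y_mem k hk, ?_⟩
      change φ 0 ∈ _
      rw [map_zero]; exact zero_mem _

theorem TopClass.adj {h : MvPolynomial σ ℚ →ₐ[ℚ] B'} {p : ℤ} {ε : B' →ₗ[ℚ] ℚ} {θ : B'}
    (ht : TopClass h F p ε θ) (hw : ∀ s, Even (w s)) (hX : ∀ s, h (X s) ∈ Gr B' (w s)) {n : ℕ}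
    (hn : Odd n) {g : MvPolynomial σ ℚ} (hg : g ∈ Ideal.span (Set.range X))
    (hf : h g ∈ Gr B' (n + 1)) (hdf : Dd B' (h g) = 0) :
    let _ := Adj.gcdga hn hf hdf
    TopClass (Adj.inl.comp h) (Adj.fam F 1) (p + 1)
      (ε ∘ₗ Adj.sndLin) ⟨0, θ⟩ := by
  let _ := Adj.gcdga hn hf hdf
  have hpar : ∀ g ∈ Ideal.span (Set.range X), par B' θ * h g = 0 := fun g hg => by
    rw [← poly_par hw hX, ← map_mul, ht.mul g hg, map_zero]
  refine ⟨fun u => ht.exact u.2, fun q hq u hu => ht.eq_zero (q - 1) (by omega) _ hu.2,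
    Adj.ext ?_ ht.closed, ht.one, fun g' hg' => Adj.ext (zero_mul _) ?_⟩
  · change Dd B' 0 + par B' θ * h g = 0
    rw [hpar g hg, map_zero, add_zero]
  · change 0 * 0 + θ * par B' (h g') = 0
    rw [poly_par hw hX, ht.mul g' hg', mul_zero, add_zero]

end

variable (w n f wt)

/-- A filtered model with a top class in the highest weight `p`. -/
def HasTopModel (S : Finset J) (p : ℤ) : Prop :=
  ∃ (B B' : Type) (_ : GCDGA B) (_ : GCDGA B') (i : MvPolynomial σ ℚ →ₐ[ℚ] B) (y : J → B)
    (φ : B →ₐ[ℚ] B') (F : ℤ → Submodule ℚ B') (ε : B' →ₗ[ℚ] ℚ) (θ : B'),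
    FilteredModel w n f wt S B B' i y φ F p ∧ TopClass (φ.comp i) F p ε θ

/-- A filtered model whose filtration is exhausted in weight `0` and vanishes beyond `N`. -/
def HasBoundedModel (S : Finset J) (N : ℤ) : Prop :=
  ∃ (B B' : Type) (_ : GCDGA B) (_ : GCDGA B') (i : MvPolynomial σ ℚ →ₐ[ℚ] B) (y : J → B)
    (φ : B →ₐ[ℚ] B') (F : ℤ → Submodule ℚ B'),
    FilteredModel w n f wt S B B' i y φ F N ∧ ∀ p ≤ 0, F p = ⊤

variable {w n f wt}

open Classical in
theorem HasTopModel.insert {S : Finset J} {p : ℤ} (h : HasTopModel w n f wt S p)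
    (hw : ∀ s, Even (w s)) {j : J} (hj : j ∉ S) (hn : Odd (n j)) (hwt : wt j = 1)
    (hf : IsWeightedHomogeneous w (f j) (n j + 1)) (hfX : f j ∈ Ideal.span (Set.range X)) :
    HasTopModel w n f wt (insert j S) (p + 1) := by
  obtain ⟨B, B', _, _, i, y, φ, F, ε, θ, h, ht⟩ := h
  have hX' : ∀ s, φ.comp i (X s) ∈ Gr B' (w s) := fun s => h.hom.2 _ _ (h.ext.X_mem s)
  have hfj : i (f j) ∈ Gr B (n j + 1) := poly_mem h.ext.X_mem hf
  have hdf : Dd B (i (f j)) = 0 := poly_closed h.ext.d_X _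
  have hf' : φ (i (f j)) ∈ Gr B' (n j + 1) := h.hom.2 _ _ hfj
  have hdf' : Dd B' (φ (i (f j))) = 0 := by rw [← h.hom.1, hdf, map_zero]
  have h1 := h.adj hj hn (by omega) hfj hdf hf' hdf'
  rw [hwt] at h1
  refine ⟨Adj B, Adj B', Adj.gcdga hn hfj hdf, Adj.gcdga hn hf' hdf', _, _, _, _,
    ε ∘ₗ Adj.sndLin, ⟨0, θ⟩, h1, ?_⟩
  have heq : (Adj.map φ h.hom).comp (Adj.inl.comp i) = Adj.inl.comp (φ.comp i) :=
    AlgHom.ext fun g => Adj.ext rfl (map_zero φ)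
  rw [heq]
  exact ht.adj hw hX' hn hfX hf' hdf'

open Classical in
theorem HasBoundedModel.insert {S : Finset J} {N : ℤ} (h : HasBoundedModel w n f wt S N)
    {j : J} (hj : j ∉ S) (hn : Odd (n j)) (hwt : 0 ≤ wt j)
    (hf : IsWeightedHomogeneous w (f j) (n j + 1)) :
    HasBoundedModel w n f wt (insert j S) (N + wt j) := by
  obtain ⟨B, B', _, _, i, y, φ, F, h, hF⟩ := h
  have hfj : i (f j) ∈ Gr B (n j + 1) := poly_mem h.ext.X_mem hf
  have hdf : Dd B (i (f j)) = 0 := poly_closed h.ext.d_X _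
  have hf' : φ (i (f j)) ∈ Gr B' (n j + 1) := h.hom.2 _ _ hfj
  have hdf' : Dd B' (φ (i (f j))) = 0 := by rw [← h.hom.1, hdf, map_zero]
  refine ⟨Adj B, Adj B', Adj.gcdga hn hfj hdf, Adj.gcdga hn hf' hdf', _, _, _, _,
    h.adj hj hn hwt hfj hdf hf' hdf', fun p hp => eq_top_iff.2 fun u _ => ⟨?_, ?_⟩⟩
  · rw [hF p hp]; trivial
  · rw [hF _ (by omega)]; trivial

open Classical in
theorem HasTopModel.union {S : Finset J} {p : ℤ} (h : HasTopModel w n f wt S p)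
    (hw : ∀ s, Even (w s)) (hn : ∀ j, Odd (n j)) (hf : ∀ j, IsWeightedHomogeneous w (f j) (n j + 1))
    (hfX : ∀ j, f j ∈ Ideal.span (Set.range X)) (S' : Finset J) (hS : Disjoint S' S)
    (hwt : ∀ j ∈ S', wt j = 1) : HasTopModel w n f wt (S' ∪ S) (p + S'.card) := by
  induction S' using Finset.induction_on with
  | empty => simpa using h
  | insert j S' hj ih =>
    rw [Finset.disjoint_insert_left] at hS
    have := (ih hS.2 fun k hk => hwt k (Finset.mem_insert_of_mem hk)).insert hw (j := j)
      (by simp [hj, hS.1]) (hn j) (hwt j (Finset.mem_insert_self _ _)) (hf j) (hfX j)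
    rw [Finset.insert_union, Finset.card_insert_of_notMem hj]
    push_cast
    rwa [← add_assoc]

open Classical in
theorem HasBoundedModel.union {S : Finset J} {N : ℤ} (h : HasBoundedModel w n f wt S N)
    (hn : ∀ j, Odd (n j)) (hf : ∀ j, IsWeightedHomogeneous w (f j) (n j + 1))
    (hwt : ∀ j, 0 ≤ wt j) (S' : Finset J) (hS : Disjoint S' S) :
    HasBoundedModel w n f wt (S' ∪ S) (N + ∑ j ∈ S', wt j) := by
  induction S' using Finset.induction_on with
  | empty => simpa using h
  | insert j S' hj ih =>
    rw [Finset.disjoint_insert_left] at hS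
    have := (ih hS.2).insert (j := j) (by simp [hj, hS.1]) (hn j) (hwt j) (hf j)
    rw [Finset.insert_union, Finset.sum_insert hj, add_comm (wt j), ← add_assoc]
    exact this

end Stage

section Base

variable {σ J : Type} {w : σ → ℕ} {n : J → ℕ} {f : J → MvPolynomial σ ℚ} {wt : J → ℤ}

theorem hasBoundedModel_base [Fintype σ] (hw : ∀ s, Even (w s)) (hn : ∀ j, Odd (n j))
    (hf : ∀ j, IsWeightedHomogeneous w (f j) (n j + 1)) (S : Finset J)
    (hS : S.card ≤ Fintype.card σ)
    (hX : ∀ s, ∃ e : ℕ, (X s : MvPolynomial σ ℚ) ^ e ∈ Ideal.span (f '' S)) (N : ℕ)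
    (hN : (Ideal.span (Set.range X) : Ideal (MvPolynomial σ ℚ)) ^ (N + 1) ≤ Ideal.span (f '' S)) :
    HasBoundedModel w n f wt S N := by
  obtain ⟨B, _, i, y, R, _, ρ, φ, hext, hρ, hk, hρX, hR, hφ, hs, hq, hφi, hφy⟩ :=
    exists_koszul_quasiIso hw hn hf S hS hX
  let 𝔪 : Ideal (MvPolynomial σ ℚ) := Ideal.span (Set.range X)
  let F : ℤ → Submodule ℚ R := fun p => ((𝔪 ^ p.toNat).restrictScalars ℚ).map ρ.toLinearMap
  refine ⟨B, R, _, _, i, y, φ, F, ⟨hext, hφ, hs, hq, ⟨?_, ?_, ?_, ?_⟩, fun s => ?_, fun j hj => ?_⟩,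
    fun p hp => ?_⟩
  · exact ⟨1, by simp, map_one ρ⟩
  · rintro p q _ _ ⟨a, ha, rfl⟩ ⟨b, hb, rfl⟩
    refine ⟨a * b, ?_, map_mul ρ a b⟩
    exact Ideal.pow_le_pow_right (by omega) (pow_add 𝔪 p.toNat q.toNat ▸ Ideal.mul_mem_mul ha hb)
  · rintro p _ ⟨a, ha, rfl⟩
    exact ⟨a, ha, (poly_par hw hρX a).symm⟩
  · rintro p hp _ ⟨a, ha, rfl⟩
    exact (hk a).2 (hN (Ideal.pow_le_pow_right (by omega) ha))
  · refine ⟨X s, ?_, (hφi _).symm⟩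
    change X s ∈ 𝔪 ^ (1 : ℤ).toNat
    rw [show (1 : ℤ).toNat = 1 from rfl, pow_one]
    exact Ideal.subset_span ⟨s, rfl⟩
  · rw [hφy j hj]; exact zero_mem _
  · refine eq_top_iff.2 fun x _ => ?_
    obtain ⟨a, rfl⟩ := hρ x
    refine ⟨a, ?_, rfl⟩
    change a ∈ 𝔪 ^ p.toNat
    rw [Int.toNat_of_nonpos hp, pow_zero, Ideal.one_eq_top]
    trivial

theorem mem_pow_of_isHomogeneous {q : ℕ} {p : MvPolynomial σ ℚ} (hp : p.IsHomogeneous q) :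
    p ∈ (Ideal.span (Set.range X) : Ideal (MvPolynomial σ ℚ)) ^ q :=
  (mem_pow_idealOfVars_iff q p).2 fun x hx => by
    rw [Finsupp.degree_eq_weight_one]
    exact (hp (mem_support_iff.1 hx)).ge

theorem pow_le_of_isHomogeneous {q : ℕ} {I : Ideal (MvPolynomial σ ℚ)}
    (h : ∀ p : MvPolynomial σ ℚ, p.IsHomogeneous q → p ∈ I) :
    (Ideal.span (Set.range X) : Ideal (MvPolynomial σ ℚ)) ^ q ≤ I := by
  refine (pow_idealOfVars_eq_span (σ := σ) (R := ℚ) q).le.trans ?_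
  rw [Ideal.span_le]
  rintro _ ⟨x, hx, rfl⟩
  exact h _ (isHomogeneous_monomial 1 hx)

theorem exists_pow_le [Finite σ] {I : Ideal (MvPolynomial σ ℚ)}
    (hX : ∀ s, ∃ e : ℕ, (X s : MvPolynomial σ ℚ) ^ e ∈ I) :
    ∃ q, (Ideal.span (Set.range X) : Ideal (MvPolynomial σ ℚ)) ^ q ≤ I := by
  refine Ideal.exists_pow_le_of_le_radical_of_fg ?_ ⟨(Set.finite_range X).toFinset, by simp⟩
  rw [Ideal.span_le]
  rintro _ ⟨s, rfl⟩
  exact hX s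

theorem hasTopModel_base [Fintype σ] (hw : ∀ s, Even (w s)) (hn : ∀ j, Odd (n j))
    (hf : ∀ j, IsWeightedHomogeneous w (f j) (n j + 1)) {l : ℕ} (hl : 0 < l)
    (hfl : ∀ j, (f j).IsHomogeneous l) (S : Finset J)
    (hS : S.card ≤ Fintype.card σ)
    (hX : ∀ s, ∃ e : ℕ, (X s : MvPolynomial σ ℚ) ^ e ∈ Ideal.span (f '' S)) :
    ∃ D : ℕ, (Ideal.span (Set.range X) : Ideal (MvPolynomial σ ℚ)) ^ (D + 1) ≤
      Ideal.span (f '' S) ∧ HasTopModel w n f wt S D := by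
  classical
  let 𝔪 : Ideal (MvPolynomial σ ℚ) := Ideal.span (Set.range X)
  let I := Ideal.span (f '' S)
  have hex : ∃ q, 𝔪 ^ q ≤ I := exists_pow_le hX
  have hI𝔪 : I ≤ 𝔪 := by
    rw [Ideal.span_le]
    rintro _ ⟨j, -, rfl⟩
    exact Ideal.pow_le_self hl.ne' (mem_pow_of_isHomogeneous (hfl j))
  have h𝔪 : (1 : MvPolynomial σ ℚ) ∉ 𝔪 := fun h1 => by
    simpa using (mem_pow_idealOfVars_iff' (R := ℚ) (σ := σ) 1 1).1 (by rwa [pow_one]) 0 (by simp)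
  obtain ⟨D, hD⟩ : ∃ D, Nat.find hex = D + 1 := by
    refine Nat.exists_eq_succ_of_ne_zero fun h0 => h𝔪 ?_
    have := Nat.find_spec hex
    rw [h0, pow_zero, Ideal.one_eq_top] at this
    exact hI𝔪 (this trivial)
  have hDI : 𝔪 ^ (D + 1) ≤ I := hD ▸ Nat.find_spec hex
  have hbig : ∀ q, D < q → ∀ p : MvPolynomial σ ℚ, p.IsHomogeneous q → p ∈ I := fun q hq p hp =>
    hDI (Ideal.pow_le_pow_right (by omega) (mem_pow_of_isHomogeneous hp))
  obtain ⟨ω, hω, hωI⟩ : ∃ ω : MvPolynomial σ ℚ, ω.IsHomogeneous D ∧ ω ∉ I := by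
    by_contra! hcon
    have := Nat.find_min' hex (pow_le_of_isHomogeneous hcon)
    omega
  refine ⟨D, hDI, ?_⟩
  obtain ⟨B, _, i, y, R, _, ρ, φ, hext, hρ, hk, hρX, hR, hφ, hs, hq, hφi, hφy⟩ :=
    exists_koszul_quasiIso hw hn hf S hS hX
  obtain ⟨ψ, hψω, hψI⟩ := Submodule.exists_dual_map_eq_bot_of_notMem (p := I.restrictScalars ℚ)
    (x := ω) hωI inferInstance
  have hψI : ∀ p ∈ I, ψ p = 0 := fun p hp => by
    have : ψ p ∈ (I.restrictScalars ℚ).map ψ := ⟨p, hp, rfl⟩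
    rwa [hψI] at this
  have hcomp : ∀ p ∈ I, homogeneousComponent D p ∈ I := fun p hp =>
    weightedHomogeneousComponent_mem_span (by rintro _ ⟨j, -, rfl⟩; exact ⟨_, hfl j⟩) hp D
  have hcs : ∀ p : MvPolynomial σ ℚ, p.IsHomogeneous D → homogeneousComponent D p = p := fun p hp =>
    hp.weightedHomogeneousComponent_same
  have hcn : ∀ (q : ℕ) (p : MvPolynomial σ ℚ), p.IsHomogeneous q → q ≠ D →
      homogeneousComponent D p = 0 := fun q p hp hq =>
    hp.weightedHomogeneousComponent_ne D hq.symm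
  let ε : R →ₗ[ℚ] ℚ := descend ρ hρ ((ψ ω)⁻¹ • ψ ∘ₗ homogeneousComponent D) (fun p hp => by
    simp [hψI _ (hcomp p ((hk p).1 hp))])
  have hε : ∀ p, ε (ρ p) = (ψ ω)⁻¹ * ψ (homogeneousComponent D p) := fun p =>
    descend_apply ρ hρ _ _ p
  let F : ℤ → Submodule ℚ R := fun p =>
    if p < 0 then ⊥ else (homogeneousSubmodule σ ℚ p.toNat).map ρ.toLinearMap
  have hF : ∀ p x, x ∈ F p → x = 0 ∨ 0 ≤ p ∧ ∃ a : MvPolynomial σ ℚ,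
      a.IsHomogeneous p.toNat ∧ ρ a = x := by
    intro p x hx
    simp only [F] at hx
    split_ifs at hx with hp
    · exact Or.inl hx
    · obtain ⟨a, ha, rfl⟩ := hx
      exact Or.inr ⟨by omega, a, ha, rfl⟩
  have hF' : ∀ p, 0 ≤ p → ∀ a : MvPolynomial σ ℚ, a.IsHomogeneous p.toNat → ρ a ∈ F p := by
    intro p hp a ha
    simp only [F]
    rw [if_neg (by omega)]
    exact ⟨a, ha, rfl⟩
  have hφρ : φ.comp i = ρ := AlgHom.ext hφi
  refine ⟨B, R, _, _, i, y, φ, F, ε, ρ ω, ⟨hext, hφ, hs, hq, ⟨?_, ?_, ?_, ?_⟩, fun s => ?_,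
    fun j hj => ?_⟩, ⟨?_, ?_, hR _, ?_, ?_⟩⟩
  · rw [← map_one ρ]; exact hF' 0 le_rfl 1 (isHomogeneous_one σ ℚ)
  · intro p q a b ha hb
    rcases hF p a ha with rfl | ⟨hp, a, ha', rfl⟩
    · rw [zero_mul]; exact zero_mem _
    rcases hF q b hb with rfl | ⟨hq, b, hb', rfl⟩
    · rw [mul_zero]; exact zero_mem _
    rw [← map_mul]
    refine hF' _ (by omega) _ ?_
    rw [Int.toNat_add hp hq]
    exact IsHomogeneous.mul ha' hb'
  · intro p a ha
    rcases hF p a ha with rfl | ⟨hp, a, ha', rfl⟩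
    · rwa [map_zero]
    · rwa [poly_par hw hρX]
  · intro p hp a ha
    rcases hF p a ha with rfl | ⟨hp, a, ha', rfl⟩
    · rfl
    · exact (hk a).2 (hbig _ (by omega) a ha')
  · rw [hφi]; exact hF' 1 (by norm_num) _ (isHomogeneous_X ℚ s)
  · rw [hφy j hj]; exact zero_mem _
  · intro b; rw [hR, map_zero]
  · intro q hq b hb
    rcases hF q b hb with rfl | ⟨hq, a, ha, rfl⟩
    · rw [map_zero]
    · rw [hε, hcn _ a ha (by omega), map_zero, mul_zero]
  · rw [hε, hcs ω hω, inv_mul_cancel₀ hψω]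
  · intro g hg
    rw [hφρ, ← map_mul, hk]
    exact hDI (pow_succ 𝔪 D ▸ Ideal.mul_mem_mul (mem_pow_of_isHomogeneous hω) hg)

end Base

section Reduction

theorem exists_homogeneous_relation {ι τ : Type} [Fintype ι] [Fintype τ] {l : ℕ}
    {p : ι → MvPolynomial τ ℚ} (hp : ∀ i, (p i).IsHomogeneous l) (hl : 0 < l)
    (hc : Fintype.card τ < Fintype.card ι) :
    ∃ (e : ℕ) (h : MvPolynomial ι ℚ), 0 < e ∧ h ≠ 0 ∧ h.IsHomogeneous e ∧ aeval p h = 0 := by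
  have hdep : ¬ AlgebraicIndependent ℚ p := fun hi => by
    have := hi.cardinalMk_le_trdeg
    rw [MvPolynomial.trdeg_of_isDomain] at this
    simp at this
    omega
  obtain ⟨h, hh, h0⟩ : ∃ h : MvPolynomial ι ℚ, aeval p h = 0 ∧ h ≠ 0 := by
    by_contra! hcon
    exact hdep ((injective_iff_map_eq_zero _).2 hcon)
  obtain ⟨e, he⟩ : ∃ e, homogeneousComponent e h ≠ 0 := by
    by_contra! hcon
    rw [← sum_homogeneousComponent h, Finset.sum_eq_zero fun e _ => hcon e] at h0
    exact h0 rfl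
  have hhom := homogeneousComponent_isHomogeneous e h
  have key : aeval p (homogeneousComponent e h) = 0 := by
    have hz := congrArg (homogeneousComponent (l * e)) hh
    rw [map_zero, ← sum_homogeneousComponent h, map_sum, map_sum, Finset.sum_eq_single e] at hz
    · rwa [homogeneousComponent_eq_self (hhom.aeval p hp)] at hz
    · intro c _ hce
      have hc := (homogeneousComponent_isHomogeneous c h).aeval p hp
      rw [homogeneousComponent_of_mem hc, if_neg]
      exact fun h => hce (Nat.eq_of_mul_eq_mul_left hl h).symm
    · intro hne
      rw [homogeneousComponent_eq_zero e h (by simpa using hne), map_zero, map_zero]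
  refine ⟨e, _, Nat.pos_of_ne_zero fun h => he ?_, he, hhom, key⟩
  subst h
  rw [homogeneousComponent_zero, aeval_C] at key
  rw [homogeneousComponent_zero, (map_eq_zero_iff _ (algebraMap ℚ _).injective).1 key, C_0]

theorem aeval_smul_of_isHomogeneous {ι R : Type} [CommRing R] [Algebra ℚ R] {e : ℕ}
    {h : MvPolynomial ι ℚ} (hh : h.IsHomogeneous e) (t : ι → ℚ) (x : R) :
    aeval (fun i => t i • x) h = eval t h • x ^ e := by
  rw [aeval_def, eval₂_eq, eval_eq, Finset.sum_smul]
  refine Finset.sum_congr rfl fun d hd => ?_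
  rw [hh.degree_eq_sum_deg_support hd, ← Algebra.smul_def, mul_smul]
  simp only [smul_pow, Finset.prod_smul, Finset.prod_pow_eq_pow_sum]

theorem exists_hyperplane {τ Z : Type} [Fintype τ] [AddCommGroup Z] [Module ℚ Z]
    [FiniteDimensional ℚ Z] (g : Z →ₗ[ℚ] MvPolynomial τ ℚ) {l : ℕ} (hl : 0 < l)
    (hg : ∀ z, (g z).IsHomogeneous l) (hc : Fintype.card τ < Module.finrank ℚ Z) :
    ∃ K : Submodule ℚ Z, K ≠ ⊤ ∧ ∀ z, g z ∈ (Ideal.span (g '' K)).radical := by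
  let b := Module.finBasis ℚ Z
  obtain ⟨e, h, he, h0, hh, hrel⟩ := exists_homogeneous_relation (p := fun i => g (b i))
    (fun i => hg (b i)) hl
    (by rwa [Fintype.card_fin])
  obtain ⟨t, ht⟩ : ∃ t, eval t h ≠ 0 := by
    by_contra! hcon
    exact h0 (MvPolynomial.funext fun t => by rw [hcon, map_zero])
  let T : Z →ₗ[ℚ] ℚ := b.constr ℚ t
  have hTb : ∀ i, T (b i) = t i := fun i => b.constr_basis ℚ t i
  obtain ⟨v, hv⟩ : ∃ v, T v = 1 := by
    obtain ⟨i, hi⟩ : ∃ i, t i ≠ 0 := by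
      by_contra! hcon
      obtain rfl : t = 0 := funext hcon
      refine ht ?_
      rw [show (0 : Fin (Module.finrank ℚ Z) → ℚ) = fun _ => 0 from rfl, eval_zero',
        constantCoeff_eq]
      exact hh.coeff_eq_zero (by simpa using he.ne)
    exact ⟨(t i)⁻¹ • b i, by rw [map_smul, hTb, smul_eq_mul, inv_mul_cancel₀ hi]⟩
  let I := Ideal.span (g '' (LinearMap.ker T : Set Z))
  have hdec : ∀ z, g z = T z • g v + g (z - T z • v) := fun z => by
    rw [map_sub, map_smul]; abel
  have hI : ∀ z, g (z - T z • v) ∈ I := fun z =>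
    Ideal.subset_span ⟨_, by simp [hv], rfl⟩
  have hmem : g v ^ e ∈ I := by
    let q := Ideal.Quotient.mkₐ ℚ I
    have hq : ∀ i, q (g (b i)) = t i • q (g v) := fun i => by
      rw [hdec (b i), map_add, map_smul, show q (g (b i - T (b i) • v)) = 0 from
        Ideal.Quotient.eq_zero_iff_mem.2 (hI (b i)), add_zero, hTb]
    have := congrArg q hrel
    rw [map_zero, ← AlgHom.comp_apply, comp_aeval, funext hq, aeval_smul_of_isHomogeneous hh,
      smul_eq_zero_iff_right ht, ← map_pow] at this
    exact Ideal.Quotient.eq_zero_iff_mem.1 this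
  refine ⟨LinearMap.ker T, fun htop => ?_, fun z => ?_⟩
  · have : v ∈ LinearMap.ker T := htop ▸ trivial
    rw [LinearMap.mem_ker, hv] at this
    exact one_ne_zero this
  · rw [hdec z, MvPolynomial.smul_eq_C_mul]
    exact Ideal.add_mem _ (Ideal.mul_mem_left _ _ ⟨e, hmem⟩) (Ideal.le_radical (hI z))

theorem exists_reduction {τ Y : Type} [Fintype τ] [AddCommGroup Y] [Module ℚ Y]
    [FiniteDimensional ℚ Y] (g : Y →ₗ[ℚ] MvPolynomial τ ℚ) {l : ℕ} (hl : 0 < l)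
    (hg : ∀ z, (g z).IsHomogeneous l) :
    ∃ Z : Submodule ℚ Y, Module.finrank ℚ Z ≤ Fintype.card τ ∧
      ∀ y, g y ∈ (Ideal.span (g '' Z)).radical := by
  suffices ∀ (N : ℕ) (Z : Submodule ℚ Y), Module.finrank ℚ Z ≤ N →
      (∀ y, g y ∈ (Ideal.span (g '' Z)).radical) → ∃ Z : Submodule ℚ Y,
      Module.finrank ℚ Z ≤ Fintype.card τ ∧ ∀ y, g y ∈ (Ideal.span (g '' Z)).radical from
    this _ ⊤ le_rfl fun y => Ideal.le_radical (Ideal.subset_span ⟨y, trivial, rfl⟩)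
  intro N
  induction N with
  | zero => exact fun Z hZ hr => ⟨Z, hZ.trans (Nat.zero_le _), hr⟩
  | succ N ih =>
    intro Z hZ hr
    by_cases hc : Fintype.card τ < Module.finrank ℚ Z
    · obtain ⟨K, hK, hKr⟩ := exists_hyperplane (g ∘ₗ Z.subtype) hl (fun z => hg z) hc
      have himg : (g ∘ₗ Z.subtype) '' K = g '' (K.map Z.subtype : Submodule ℚ Y) := by
        rw [Submodule.map_coe, Set.image_image]; rfl
      refine ih (K.map Z.subtype) ?_ fun y => ?_
      · rw [Submodule.finrank_map_subtype_eq]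
        have := Submodule.finrank_lt hK
        omega
      · rw [himg] at hKr
        have hle : Ideal.span (g '' Z) ≤ (Ideal.span (g '' (K.map Z.subtype :
            Submodule ℚ Y))).radical := by
          rw [Ideal.span_le]
          rintro _ ⟨z, hz, rfl⟩
          exact hKr ⟨z, hz⟩
        exact Ideal.radical_le_radical_iff.2 hle (hr y)
    · exact ⟨Z, not_lt.1 hc, hr⟩

end Reduction

section WeightReduction

open Classical in
/-- Setting to zero all variables outside a set. -/
def restrictVars {σ : Type} (P : σ → Prop) : MvPolynomial σ ℚ →ₐ[ℚ] MvPolynomial {s // P s} ℚ :=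
  aeval fun s => if h : P s then X ⟨s, h⟩ else 0

open Classical in
theorem rename_restrictVars_X {σ : Type} (P : σ → Prop) (s : σ) :
    rename Subtype.val (restrictVars P (X s)) = if P s then (X s : MvPolynomial σ ℚ) else 0 := by
  rw [restrictVars, aeval_X]
  split_ifs <;> simp

theorem isHomogeneous_restrictVars {σ : Type} (P : σ → Prop) {p : MvPolynomial σ ℚ} {l : ℕ}
    (hp : p.IsHomogeneous l) : (restrictVars P p).IsHomogeneous l := by
  have := hp.aeval (n := 1) (fun s => restrictVars P (X s)) fun s => by
    rw [restrictVars, aeval_X]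
    split_ifs
    · exact isHomogeneous_X _ _
    · exact isHomogeneous_zero _ _ _
  rw [one_mul] at this
  convert this
  ext s
  simp

theorem restrictVars_monomial {σ : Type} (P : σ → Prop) (m : σ →₀ ℕ) (c : ℚ) :
    (∀ s ∈ m.support, P s) ∧
      rename Subtype.val (restrictVars P (monomial m c)) = (monomial m c : MvPolynomial σ ℚ) ∨
    (∃ s ∈ m.support, ¬ P s) ∧
      rename Subtype.val (restrictVars P (monomial m c)) = (0 : MvPolynomial σ ℚ) := by
  by_cases h : ∀ s ∈ m.support, P s
  · refine Or.inl ⟨h, ?_⟩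
    rw [monomial_eq, map_mul, map_mul, Finsupp.prod, map_prod, map_prod]
    congr 1
    · simp [algHom_C]
    · refine Finset.prod_congr rfl fun s hs => ?_
      rw [map_pow, map_pow, rename_restrictVars_X, if_pos (h s hs)]
  · push Not at h
    refine Or.inr ⟨h, ?_⟩
    obtain ⟨s, hs, hP⟩ := h
    rw [monomial_eq, map_mul, map_mul, Finsupp.prod, map_prod, map_prod,
      Finset.prod_eq_zero hs, mul_zero]
    rw [map_pow, map_pow, rename_restrictVars_X, if_neg hP, zero_pow (Finsupp.mem_support_iff.1 hs)]

variable {σ : Type} {w : σ → ℕ} {l : ℕ}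

theorem sub_restrictVars_mem {d : ℕ} {I : Ideal (MvPolynomial σ ℚ)}
    (hI : ∀ s, w s < d → X s ∈ I) {p : MvPolynomial σ ℚ} (hp : p.IsHomogeneous l)
    (hpw : IsWeightedHomogeneous w p (l * d)) :
    p - rename Subtype.val (restrictVars (fun s => w s = d) p) ∈ I := by
  rw [p.as_sum, map_sum, map_sum, ← Finset.sum_sub_distrib]
  refine Ideal.sum_mem _ fun m hm => ?_
  rcases restrictVars_monomial (fun s => w s = d) m (coeff m p) with ⟨-, h⟩ | ⟨⟨t, ht, htd⟩, h⟩
  · rw [h, sub_self]; exact zero_mem _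
  · rw [h, sub_zero]
    obtain ⟨s, hs, hsd⟩ : ∃ s ∈ m.support, w s < d := by
      by_contra! hcon
      have h1 := hpw (mem_support_iff.1 hm)
      rw [Finsupp.weight_apply, Finsupp.sum, hp.degree_eq_sum_deg_support hm,
        Finset.sum_mul] at h1
      refine (Finset.sum_lt_sum (fun s hs => ?_) ⟨t, ht, ?_⟩).ne' h1
      · exact Nat.mul_le_mul_left _ (hcon s hs)
      · exact Nat.mul_lt_mul_of_pos_left (lt_of_le_of_ne (hcon t ht) (Ne.symm htd))
          (Nat.pos_of_ne_zero (Finsupp.mem_support_iff.1 ht))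
    classical
    rw [monomial_eq, Finsupp.prod, ← Finset.mul_prod_erase _ _ hs]
    refine Ideal.mul_mem_left _ _ (Ideal.mul_mem_right _ _ ?_)
    exact Ideal.pow_mem_of_mem _ (hI s hsd) _ (Nat.pos_of_ne_zero (Finsupp.mem_support_iff.1 hs))

theorem restrictVars_eq_zero {d N : ℕ} (hN : N ≠ l * d) {p : MvPolynomial σ ℚ}
    (hp : p.IsHomogeneous l) (hpw : IsWeightedHomogeneous w p N) :
    rename Subtype.val (restrictVars (fun s => w s = d) p) = (0 : MvPolynomial σ ℚ) := by
  rw [p.as_sum, map_sum, map_sum]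
  refine Finset.sum_eq_zero fun m hm => ?_
  rcases restrictVars_monomial (fun s => w s = d) m (coeff m p) with ⟨h, -⟩ | ⟨-, h⟩
  · refine absurd ?_ hN
    rw [← hpw (mem_support_iff.1 hm), hp.degree_eq_sum_deg_support hm, Finsupp.weight_apply,
      Finsupp.sum, Finset.sum_mul]
    exact Finset.sum_congr rfl fun s hs => by rw [h s hs, smul_eq_mul]
  · exact h

theorem exists_weighted_reduction [Fintype σ] {E : Type} [Fintype E] (hl : 0 < l) {n : E → ℕ}
    (hn : Function.Injective n) (Y : E → Type) [∀ e, AddCommGroup (Y e)] [∀ e, Module ℚ (Y e)]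
    [∀ e, FiniteDimensional ℚ (Y e)] (L : ∀ e, Y e →ₗ[ℚ] MvPolynomial σ ℚ)
    (hL : ∀ e y, (L e y).IsHomogeneous l)
    (hLw : ∀ e y, IsWeightedHomogeneous w (L e y) (n e + 1))
    (hX : ∀ s, (X s : MvPolynomial σ ℚ) ∈ (Ideal.span (⋃ e, Set.range (L e))).radical) :
    ∃ Z : ∀ e, Submodule ℚ (Y e), ∑ e, Module.finrank ℚ (Z e) ≤ Fintype.card σ ∧
      ∀ s, (X s : MvPolynomial σ ℚ) ∈ (Ideal.span (⋃ e, L e '' Z e)).radical := by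
  classical
  choose Z hZ hZr using fun e => exists_reduction
    ((restrictVars fun s => l * w s = n e + 1).toLinearMap ∘ₗ L e) hl
    (fun y => isHomogeneous_restrictVars _ (hL e y))
  refine ⟨Z, ?_, ?_⟩
  · refine (Finset.sum_le_sum fun e _ => hZ e).trans ?_
    rw [← Fintype.card_sigma]
    refine Fintype.card_le_of_injective (fun x => x.2.1) ?_
    rintro ⟨e, s, hs⟩ ⟨e', s', hs'⟩ (rfl : s = s')
    obtain rfl : e = e' := hn (by omega)
    rfl
  · intro s
    generalize hd : w s = d
    induction d using Nat.strong_induction_on generalizing s with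
    | _ d ih =>
      let I := (Ideal.span (⋃ e, L e '' (Z e : Set (Y e)))).radical
      have hI : ∀ s, w s < d → X s ∈ I := fun s hs => ih _ hs s rfl
      let ψ : MvPolynomial σ ℚ →ₐ[ℚ] MvPolynomial σ ℚ :=
        (rename Subtype.val).comp (restrictVars fun s => w s = d)
      have key : ∀ e y, ψ (L e y) ∈ I := by
        intro e y
        by_cases he : n e + 1 = l * d
        · have hiff : ∀ s, l * w s = n e + 1 ↔ w s = d := fun s => by
            rw [he]; exact Nat.mul_right_inj hl.ne'
          have hψ : ψ = (rename Subtype.val).comp (restrictVars fun s => l * w s = n e + 1) := by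
            ext1 s
            simp only [ψ, AlgHom.comp_apply, rename_restrictVars_X, hiff]
            congr
          have hz : ∀ z ∈ Z e, ψ (L e z) ∈ I := fun z hz => by
            have h1 : L e z ∈ I := Ideal.le_radical (Ideal.subset_span
              (Set.mem_iUnion.2 ⟨e, z, hz, rfl⟩))
            have h2 := sub_restrictVars_mem hI (hL e z) (he ▸ hLw e z)
            have := Ideal.sub_mem _ h1 h2
            rwa [sub_sub_cancel] at this
          have hle : (Ideal.span (((restrictVars fun s => l * w s = n e + 1).toLinearMap ∘ₗ L e) ''
              (Z e : Set (Y e)))) ≤ I.comap (rename Subtype.val) := by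
            rw [Ideal.span_le]
            rintro _ ⟨z, hze, rfl⟩
            have := hz z hze
            rwa [hψ] at this
          have := Ideal.radical_mono hle (hZr e y)
          rw [← Ideal.comap_radical, Ideal.radical_idem] at this
          rw [hψ]
          exact this
        · rw [show ψ (L e y) = 0 from restrictVars_eq_zero he (hL e y) (hLw e y)]
          exact zero_mem _
      obtain ⟨k, hk⟩ := hX s
      have hle : Ideal.span (⋃ e, Set.range (L e)) ≤ I.comap ψ := by
        rw [Ideal.span_le]
        rintro _ ⟨_, ⟨e, rfl⟩, y, rfl⟩
        exact key e y
      have := hle hk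
      rw [Ideal.mem_comap, map_pow, show ψ (X s) = X s from
        (rename_restrictVars_X _ s).trans (if_pos hd)] at this
      exact (Ideal.radical_isRadical _) ⟨k, this⟩

end WeightReduction

section Free

variable {σ J : Type} {w : σ → ℕ} {n : J → ℕ} {f : J → MvPolynomial σ ℚ} {wt : J → ℤ}

/-- `A` is a free graded-commutative algebra on the families `x` and `v`. -/
structure IsFreeOn (w : σ → ℕ) (n : J → ℕ) (A : Type) [GCDGA A] (x : σ → A) (v : J → A) :
    Prop where
  x_mem : ∀ s, x s ∈ Gr A (w s)
  v_mem : ∀ j, v j ∈ Gr A (n j)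
  lift : ∀ (B : Type) [GCDGA B] (c : σ → B) (c' : J → B), (∀ s, c s ∈ Gr B (w s)) →
    (∀ j, c' j ∈ Gr B (n j)) → ∃ g : A →ₐ[ℚ] B, (∀ m, ∀ a ∈ Gr A m, g a ∈ Gr B m) ∧
      (∀ s, g (x s) = c s) ∧ ∀ j, g (v j) = c' j
  unique : ∀ g : A →ₐ[ℚ] A, (∀ m, ∀ a ∈ Gr A m, g a ∈ Gr A m) → (∀ s, g (x s) = x s) →
    (∀ j, g (v j) = v j) → ∀ a, g a = a

theorem IsExt.algHom_eq {S : Finset J} {B C : Type} [GCDGA B] [Ring C] [Algebra ℚ C]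
    {i : MvPolynomial σ ℚ →ₐ[ℚ] B} {y : J → B} (h : IsExt w n f S B i y) {g g' : B →ₐ[ℚ] C}
    (hx : ∀ s, g (i (X s)) = g' (i (X s))) (hy : ∀ j ∈ S, g (y j) = g' (y j)) : g = g' :=
  AlgHom.ext <| h.gen (AlgHom.equalizer g g')
    (DFunLike.congr_fun (MvPolynomial.algHom_ext hx : g.comp i = g'.comp i)) hy

theorem IsFreeOn.isExt [Fintype J] {A : Type} [GCDGA A] {x : σ → A} {v : J → A}
    (h : IsFreeOn w n A x v) (hw : ∀ s, Even (w s)) (hn : ∀ j, Odd (n j))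
    (hf : ∀ j, IsWeightedHomogeneous w (f j) (n j + 1)) (hx : ∀ s, Dd A (x s) = 0)
    (hv : ∀ j, Dd A (v j) = polyLift hw x h.x_mem (f j)) :
    IsExt w n f Finset.univ A (polyLift hw x h.x_mem) v := by
  classical
  obtain ⟨S, hS, B, _, i, y, Θ, hstage⟩ := exists_koszulStage hw hn hf
    (Finset.univ : Finset J).toList (Finset.nodup_toList _)
  obtain rfl : S = Finset.univ := by ext k; simp [hS]
  have hB := hstage.ext
  let p := polyLift hw x h.x_mem
  have hpX : ∀ s, p (X s) = x s := polyLift_X hw h.x_mem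
  obtain ⟨H, hH, hHi, hHy⟩ := hB.lift A p v (fun s => (hpX s).symm ▸ h.x_mem s)
    (fun s => (congrArg _ (hpX s)).trans (hx s)) (fun j _ => h.v_mem j) (fun j _ => hv j)
  obtain ⟨G, hG, hGx, hGv⟩ := h.lift B (fun s => i (X s)) y hB.X_mem
    (fun j => hB.y_mem j (Finset.mem_univ j))
  have hHG : ∀ a, H (G a) = a := h.unique (H.comp G) (fun m a ha => hH.2 _ _ (hG m a ha))
    (fun s => by rw [AlgHom.comp_apply, hGx, hHi, hpX])
    (fun j => by rw [AlgHom.comp_apply, hGv, hHy j (Finset.mem_univ j)])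
  have hGH : ∀ b, G (H b) = b := DFunLike.congr_fun
    (hB.algHom_eq (g := G.comp H) (g' := AlgHom.id ℚ B)
    (fun s => by rw [AlgHom.comp_apply, hHi, hpX, hGx]; rfl)
    (fun j hj => by rw [AlgHom.comp_apply, hHy j hj, hGv]; rfl))
  have hGd : IsDGAHom G := ⟨fun a => by
    conv_lhs => rw [← hHG a]
    rw [← hH.1, hGH], hG⟩
  have hGp : ∀ q, G (p q) = i q := fun q => by rw [← hHi, hGH]
  refine ⟨fun s => (hpX s).symm ▸ h.x_mem s, fun s => (congrArg _ (hpX s)).trans (hx s),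
    fun j _ => h.v_mem j, fun j _ => hv j, fun T hT hTv a => ?_, ?_⟩
  · rw [← hHG a]
    refine hB.gen (T.comap H) (fun q => ?_) (fun j hj => ?_) _
    · rw [Subalgebra.mem_comap, hHi]; exact hT q
    · rw [Subalgebra.mem_comap, hHy j hj]; exact hTv j hj
  · intro C _ k Y hX hd hY hdY
    obtain ⟨g, hg, hgi, hgy⟩ := hB.lift C k Y hX hd hY hdY
    exact ⟨g.comp G, hg.comp hGd, fun q => (congrArg g (hGp q)).trans (hgi q),
      fun j hj => (congrArg g (hGv j)).trans (hgy j hj)⟩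

theorem IsExt.exists_equiv {S : Finset J} {A B : Type} [GCDGA A] [GCDGA B]
    {i : MvPolynomial σ ℚ →ₐ[ℚ] B} {y : J → B} {p : MvPolynomial σ ℚ →ₐ[ℚ] A} {v : J → A}
    (hB : IsExt w n f S B i y) (hA : IsExt w n f S A p v) :
    ∃ (G : A →ₐ[ℚ] B) (H : B →ₐ[ℚ] A), IsDGAHom G ∧ IsDGAHom H ∧ (∀ a, H (G a) = a) ∧
      (∀ b, G (H b) = b) ∧ (∀ q, G (p q) = i q) ∧ ∀ j ∈ S, G (v j) = y j := by
  obtain ⟨G, hG, hGp, hGv⟩ := hA.lift B i y hB.X_mem hB.d_X hB.y_mem hB.d_y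
  obtain ⟨H, hH, hHi, hHy⟩ := hB.lift A p v hA.X_mem hA.d_X hA.y_mem hA.d_y
  refine ⟨G, H, hG, hH, DFunLike.congr_fun (hA.algHom_eq (g := H.comp G) (g' := AlgHom.id ℚ A)
    (fun s => ?_) (fun j hj => ?_)), DFunLike.congr_fun (hB.algHom_eq (g := G.comp H)
    (g' := AlgHom.id ℚ B) (fun s => ?_) (fun j hj => ?_)), hGp, hGv⟩
  · rw [AlgHom.comp_apply, hGp, hHi]; rfl
  · rw [AlgHom.comp_apply, hGv j hj, hHy j hj]; rfl
  · rw [AlgHom.comp_apply, hHi, hGp]; rfl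
  · rw [AlgHom.comp_apply, hHy j hj, hGv j hj]; rfl

theorem FilteredModel.transport {S : Finset J} {A B B' : Type} [GCDGA A] [GCDGA B] [GCDGA B']
    {i : MvPolynomial σ ℚ →ₐ[ℚ] B} {y : J → B} {φ : B →ₐ[ℚ] B'} {F : ℤ → Submodule ℚ B'} {N : ℤ}
    (h : FilteredModel w n f wt S B B' i y φ F N) {p : MvPolynomial σ ℚ →ₐ[ℚ] A} {v : J → A}
    (hA : IsExt w n f S A p v) : ∃ φ' : A →ₐ[ℚ] B', (∀ q, φ' (p q) = φ (i q)) ∧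
      FilteredModel w n f wt S A B' p v φ' F N := by
  obtain ⟨G, H, hG, hH, hHG, hGH, hGp, hGv⟩ := h.ext.exists_equiv hA
  have hφ : ∀ q, φ.comp G (p q) = φ (i q) := fun q => congrArg φ (hGp q)
  refine ⟨φ.comp G, hφ, hA, h.hom.comp hG, h.surj.comp fun b => ⟨H b, hGH b⟩, ⟨?_, ?_⟩, h.fam,
    fun s => (hφ _).symm ▸ h.X_mem s, fun j hj => ?_⟩
  · intro b hb
    obtain ⟨a, ha, c, hc⟩ := h.quasi.1 b hb
    refine ⟨H a, by rw [← hH.1, ha, map_zero], c, ?_⟩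
    rw [AlgHom.comp_apply, hGH, hc]
  · rintro a ha ⟨c, hc⟩
    obtain ⟨e, he⟩ := h.quasi.2 (G a) (by rw [← hG.1, ha, map_zero]) ⟨c, hc⟩
    exact ⟨H e, by rw [← hH.1, ← he, hHG]⟩
  · rw [AlgHom.comp_apply, hGv j hj]
    exact h.y_mem j hj

end Free

section Generators

variable {A : Type} [GCDGA A]

theorem exists_pr_eq_zero_of_finiteDimensional (U : Submodule ℚ A) [FiniteDimensional ℚ U] :
    ∃ N, ∀ m, N ≤ m → ∀ a ∈ U, pr A m a = 0 := by
  classical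
  obtain ⟨t, ht⟩ := (Submodule.fg_iff_finiteDimensional U).2 inferInstance
  choose N hN using fun a : A => exists_sum_pr a
  refine ⟨t.sup N, fun m hm a ha => ?_⟩
  have hle : U ≤ LinearMap.ker (pr A m) := by
    rw [← ht, Submodule.span_le]
    intro b hb
    have hNm : N b ≤ m := (Finset.le_sup hb).trans hm
    have h1 := hN b (m + 1) (by omega)
    rw [Finset.sum_range_succ, hN b m hNm] at h1
    exact left_eq_add.1 h1.symm
  exact hle ha

theorem pr_eq_zero_of_mem_biSup {U : ℕ → Submodule ℚ A} (hU : ∀ m, U m ≤ Gr A m) {E : Finset ℕ}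
    {m : ℕ} (hm : m ∉ E) {a : A} (ha : a ∈ ⨆ k ∈ E, U k) : pr A m a = 0 := by
  have hle : ⨆ k ∈ E, U k ≤ LinearMap.ker (pr A m) := iSup₂_le fun k hk b hb =>
    pr_ne (hU k hb) fun h => hm (h ▸ hk)
  exact hle ha

theorem finrank_biSup {U : ℕ → Submodule ℚ A} (hU : ∀ m, U m ≤ Gr A m)
    [∀ m, FiniteDimensional ℚ (U m)] (E : Finset ℕ) :
    FiniteDimensional ℚ (⨆ m ∈ E, U m : Submodule ℚ A) ∧
      Module.finrank ℚ (⨆ m ∈ E, U m : Submodule ℚ A) = ∑ m ∈ E, Module.finrank ℚ (U m) := by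
  classical
  induction E using Finset.induction_on with
  | empty =>
    rw [show (⨆ m ∈ (∅ : Finset ℕ), U m) = ⊥ by simp]
    exact ⟨inferInstance, by simp⟩
  | insert m E hm ih =>
    obtain ⟨ih1, ih2⟩ := ih
    rw [Finset.iSup_insert, Finset.sum_insert hm, ← ih2, ← Submodule.finrank_sup_add_finrank_inf_eq]
    refine ⟨inferInstance, ?_⟩
    have : U m ⊓ ⨆ k ∈ E, U k = ⊥ := by
      rw [eq_bot_iff]
      rintro a ⟨h1, h2⟩
      rw [Submodule.mem_bot, ← pr_same (hU m h1), pr_eq_zero_of_mem_biSup hU hm h2]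
    rw [this, finrank_bot, add_zero]

namespace MinimalSullivan

variable (S : MinimalSullivan A)

theorem exists_bound [FiniteDimensional ℚ (⨆ n, S.V n : Submodule ℚ A)] :
    ∃ N, ∀ m, N ≤ m → S.V m = ⊥ := by
  obtain ⟨N, hN⟩ := exists_pr_eq_zero_of_finiteDimensional (⨆ n, S.V n)
  refine ⟨N, fun m hm => eq_bot_iff.2 fun a ha => ?_⟩
  rw [Submodule.mem_bot, ← pr_same (S.V_le m ha), hN m hm a (Submodule.mem_iSup_of_mem m ha)]

variable {S} {N : ℕ}

theorem veven_eq (hN : ∀ m, N ≤ m → S.V m = ⊥) :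
    S.Veven = ⨆ m ∈ (Finset.range N).filter Even, S.V m := by
  refine le_antisymm (iSup_le fun k => ?_) (iSup₂_le fun m hm => ?_)
  · by_cases hk : 2 * k < N
    · exact le_iSup₂_of_le (2 * k) (by simp [hk]) le_rfl
    · rw [hN _ (not_lt.1 hk)]; exact bot_le
  · obtain ⟨k, rfl⟩ := (Finset.mem_filter.1 hm).2
    exact le_iSup_of_le k (by rw [two_mul])

theorem vodd_eq (hN : ∀ m, N ≤ m → S.V m = ⊥) :
    S.Vodd = ⨆ m ∈ (Finset.range N).filter Odd, S.V m := by
  refine le_antisymm (iSup_le fun k => ?_) (iSup₂_le fun m hm => ?_)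
  · by_cases hk : 2 * k + 1 < N
    · exact le_iSup₂_of_le (2 * k + 1) (by simp [hk]) le_rfl
    · rw [hN _ (not_lt.1 hk)]; exact bot_le
  · obtain ⟨k, rfl⟩ := (Finset.mem_filter.1 hm).2
    exact le_iSup_of_le k le_rfl

/-- The even (`P = Even`) or odd (`P = Odd`) degrees below `N`. -/
abbrev Degrees (N : ℕ) (P : ℕ → Prop) [DecidablePred P] : Type :=
  {m // m ∈ (Finset.range N).filter P}

theorem Degrees.prop {P : ℕ → Prop} [DecidablePred P] (m : Degrees N P) : P m.1 :=
  (Finset.mem_filter.1 m.2).2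

variable {β γ : ℕ → Type} [∀ m, Fintype (β m)] [∀ m, Fintype (γ m)]

theorem isFreeOn (hN : ∀ m, N ≤ m → S.V m = ⊥) (b : ∀ m, Module.Basis (β m) ℚ (S.V m))
    (c : ∀ m, Module.Basis (γ m) ℚ (S.V m)) :
    IsFreeOn (fun s : Σ m : Degrees N Even, β m => s.1.1)
      (fun j : Σ m : Degrees N Odd, γ m => j.1.1) A (fun s => b s.1 s.2) (fun j => c j.1 j.2) := by
  refine ⟨fun s => S.V_le _ (Subtype.mem _), fun j => S.V_le _ (Subtype.mem _), ?_, ?_⟩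
  · intro B _ k k' hk hk'
    let F : ∀ m, S.V m →ₗ[ℚ] B := fun m =>
      if h : m ∈ (Finset.range N).filter Even then (b m).constr ℚ fun i => k ⟨⟨m, h⟩, i⟩
      else if h : m ∈ (Finset.range N).filter Odd then (c m).constr ℚ fun i => k' ⟨⟨m, h⟩, i⟩
      else 0
    have hF : ∀ m (v : S.V m), F m v ∈ Gr B m := fun m v => by
      simp only [F]
      split_ifs with h1 h2
      · rw [Module.Basis.constr_apply_fintype]
        exact sum_mem fun i _ => Submodule.smul_mem _ _ (hk ⟨⟨m, h1⟩, i⟩)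
      · rw [Module.Basis.constr_apply_fintype]
        exact sum_mem fun i _ => Submodule.smul_mem _ _ (hk' ⟨⟨m, h2⟩, i⟩)
      · exact zero_mem _
    obtain ⟨g, ⟨hg, hgF⟩, -⟩ := S.free B F hF
    refine ⟨g, hg, fun s => ?_, fun j => ?_⟩
    · rw [hgF]
      simp only [F]
      rw [dif_pos s.1.2, Module.Basis.constr_basis]
    · rw [hgF]
      simp only [F]
      rw [dif_neg, dif_pos j.1.2, Module.Basis.constr_basis]
      exact fun h => Nat.not_even_iff_odd.2 (Degrees.prop j.1) (Finset.mem_filter.1 h).2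
  · intro g hg hb hc
    obtain ⟨g', -, hu⟩ := S.free A (fun m => (S.V m).subtype) fun m v => S.V_le m v.2
    have hgV : ∀ m (v : S.V m), g v = v := fun m v => by
      by_cases hm : N ≤ m
      · have : (v : A) = 0 := by simpa [hN m hm] using v.2
        rw [this, map_zero]
      rcases Nat.even_or_odd m with hp | hp
      · exact LinearMap.congr_fun ((b m).ext (f₁ := g.toLinearMap ∘ₗ (S.V m).subtype)
          (f₂ := (S.V m).subtype) fun i => hb ⟨⟨m, by simp [hp]; omega⟩, i⟩) v
      · exact LinearMap.congr_fun ((c m).ext (f₁ := g.toLinearMap ∘ₗ (S.V m).subtype)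
          (f₂ := (S.V m).subtype) fun i => hc ⟨⟨m, by simp [hp]; omega⟩, i⟩) v
    have h1 := hu g ⟨hg, hgV⟩
    have h2 := hu (AlgHom.id ℚ A) ⟨fun _ _ h => h, fun _ _ => rfl⟩
    exact DFunLike.congr_fun (h1.trans h2.symm)

theorem card_even (hN : ∀ m, N ≤ m → S.V m = ⊥) (b : ∀ m, Module.Basis (β m) ℚ (S.V m)) :
    Fintype.card (Σ m : Degrees N Even, β m) = Module.finrank ℚ S.Veven := by
  have := S.V_fin
  rw [veven_eq hN, (finrank_biSup S.V_le _).2, Fintype.card_sigma,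
    ← Finset.sum_coe_sort ((Finset.range N).filter Even)]
  exact Finset.sum_congr rfl fun m _ => (Module.finrank_eq_card_basis (b m)).symm

theorem card_odd (hN : ∀ m, N ≤ m → S.V m = ⊥) (b : ∀ m, Module.Basis (β m) ℚ (S.V m)) :
    Fintype.card (Σ m : Degrees N Odd, β m) = Module.finrank ℚ S.Vodd := by
  have := S.V_fin
  rw [vodd_eq hN, (finrank_biSup S.V_le _).2, Fintype.card_sigma,
    ← Finset.sum_coe_sort ((Finset.range N).filter Odd)]
  exact Finset.sum_congr rfl fun m _ => (Module.finrank_eq_card_basis (b m)).symm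

end MinimalSullivan

end Generators

namespace MinimalSullivan

variable {A : Type} [GCDGA A] (S : MinimalSullivan A)

/-- The projection onto the elements of word length `q`. -/
def lamProj (q : ℕ) : A →ₗ[ℚ] A :=
  (S.lam q).subtype ∘ₗ DirectSum.component ℚ ℕ (fun k => S.lam k) q ∘ₗ
    (LinearEquiv.ofBijective (DirectSum.coeLinearMap S.lam) S.lam_internal).symm.toLinearMap

variable {S}

theorem lamProj_apply_lof (p q : ℕ) (a : S.lam p) :
    S.lamProj q a = (DirectSum.lof ℚ ℕ (fun k => S.lam k) p a q : S.lam q) := by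
  have : (LinearEquiv.ofBijective (DirectSum.coeLinearMap S.lam) S.lam_internal).symm a =
      DirectSum.lof ℚ ℕ (fun k => S.lam k) p a := by
    rw [LinearEquiv.symm_apply_eq]
    exact (DirectSum.coeLinearMap_lof S.lam p a).symm
  simp only [lamProj, LinearMap.comp_apply, LinearEquiv.coe_coe, this]
  rfl

theorem lamProj_same {q : ℕ} {a : A} (h : a ∈ S.lam q) : S.lamProj q a = a := by
  rw [lamProj_apply_lof q q ⟨a, h⟩, DirectSum.lof_apply]

theorem lamProj_ne {p q : ℕ} {a : A} (h : a ∈ S.lam p) (hpq : p ≠ q) : S.lamProj q a = 0 := by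
  rw [lamProj_apply_lof p q ⟨a, h⟩, DirectSum.lof_eq_of, DirectSum.of_eq_of_ne _ _ _ hpq.symm]
  rfl

theorem mem_iSup_lam (a : A) : a ∈ ⨆ q, S.lam q := by
  rw [S.lam_internal.submodule_iSup_eq_top]; trivial

variable {σ : Type} {w : σ → ℕ}

theorem poly_mem_lam {h : MvPolynomial σ ℚ →ₐ[ℚ] A} (hX : ∀ s, h (X s) ∈ S.lam 1) {q : ℕ}
    {p : MvPolynomial σ ℚ} (hp : p.IsHomogeneous q) : h p ∈ S.lam q := by
  have hone : (1 : A) ∈ S.lam 0 := S.lam_zero ▸ Submodule.one_le.1 le_rfl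
  have hmon : ∀ e : σ →₀ ℕ, h (monomial e 1) ∈ S.lam e.degree := by
    intro e
    induction e using Finsupp.induction_linear with
    | zero => simpa using hone
    | add e f he hf =>
      rw [map_add, ← one_mul (1 : ℚ), ← monomial_mul, map_mul]
      exact S.lam_mul _ _ (Submodule.mul_mem_mul he hf)
    | single s k =>
      induction k with
      | zero => simpa using hone
      | succ k ih =>
        rw [Finsupp.single_add, map_add, ← one_mul (1 : ℚ), ← monomial_mul, map_mul]
        refine S.lam_mul _ _ (Submodule.mul_mem_mul ih ?_)
        simpa [X] using hX s
  rw [p.as_sum, map_sum]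
  refine sum_mem fun e he => ?_
  rw [← mul_one (coeff e p), ← smul_eq_mul, ← smul_monomial, map_smul]
  refine Submodule.smul_mem _ _ ?_
  have hd : e.degree = q := by
    rw [Finsupp.degree_eq_weight_one]; exact hp (mem_support_iff.1 he)
  exact hd ▸ hmon e

theorem poly_homogeneousComponent {h : MvPolynomial σ ℚ →ₐ[ℚ] A} (hX : ∀ s, h (X s) ∈ S.lam 1)
    (q : ℕ) (p : MvPolynomial σ ℚ) : h (homogeneousComponent q p) = S.lamProj q (h p) := by
  conv_rhs => rw [← sum_homogeneousComponent p]
  rw [map_sum, map_sum, Finset.sum_eq_single q]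
  · exact (lamProj_same (poly_mem_lam hX (homogeneousComponent_isHomogeneous q p))).symm
  · exact fun k _ hk => lamProj_ne (poly_mem_lam hX (homogeneousComponent_isHomogeneous k p)) hk
  · intro hq
    rw [homogeneousComponent_eq_zero q p (by simpa using hq), map_zero, map_zero]

end MinimalSullivan

section

variable {A : Type} [GCDGA A] {σ : Type} {w : σ → ℕ}

theorem poly_weightedHomogeneousComponent {h : MvPolynomial σ ℚ →ₐ[ℚ] A}
    (hX : ∀ s, h (X s) ∈ Gr A (w s)) (N : ℕ) (p : MvPolynomial σ ℚ) :
    h (weightedHomogeneousComponent w N p) = pr A N (h p) := by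
  conv_rhs => rw [← sum_weightedHomogeneousComponent w p]
  rw [finsum_eq_sum _ (weightedHomogeneousComponent_finsupp p), map_sum, map_sum]
  rw [Finset.sum_eq_single N]
  · exact (pr_same (poly_mem hX (weightedHomogeneousComponent_isWeightedHomogeneous N p))).symm
  · exact fun k _ hk =>
      pr_ne (poly_mem hX (weightedHomogeneousComponent_isWeightedHomogeneous k p)) hk
  · intro hq
    have : weightedHomogeneousComponent w N p = 0 := by
      by_contra hne
      exact hq ((Set.Finite.mem_toFinset _).2 hne)
    rw [this, map_zero, map_zero]

end

namespace MinimalSullivan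

variable {A : Type} [GCDGA A] {S : MinimalSullivan A} {σ : Type} {w : σ → ℕ}

theorem exists_poly_differential (hpure : S.Pure) {l : ℕ} (hlen : S.ConstantLength l)
    {h : MvPolynomial σ ℚ →ₐ[ℚ] A} (hX : ∀ s, h (X s) ∈ Gr A (w s))
    (hX1 : ∀ s, h (X s) ∈ S.lam 1) (hV : ∀ m, Even m → S.V m ≤ Subalgebra.toSubmodule h.range)
    {m : ℕ} (hm : Odd m) {v : A} (hv : v ∈ S.V m) :
    ∃ p : MvPolynomial σ ℚ, p.IsHomogeneous l ∧ IsWeightedHomogeneous w p (m + 1) ∧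
      h p = Dd A v := by
  have hle : Algebra.adjoin ℚ (S.Veven : Set A) ≤ h.range := by
    refine Algebra.adjoin_le ?_
    have : S.Veven ≤ Subalgebra.toSubmodule h.range := iSup_le fun k => hV _ (even_two_mul k)
    exact this
  obtain ⟨k, rfl⟩ := hm
  obtain ⟨p, hp⟩ := hle (hpure.2 v (Submodule.mem_iSup_of_mem k hv))
  have hp : h p = Dd A v := hp
  refine ⟨homogeneousComponent l (weightedHomogeneousComponent w (2 * k + 1 + 1) p),
    homogeneousComponent_isHomogeneous _ _, fun e he => ?_, ?_⟩
  · rw [coeff_homogeneousComponent] at he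
    exact weightedHomogeneousComponent_isWeightedHomogeneous _ p (ite_ne_right_iff.1 he).2
  · rw [poly_homogeneousComponent hX1, poly_weightedHomogeneousComponent hX, hp,
      pr_same (Dd_mem (S.V_le _ hv)), lamProj_same (hlen _ v hv)]

end MinimalSullivan

section Nilpotent

variable {A : Type} [GCDGA A]

theorem pr_zero_Dd (a : A) : pr A 0 (Dd A a) = 0 := by
  induction a using gr_induction with
  | hom i a ha => exact pr_ne (Dd_mem ha) i.succ_ne_zero
  | add a b ha hb => rw [map_add, map_add, ha, hb, add_zero]

theorem exists_pow_exact [FiniteDimensional ℚ (CohClasses A)] {k : ℕ} (hk : 0 < k) {x : A}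
    (hx : x ∈ Gr A k) (hd : Dd A x = 0) : ∃ (e : ℕ) (a : A), x ^ e = Dd A a := by
  have hpow : ∀ e, x ^ e ∈ Gr A (e * k) := fun e => by
    induction e with
    | zero => simpa using one_mem_gr
    | succ e ih => rw [pow_succ, Nat.succ_mul]; exact mul_mem_gr ih hx
  have hdpow : ∀ e, Dd A (x ^ e) = 0 := fun e => by
    induction e with
    | zero => rw [pow_zero, Dd_one]
    | succ e ih => rw [pow_succ, Dd_mul' , hd, ih, zero_mul, mul_zero, add_zero]
  let c : ℕ → CohClasses A := fun e =>
    Submodule.Quotient.mk (p := (LinearMap.range (Dd A)).comap (LinearMap.ker (Dd A)).subtype)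
      ⟨x ^ e, hdpow e⟩
  have hli : ¬ LinearIndependent ℚ c := fun h => by
    have := h.finite
    exact not_finite ℕ
  obtain ⟨t, g, hsum, e, he, hge⟩ := not_linearIndependent_iff.1 hli
  have hsum' : ∃ a, Dd A a = ∑ i ∈ t, g i • x ^ i := by
    have h1 : (Submodule.mkQ ((LinearMap.range (Dd A)).comap (LinearMap.ker (Dd A)).subtype))
        (∑ i ∈ t, g i • ⟨x ^ i, hdpow i⟩) = 0 := by
      rw [map_sum]
      simp only [map_smul]
      exact hsum
    obtain ⟨a, ha⟩ := (Submodule.Quotient.mk_eq_zero _).1 h1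
    refine ⟨a, ha.trans ?_⟩
    simp
  obtain ⟨a, ha⟩ := hsum'
  have h2 := congrArg (pr A (e * k)) ha
  rw [map_sum, Finset.sum_eq_single e, map_smul, pr_same (hpow e)] at h2
  · rcases h0 : e * k with _ | m
    · rw [h0, pr_zero_Dd] at h2
      refine ⟨e, 0, ?_⟩
      rw [map_zero]
      exact (smul_eq_zero.1 h2.symm).resolve_left hge
    · rw [h0, ← Dd_pr] at h2
      refine ⟨e, (g e)⁻¹ • pr A m a, ?_⟩
      rw [map_smul, h2, smul_smul, inv_mul_cancel₀ hge, one_smul]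
  · intro i _ hi
    rw [map_smul, pr_ne (hpow i), smul_zero]
    exact fun h => hi (Nat.eq_of_mul_eq_mul_right hk h)
  · exact fun h => absurd he h

variable {σ J : Type} {w : σ → ℕ} {n : J → ℕ} {f : J → MvPolynomial σ ℚ}

theorem IsExt.exists_pow_mem [Fintype J] [FiniteDimensional ℚ (CohClasses A)]
    {p : MvPolynomial σ ℚ →ₐ[ℚ] A} {v : J → A} (h : IsExt w n f Finset.univ A p v)
    (hw : ∀ s, Even (w s)) (hw0 : ∀ s, 0 < w s)
    (hf : ∀ j, IsWeightedHomogeneous w (f j) (n j + 1)) (s : σ) :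
    ∃ e, (X s : MvPolynomial σ ℚ) ^ e ∈ Ideal.span (Set.range f) := by
  obtain ⟨R, _, ρ, hs, hk, hρX, hR⟩ := exists_poly_quotient hw (Ideal.span (Set.range f)) (by
    intro N p hp
    exact weightedHomogeneousComponent_mem_span (by rintro _ ⟨j, rfl⟩; exact ⟨_, hf j⟩) hp N)
  obtain ⟨φ, hφ, hφi, -⟩ := h.lift R ρ 0 hρX (fun s => hR _) (fun j _ => zero_mem _)
    (fun j _ => by rw [hR, (hk _).2 (Ideal.subset_span ⟨j, rfl⟩)])
  obtain ⟨e, a, ha⟩ := exists_pow_exact (hw0 s) (h.X_mem s) (h.d_X s)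
  exact ⟨e, (hk _).1 (by rw [← hφi, map_pow, ha, hφ.1, hR])⟩

end Nilpotent

section Basis

variable {M : Type} [AddCommGroup M] [Module ℚ M] [FiniteDimensional ℚ M]

theorem exists_basis_extending (Z : Submodule ℚ M) :
    ∃ (k : ℕ) (b : Module.Basis (Fin (Module.finrank ℚ Z) ⊕ Fin k) ℚ M),
      ∀ x ∈ Z, x ∈ Submodule.span ℚ (Set.range fun i => b (Sum.inl i)) := by
  obtain ⟨C, hC⟩ := Submodule.exists_isCompl Z
  let b := ((Module.finBasis ℚ Z).prod (Module.finBasis ℚ C)).map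
    (Submodule.prodEquivOfIsCompl Z C hC)
  have hb : ∀ i, b (Sum.inl i) = Module.finBasis ℚ Z i := fun i => by simp [b]
  refine ⟨_, b, fun x hx => ?_⟩
  have h1 := Submodule.mem_map_of_mem (f := Z.subtype)
    ((Module.finBasis ℚ Z).mem_span (⟨x, hx⟩ : Z))
  rw [Submodule.map_span, ← Set.range_comp] at h1
  simpa [Function.comp_def, hb] using h1

end Basis

namespace MinimalSullivan

variable {A : Type} [GCDGA A]

/-- A presentation of `A` by closed even generators `p (X s)` and odd generators `v j` with
`d (v j) = p (f j)`, together with a set `κ` of odd generators which already make the even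
generators nilpotent. -/
structure IsPresentation (S : MinimalSullivan A) (l : ℕ) {σ J : Type} [Fintype σ] [Fintype J]
    (w : σ → ℕ) (n : J → ℕ) (f : J → MvPolynomial σ ℚ) (κ : Finset J)
    (p : MvPolynomial σ ℚ →ₐ[ℚ] A) (v : J → A) : Prop where
  even : ∀ s, Even (w s)
  odd : ∀ j, Odd (n j)
  weighted : ∀ j, IsWeightedHomogeneous w (f j) (n j + 1)
  homogeneous : ∀ j, (f j).IsHomogeneous l
  ext : IsExt w n f Finset.univ A p v
  X_mem_lam : ∀ s, p (X s) ∈ S.lam 1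
  mem_lam : ∀ j, v j ∈ S.lam 1
  nilpotent : ∀ s, ∃ e, (X s : MvPolynomial σ ℚ) ^ e ∈ Ideal.span (f '' (κ : Set J))
  card_le : κ.card ≤ Fintype.card σ
  card_even : Fintype.card σ = Module.finrank ℚ S.Veven
  card_odd : Fintype.card J = Module.finrank ℚ S.Vodd

theorem V_le_lam_one (S : MinimalSullivan A) (m : ℕ) : S.V m ≤ S.lam 1 :=
  S.lam_one ▸ le_iSup S.V m

theorem exists_isPresentation {S : MinimalSullivan A} (hpure : S.Pure) (hell : Elliptic A S)
    {l : ℕ} (hl : 0 < l) (hlen : S.ConstantLength l) :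
    ∃ (σ J : Type) (_ : Fintype σ) (_ : Fintype J) (w : σ → ℕ) (n : J → ℕ)
      (f : J → MvPolynomial σ ℚ) (κ : Finset J) (p : MvPolynomial σ ℚ →ₐ[ℚ] A) (v : J → A),
      S.IsPresentation l w n f κ p v := by
  classical
  have := S.V_fin
  have := hell.1
  have := hell.2
  obtain ⟨N, hN⟩ := S.exists_bound
  let b : ∀ m, Module.Basis (Fin (Module.finrank ℚ (S.V m))) ℚ (S.V m) :=
    fun m => Module.finBasis ℚ (S.V m)
  let σ := Σ m : Degrees N Even, Fin (Module.finrank ℚ (S.V m))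
  let w : σ → ℕ := fun s => s.1.1
  let x : σ → A := fun s => b s.1 s.2
  have hw : ∀ s, Even (w s) := fun s => s.1.prop
  have hw0 : ∀ s, 0 < w s := by
    rintro ⟨⟨m, hm⟩, i⟩
    refine Nat.pos_of_ne_zero fun h => ?_
    obtain rfl : m = 0 := h
    have h0 : Module.finrank ℚ (S.V 0) = 0 := by rw [S.V0, finrank_bot]
    exact (h0 ▸ i : Fin 0).elim0
  have hxm : ∀ s, x s ∈ Gr A (w s) := fun s => S.V_le _ (Subtype.mem _)
  let p := polyLift hw x hxm
  have hpX : ∀ s, p (X s) = x s := fun s => polyLift_X hw hxm s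
  have hpm : ∀ s, p (X s) ∈ Gr A (w s) := fun s => (hpX s).symm ▸ hxm s
  have hpl : ∀ s, p (X s) ∈ S.lam 1 := fun s => (hpX s).symm ▸ S.V_le_lam_one _ (Subtype.mem _)
  have hdx : ∀ s, Dd A (x s) = 0 := fun s => by
    obtain ⟨k, hk⟩ := (hw s).two_dvd
    exact hpure.1 _ (Submodule.mem_iSup_of_mem k (hk ▸ Subtype.mem _))
  have hV : ∀ m, Even m → S.V m ≤ Subalgebra.toSubmodule p.range := fun m hm a ha => by
    by_cases h : N ≤ m
    · rw [hN m h, Submodule.mem_bot] at ha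
      rw [ha]
      exact zero_mem _
    · have h1 : (⟨a, ha⟩ : S.V m) = ∑ i, (b m).repr ⟨a, ha⟩ i • b m i := ((b m).sum_repr _).symm
      have h2 : a = ∑ i, (b m).repr ⟨a, ha⟩ i • (b m i : A) := by
        have h3 := congrArg (S.V m).subtype h1
        rw [map_sum] at h3
        exact h3
      rw [h2]
      refine sum_mem fun i _ => Submodule.smul_mem _ _ ⟨X ⟨⟨m, by simp [hm]; omega⟩, i⟩, ?_⟩
      exact hpX _
  have hP : ∀ (e : Degrees N Odd) (u : S.V e), ∃ q : MvPolynomial σ ℚ, q.IsHomogeneous l ∧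
      IsWeightedHomogeneous w q (e.1 + 1) ∧ p q = Dd A u := fun e u =>
    exists_poly_differential hpure hlen hpm hpl hV e.prop u.2
  choose q hql hqw hqd using hP
  let L : ∀ e : Degrees N Odd, S.V e →ₗ[ℚ] MvPolynomial σ ℚ :=
    fun e => (b e).constr ℚ fun i => q e (b e i)
  have hLl : ∀ e u, (L e u).IsHomogeneous l := fun e u => by
    simp only [L, Module.Basis.constr_apply_fintype]
    exact sum_mem (S := homogeneousSubmodule σ ℚ l) fun i _ => Submodule.smul_mem _ _ (hql e _)
  have hLw : ∀ e u, IsWeightedHomogeneous w (L e u) (e.1 + 1) := fun e u => by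
    simp only [L, Module.Basis.constr_apply_fintype]
    exact sum_mem (S := weightedHomogeneousSubmodule ℚ w (e.1 + 1)) fun i _ =>
      Submodule.smul_mem _ _ (hqw e _)
  have hLd : ∀ e u, p (L e u) = Dd A u := fun e u => by
    have : p.toLinearMap ∘ₗ L e = Dd A ∘ₗ (S.V e).subtype :=
      (b e).ext fun i => by
        simp only [L, LinearMap.comp_apply, Module.Basis.constr_basis]
        exact hqd e _
    exact LinearMap.congr_fun this u
  have hext : ∀ {γ : ℕ → Type} [∀ m, Fintype (γ m)] (c : ∀ m, Module.Basis (γ m) ℚ (S.V m)),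
      IsExt w (fun j : Σ m : Degrees N Odd, γ m => j.1.1) (fun j => L j.1 (c j.1 j.2))
        Finset.univ A p (fun j => c j.1 j.2) := fun c =>
    (isFreeOn hN b c).isExt hw (fun j => j.1.prop) (fun j => hLw _ _) hdx fun j =>
      (hLd j.1 _).symm
  have hrad : ∀ s, (X s : MvPolynomial σ ℚ) ∈
      (Ideal.span (⋃ e, Set.range (L e))).radical := fun s => by
    obtain ⟨e, he⟩ := (hext b).exists_pow_mem hw hw0 (fun j => hLw _ _) s
    refine ⟨e, Ideal.span_mono ?_ he⟩
    rintro _ ⟨j, rfl⟩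
    exact Set.mem_iUnion.2 ⟨j.1, _, rfl⟩
  obtain ⟨Z, hZ, hZX⟩ := exists_weighted_reduction hl (n := fun e : Degrees N Odd => e.1)
    Subtype.val_injective (fun e => S.V e) L hLl hLw hrad
  let Z' : ∀ m, Submodule ℚ (S.V m) := fun m =>
    if h : m ∈ (Finset.range N).filter Odd then Z ⟨m, h⟩ else ⊥
  have hZ' : ∀ e : Degrees N Odd, Z' e = Z e := fun e => dif_pos e.2
  choose k c hc using fun m => exists_basis_extending (Z' m)
  let J := Σ m : Degrees N Odd, (Fin (Module.finrank ℚ (Z' m)) ⊕ Fin (k m))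
  let f : J → MvPolynomial σ ℚ := fun j => L j.1 (c j.1 j.2)
  let κ : Finset J := Finset.univ.filter fun j => j.2.isLeft
  refine ⟨σ, J, inferInstance, inferInstance, w, fun j => j.1.1, f, κ, p, fun j => c j.1 j.2,
    hw, fun j => j.1.prop, fun j => hLw _ _, fun j => hLl _ _, hext c, hpl,
    fun j => S.V_le_lam_one _ (Subtype.mem _), fun s => ?_, ?_, S.card_even hN b, S.card_odd hN c⟩
  · have hle : Ideal.span (⋃ e, L e '' Z e) ≤ Ideal.span (f '' (κ : Set J)) := by
      refine Ideal.span_le.2 (Set.iUnion_subset fun e => ?_)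
      rintro _ ⟨u, hu, rfl⟩
      have h1 := Submodule.mem_map_of_mem (f := L e) (hc e u ((hZ' e).symm ▸ hu))
      rw [Submodule.map_span, ← Set.range_comp] at h1
      have h2 : Submodule.span ℚ (Set.range (L e ∘ fun i => c e (Sum.inl i))) ≤
          (Ideal.span (f '' (κ : Set J))).restrictScalars ℚ := by
        refine Submodule.span_le.2 ?_
        rintro _ ⟨i, rfl⟩
        exact Ideal.subset_span ⟨⟨e, Sum.inl i⟩, by simp [κ], rfl⟩
      exact h2 h1
    obtain ⟨e, he⟩ := hZX s
    exact ⟨e, hle he⟩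
  · refine le_of_eq_of_le ?_ hZ
    rw [Finset.card_filter, Fintype.sum_sigma]
    refine Finset.sum_congr rfl fun e _ => ?_
    rw [Fintype.sum_sum_type]
    simp only [Sum.isLeft_inl, Sum.isLeft_inr, if_true, Bool.false_eq_true, if_false,
      Finset.sum_const, Finset.card_univ, Fintype.card_fin, smul_eq_mul, mul_one, mul_zero,
      add_zero]
    rw [hZ' e]

end MinimalSullivan

namespace MinimalSullivan

variable {A : Type} [GCDGA A] {S : MinimalSullivan A}

theorem lam_induction {motive : A → Prop} (a : A) (hom : ∀ q, ∀ x ∈ S.lam q, motive x)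
    (add : ∀ x y, motive x → motive y → motive (x + y)) : motive a :=
  Submodule.iSup_induction S.lam (motive := motive) (mem_iSup_lam a) hom (hom 0 0 (zero_mem _)) add

variable {σ J : Type} [Fintype σ] [Fintype J] {w : σ → ℕ} {n : J → ℕ}
  {f : J → MvPolynomial σ ℚ} {κ : Finset J} {p : MvPolynomial σ ℚ →ₐ[ℚ] A} {v : J → A} {l : ℕ}

theorem IsPresentation.lam_le (h : S.IsPresentation l w n f κ p v) (E : ℕ → Submodule ℚ A)
    (hE : ∀ q, E q ≤ S.lam q) (hone : 1 ∈ E 0) (hmul : ∀ q q', E q * E q' ≤ E (q + q'))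
    (hX : ∀ s, p (X s) ∈ E 1) (hv : ∀ j, v j ∈ E 1) (q : ℕ) : S.lam q ≤ E q := by
  have hsup : (⨆ q, E q) * (⨆ q, E q) ≤ ⨆ q, E q := by
    rw [Submodule.iSup_mul]
    refine iSup_le fun q => ?_
    rw [Submodule.mul_iSup]
    exact iSup_le fun q' => (hmul q q').trans (le_iSup E _)
  let T : Subalgebra ℚ A := (⨆ q, E q).toSubalgebra (Submodule.mem_iSup_of_mem 0 hone)
    fun a b ha hb => hsup (Submodule.mul_mem_mul ha hb)
  have hT : ∀ a, a ∈ T := h.ext.gen T (fun g => by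
    have : (Algebra.adjoin ℚ (Set.range (X : σ → MvPolynomial σ ℚ))) ≤ T.comap p :=
      Algebra.adjoin_le (by
        rintro _ ⟨s, rfl⟩
        exact Submodule.mem_iSup_of_mem (p := E) 1 (hX s))
    rw [adjoin_range_X] at this
    exact this trivial) fun j _ => Submodule.mem_iSup_of_mem (p := E) 1 (hv j)
  intro a ha
  have key : S.lamProj q a ∈ E q := by
    refine Submodule.iSup_induction E (motive := fun a => S.lamProj q a ∈ E q) (hT a)
      (fun q' b hb => ?_) (by simp) fun b c hb hc => by rw [map_add]; exact add_mem hb hc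
    by_cases hq : q' = q
    · subst hq
      rwa [lamProj_same (hE _ hb)]
    · rw [lamProj_ne (hE _ hb) hq]
      exact zero_mem _
  rwa [lamProj_same ha] at key

theorem iSup_lam_mul_le (N : ℕ) :
    (⊤ : Submodule ℚ A) * (⨆ k, ⨆ (_ : N < k), S.lam k) ≤ ⨆ k, ⨆ (_ : N < k), S.lam k := by
  rw [← S.lam_internal.submodule_iSup_eq_top, Submodule.iSup_mul]
  refine iSup_le fun q => ?_
  simp only [Submodule.mul_iSup]
  exact iSup₂_le fun k hk => (S.lam_mul q k).trans (le_iSup₂_of_le (q + k) (by omega) le_rfl)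

theorem mul_iSup_lam_le (N : ℕ) :
    (⨆ k, ⨆ (_ : N < k), S.lam k) * (⊤ : Submodule ℚ A) ≤ ⨆ k, ⨆ (_ : N < k), S.lam k := by
  rw [← S.lam_internal.submodule_iSup_eq_top, Submodule.mul_iSup]
  refine iSup_le fun q => ?_
  simp only [Submodule.iSup_mul]
  exact iSup₂_le fun k hk => (S.lam_mul k q).trans (le_iSup₂_of_le (k + q) (by omega) le_rfl)

variable {B' : Type} [GCDGA B'] {φ : A →ₐ[ℚ] B'} {F : ℤ → Submodule ℚ B'} {D : ℤ}

theorem IsPresentation.lam_le_filtered (h : S.IsPresentation l w n f κ p v) (hl : 0 < l)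
    (hF : FilteredModel w n f (fun _ => 1) Finset.univ A B' p v φ F D) (q : ℕ) :
    S.lam q ≤ ⨆ i, (S.lam q ⊓ Gr A i ⊓ (S.lam (q + (l - 1))).comap (Dd A) ⊓
      (F q).comap φ.toLinearMap) := by
  refine h.lam_le (fun q => ⨆ i, (S.lam q ⊓ Gr A i ⊓ (S.lam (q + (l - 1))).comap (Dd A) ⊓
    (F q).comap φ.toLinearMap)) (fun q => iSup_le fun i => ?_) ?_ (fun q q' => ?_) (fun s => ?_)
    (fun j => ?_) q
  · exact fun a ha => ha.1.1.1
  · refine Submodule.mem_iSup_of_mem 0 ⟨⟨⟨S.lam_zero ▸ Submodule.one_le.1 le_rfl,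
      one_mem_gr⟩, ?_⟩, ?_⟩
    · change Dd A _ ∈ S.lam _
      rw [Dd_one]
      exact zero_mem _
    · change φ 1 ∈ F ((0 : ℕ) : ℤ)
      rw [map_one]
      exact hF.fam.one
  · rw [Submodule.iSup_mul]
    refine iSup_le fun i => ?_
    rw [Submodule.mul_iSup]
    refine iSup_le fun i' => Submodule.mul_le.2 ?_
    rintro a ⟨⟨⟨ha1, ha2⟩, ha3⟩, ha4⟩ b ⟨⟨⟨hb1, hb2⟩, hb3⟩, hb4⟩
    refine Submodule.mem_iSup_of_mem (i + i') ⟨⟨⟨S.lam_mul _ _ (Submodule.mul_mem_mul ha1 hb1),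
      mul_mem_gr ha2 hb2⟩, ?_⟩, ?_⟩
    · change Dd A _ ∈ S.lam _
      rw [Dd_mul ha2]
      refine add_mem ?_ (Submodule.smul_mem _ _ ?_)
      · rw [add_right_comm]
        exact S.lam_mul _ _ (Submodule.mul_mem_mul ha3 hb1)
      · rw [add_assoc]
        exact S.lam_mul _ _ (Submodule.mul_mem_mul ha1 hb3)
    · change φ (a * b) ∈ F ((q + q' : ℕ) : ℤ)
      rw [map_mul, Nat.cast_add]
      exact hF.fam.mul _ _ _ _ ha4 hb4
  · refine Submodule.mem_iSup_of_mem (w s) ⟨⟨⟨h.X_mem_lam s, h.ext.X_mem s⟩, ?_⟩, ?_⟩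
    · change Dd A _ ∈ S.lam _
      rw [h.ext.d_X]
      exact zero_mem _
    · exact hF.X_mem s
  · refine Submodule.mem_iSup_of_mem (n j) ⟨⟨⟨h.mem_lam j,
      h.ext.y_mem j (Finset.mem_univ j)⟩, ?_⟩, ?_⟩
    · change Dd A _ ∈ S.lam _
      rw [h.ext.d_y j (Finset.mem_univ j), Nat.add_sub_cancel' hl]
      exact poly_mem_lam h.X_mem_lam (h.homogeneous j)
    · exact hF.y_mem j (Finset.mem_univ j)

theorem IsPresentation.nonempty_catWitness (h : S.IsPresentation l w n f κ p v) (hl : 0 < l)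
    {D : ℕ} (hF : FilteredModel w n f (fun _ => 1) Finset.univ A B' p v φ F D) :
    Nonempty (CatWitness A S D) := by
  have hpr : ∀ q i, S.lam q ≤ (S.lam q).comap (pr A i) := fun q i => by
    refine (h.lam_le_filtered hl hF q).trans (iSup_le fun i' a ha => ?_)
    rw [Submodule.mem_comap]
    by_cases hi : i' = i
    · subst hi
      rw [pr_same ha.1.1.2]
      exact ha.1.1.1
    · rw [pr_ne ha.1.1.2 hi]
      exact zero_mem _
  have hd : ∀ q, S.lam q ≤ (S.lam (q + (l - 1))).comap (Dd A) := fun q =>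
    (h.lam_le_filtered hl hF q).trans (iSup_le fun i' a ha => ha.1.2)
  have hφ : ∀ q, S.lam q ≤ (F q).comap φ.toLinearMap := fun q =>
    (h.lam_le_filtered hl hF q).trans (iSup_le fun i' a ha => ha.2)
  have hle : ∀ k, D < k → S.lam k ≤ ⨆ k, ⨆ (_ : D < k), S.lam k := fun k hk =>
    le_iSup₂_of_le k hk le_rfl
  obtain ⟨Q, _, π, hπ, hπs, hπk⟩ := exists_quotient (⨆ k, ⨆ (_ : D < k), S.lam k)
    (fun a k hk => iSup_lam_mul_le D (Submodule.mul_mem_mul trivial hk))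
    (fun a k hk => mul_iSup_lam_le D (Submodule.mul_mem_mul hk trivial))
    (fun i => (iSup₂_le fun k hk => (hpr k i).trans (Submodule.comap_mono (hle k hk)) :
      _ ≤ (⨆ k, ⨆ (_ : D < k), S.lam k).comap (pr A i)))
    ((iSup₂_le fun k hk => (hd k).trans (Submodule.comap_mono (hle _ (by omega))) :
      _ ≤ (⨆ k, ⨆ (_ : D < k), S.lam k).comap (Dd A)))
  refine ⟨⟨Q, π, hπ, hπs, hπk, nonempty_htpyRetraction hF.hom hF.surj hF.quasi hπ hπs ?_⟩⟩
  have hker : (⨆ k, ⨆ (_ : D < k), S.lam k) ≤ LinearMap.ker φ.toLinearMap :=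
    iSup₂_le fun k hk a ha => hF.fam.eq_zero k (by exact_mod_cast hk) _ (hφ k ha)
  exact fun t ht => hker (hπk ▸ ht)

theorem IsPresentation.le_of_catWitness (h : S.IsPresentation l w n f κ p v) (hl : 0 < l)
    {D : ℕ} (hF : FilteredModel w n f (fun _ => 1) Finset.univ A B' p v φ F D) {ε : B' →ₗ[ℚ] ℚ}
    {θ : B'} (ht : TopClass (φ.comp p) F D ε θ) {N : ℕ} (W : CatWitness A S N) : D ≤ N := by
  have hd : ∀ q, S.lam q ≤ (S.lam (q + (l - 1))).comap (Dd A) := fun q =>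
    (h.lam_le_filtered hl hF q).trans (iSup_le fun i' a ha => ha.1.2)
  have hφ : ∀ q, S.lam q ≤ (F q).comap φ.toLinearMap := fun q =>
    (h.lam_le_filtered hl hF q).trans (iSup_le fun i' a ha => ha.2)
  have hdproj : ∀ a, Dd A (S.lamProj D a) = S.lamProj (D + (l - 1)) (Dd A a) := fun a => by
    induction a using lam_induction (S := S) with
    | add a b ha hb => simp only [map_add, ha, hb]
    | hom q a ha =>
    by_cases hq : q = D
    · subst hq
      rw [lamProj_same ha, lamProj_same (hd _ ha)]
    · rw [lamProj_ne ha hq, map_zero, lamProj_ne (hd _ ha) (by omega)]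
  have hε : ∀ a, ε (φ (S.lamProj D a)) = ε (φ a) := fun a => by
    induction a using lam_induction (S := S) with
    | add a b ha hb => simp only [map_add, ha, hb]
    | hom q a ha =>
    by_cases hq : q = D
    · subst hq
      rw [lamProj_same ha]
    · rw [lamProj_ne ha hq, map_zero, map_zero,
        ht.eq_zero q (by exact_mod_cast hq) (φ a) (hφ _ ha)]
  obtain ⟨z, hz, hφz⟩ := hF.quasi.exists_closed hF.hom hF.surj ht.closed
  by_contra hlt
  obtain ⟨Q, π, -, -, hπk, ⟨⟨C, j, q, τ, hj, -, hτ, -, hq, hqj, hτj⟩⟩⟩ := W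
  have hdz : Dd A (S.lamProj D z) = 0 := by rw [hdproj, hz, map_zero]
  have hlam : S.lamProj D z ∈ S.lam D := Subtype.mem _
  have hπ : π (S.lamProj D z) = 0 := by
    have : S.lamProj D z ∈ LinearMap.ker π.toLinearMap :=
      hπk ▸ (le_iSup₂_of_le D (not_le.1 hlt) le_rfl :
        S.lam D ≤ ⨆ k, ⨆ (_ : N < k), S.lam k) hlam
    exact this
  obtain ⟨e, he⟩ := hq.2 (j (S.lamProj D z)) (by rw [← hj.1, hdz, map_zero])
    ⟨0, by rw [map_zero, ← AlgHom.comp_apply, hqj, hπ]⟩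
  have h1 : S.lamProj D z = Dd A (τ e) := by
    rw [← hτ.1, ← he, ← AlgHom.comp_apply, hτj, AlgHom.id_apply]
  have h2 := hε z
  rw [hφz, ht.one, h1, hF.hom.1, ht.exact] at h2
  exact zero_ne_one h2

theorem IsPresentation.le_cat (h : S.IsPresentation l w n f κ p v) (hl : 0 < l) {D : ℕ}
    (hD : HasTopModel w n f (fun _ => 1) Finset.univ D) : D ≤ cat A S := by
  obtain ⟨B, B', _, _, i, y, φ, F, ε, θ, hF, ht⟩ := hD
  obtain ⟨φ', hφ', hF'⟩ := hF.transport h.ext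
  have hφ : φ'.comp p = φ.comp i := AlgHom.ext hφ'
  exact le_csInf ⟨D, h.nonempty_catWitness hl hF'⟩ fun N ⟨W⟩ =>
    h.le_of_catWitness hl hF' (hφ ▸ ht) W

end MinimalSullivan

theorem add_pow_le {R : Type} [CommRing R] {I J K : Ideal R} {m n : ℕ} (hJ : J ^ (m + 1) ≤ I)
    (hK : K ^ (n + 1) ≤ I) : (J + K) ^ (m + n + 1) ≤ I := by
  rw [add_pow]
  refine Finset.sum_induction _ (· ≤ I) (fun a b ha hb => sup_le ha hb) bot_le fun k hk => ?_
  refine Ideal.mul_le_left.trans ?_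
  by_cases h : m + 1 ≤ k
  · exact Ideal.mul_le_left.trans ((Ideal.pow_le_pow_right h).trans hJ)
  · exact Ideal.mul_le_right.trans ((Ideal.pow_le_pow_right (by omega)).trans hK)

theorem sum_pow_le {R ι : Type} [CommRing R] {I : Ideal R} (J : ι → Ideal R) {m : ℕ}
    (s : Finset ι) (hs : s.Nonempty) (hJ : ∀ k, J k ^ (m + 1) ≤ I) :
    (∑ k ∈ s, J k) ^ (s.card * m + 1) ≤ I := by
  classical
  induction hs using Finset.Nonempty.cons_induction with
  | singleton a => simpa using hJ a
  | cons a s ha hs ih =>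
    rw [Finset.sum_cons, Finset.card_cons, Nat.succ_mul, Nat.add_comm (s.card * m)]
    exact add_pow_le (hJ a) ih

section

variable {σ J : Type} {w : σ → ℕ} {n : J → ℕ} {f : J → MvPolynomial σ ℚ} {r : ℕ}

theorem isWeightedHomogeneous_rename_copy {p : MvPolynomial σ ℚ} {m : ℕ}
    (hp : IsWeightedHomogeneous w p m) (k : Fin r) :
    IsWeightedHomogeneous (fun s : σ × Fin r => w s.1) (rename (fun s => (s, k)) p) m := by
  intro d hd
  obtain ⟨u, rfl, hu⟩ := coeff_rename_ne_zero _ _ _ hd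
  rw [← hp hu, Finsupp.weight, Finsupp.weight]
  simp [Finsupp.linearCombination_mapDomain, Function.comp_def]

variable [NeZero r]

/-- The polynomials presenting the `r`-fold coproduct in the coordinates `v (j, 0)` and
`v (j, k) - v (j, 0)`. -/
def copyPoly (f : J → MvPolynomial σ ℚ) (r : ℕ) [NeZero r] (u : J × Fin r) :
    MvPolynomial (σ × Fin r) ℚ :=
  rename (fun s => (s, u.2)) (f u.1) - if u.2 = 0 then 0 else rename (fun s => (s, 0)) (f u.1)

theorem isWeightedHomogeneous_copyPoly (hf : ∀ j, IsWeightedHomogeneous w (f j) (n j + 1))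
    (u : J × Fin r) : IsWeightedHomogeneous (fun s : σ × Fin r => w s.1) (copyPoly f r u)
      (n u.1 + 1) := by
  refine Submodule.sub_mem
    (weightedHomogeneousSubmodule ℚ (fun s : σ × Fin r => w s.1) (n u.1 + 1))
    (isWeightedHomogeneous_rename_copy (hf _) _) ?_
  split_ifs
  · exact zero_mem _
  · exact isWeightedHomogeneous_rename_copy (hf _) _

theorem rename_mem_span_copyPoly {κ : Finset J} {q : MvPolynomial σ ℚ}
    (hq : q ∈ Ideal.span (f '' (κ : Set J))) (k : Fin r) :
    rename (fun s => (s, k)) q ∈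
      Ideal.span (copyPoly f r '' ((κ ×ˢ (Finset.univ : Finset (Fin r)) : Finset _) :
        Set (J × Fin r))) := by
  have hle : Ideal.span (f '' (κ : Set J)) ≤ (Ideal.span (copyPoly f r '' ((κ ×ˢ
      (Finset.univ : Finset (Fin r)) : Finset _) : Set (J × Fin r)))).comap
        (rename fun s => (s, k)) := by
    refine Ideal.span_le.2 ?_
    rintro _ ⟨j, hj, rfl⟩
    have hmem : ∀ k : Fin r, copyPoly f r (j, k) ∈ Ideal.span (copyPoly f r '' ((κ ×ˢ
        (Finset.univ : Finset (Fin r)) : Finset _) : Set (J × Fin r))) := fun k =>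
      Ideal.subset_span ⟨(j, k), by simpa using hj, rfl⟩
    have h0 : rename (fun s => (s, (0 : Fin r))) (f j) = copyPoly f r (j, 0) := by
      simp [copyPoly]
    have hk : rename (fun s => (s, k)) (f j) = copyPoly f r (j, k) +
        if k = 0 then 0 else copyPoly f r (j, 0) := by
      rw [← h0]
      simp [copyPoly]
    refine Ideal.mem_comap.2 (hk ▸ ?_)
    refine add_mem (hmem k) ?_
    split_ifs
    · exact zero_mem _
    · exact hmem 0
  exact hle hq

theorem hasBoundedModel_copyPoly [Fintype σ] [Fintype J] (hw : ∀ s, Even (w s))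
    (hn : ∀ j, Odd (n j)) (hf : ∀ j, IsWeightedHomogeneous w (f j) (n j + 1)) {κ : Finset J}
    (hκ : κ.card ≤ Fintype.card σ)
    (hX : ∀ s, ∃ e : ℕ, (X s : MvPolynomial σ ℚ) ^ e ∈ Ideal.span (f '' κ)) {D : ℕ}
    (hD : (Ideal.span (Set.range X) : Ideal (MvPolynomial σ ℚ)) ^ (D + 1) ≤
      Ideal.span (f '' κ)) :
    HasBoundedModel (fun s : σ × Fin r => w s.1) (fun u : J × Fin r => n u.1) (copyPoly f r)
      (fun u => if u.2 = 0 then 0 else 1) Finset.univ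
      (r * D + (r - 1) * (Fintype.card J - κ.card)) := by
  classical
  have hr : 0 < r := Nat.pos_of_ne_zero (NeZero.ne r)
  have hbase := hasBoundedModel_base (wt := fun u : J × Fin r => if u.2 = 0 then 0 else 1)
    (w := fun s : σ × Fin r => w s.1) (fun s => hw s.1) (fun u => hn u.1)
    (isWeightedHomogeneous_copyPoly hf) (κ ×ˢ Finset.univ)
    (by simpa using Nat.mul_le_mul_right r hκ)
    (fun s => by
      obtain ⟨e, he⟩ := hX s.1
      refine ⟨e, ?_⟩
      have := rename_mem_span_copyPoly he s.2
      simpa using this) (r * D) (by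
      let 𝔪 : Fin r → Ideal (MvPolynomial (σ × Fin r) ℚ) := fun k =>
        (Ideal.span (Set.range X)).map (rename fun s => (s, k))
      have h1 : Ideal.span (Set.range X) ≤ ∑ k, 𝔪 k := by
        refine Ideal.span_le.2 ?_
        rintro _ ⟨⟨s, k⟩, rfl⟩
        refine (Finset.single_le_sum (f := 𝔪) (fun _ _ => bot_le) (Finset.mem_univ k)) ?_
        have := Ideal.mem_map_of_mem (rename (R := ℚ) fun s : σ => (s, k))
          (Ideal.subset_span (Set.mem_range_self (f := X) s))
        simpa using this
      have h2 := sum_pow_le 𝔪 (m := D) Finset.univ Finset.univ_nonempty (I := Ideal.span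
        (copyPoly f r '' ((κ ×ˢ (Finset.univ : Finset (Fin r)) : Finset _) : Set (J × Fin r))))
        (fun k => by
          rw [← Ideal.map_pow]
          refine Ideal.map_le_iff_le_comap.2 fun q hq => ?_
          exact rename_mem_span_copyPoly (hD hq) k)
      rw [Finset.card_univ, Fintype.card_fin] at h2
      exact (Ideal.pow_right_mono h1 _).trans h2)
  have h := hbase.union (fun u => hn u.1) (isWeightedHomogeneous_copyPoly hf)
    (fun u => by positivity) (κᶜ ×ˢ Finset.univ)
    (Finset.disjoint_product.2 (Or.inl disjoint_compl_left))
  have hsum : ∑ u ∈ κᶜ ×ˢ (Finset.univ : Finset (Fin r)), (if u.2 = 0 then 0 else 1 : ℤ) =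
      (r - 1) * (Fintype.card J - κ.card) := by
    have h0 : ∑ k : Fin r, (if k = 0 then 0 else 1 : ℤ) = r - 1 := by
      rw [← Finset.add_sum_erase _ _ (Finset.mem_univ (0 : Fin r)), if_pos rfl, zero_add,
        Finset.sum_congr rfl fun k hk => if_neg (Finset.ne_of_mem_erase hk)]
      simp [Nat.cast_sub (Nat.succ_le_of_lt hr)]
    rw [Finset.sum_product, Finset.sum_congr rfl fun j _ => h0, Finset.sum_const,
      Finset.card_compl, nsmul_eq_mul, Nat.cast_sub κ.card_le_univ, mul_comm]
  rw [hsum, Nat.cast_mul] at h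
  convert h
  ext ⟨j, k⟩
  simp [em']

end

section TensorPower

variable {σ J : Type} {w : σ → ℕ} {n : J → ℕ} {f : J → MvPolynomial σ ℚ} {r : ℕ} [NeZero r]
  [Fintype J] {A T : Type} [GCDGA A] [GCDGA T] {p : MvPolynomial σ ℚ →ₐ[ℚ] A} {v : J → A}
  {i : MvPolynomial (σ × Fin r) ℚ →ₐ[ℚ] T} {y : J × Fin r → T}

theorem exists_copy (hA : IsExt w n f Finset.univ A p v)
    (hT : IsExt (fun s : σ × Fin r => w s.1) (fun u : J × Fin r => n u.1) (copyPoly f r)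
      Finset.univ T i y) (k : Fin r) :
    ∃ ι : A →ₐ[ℚ] T, IsDGAHom ι ∧ (∀ q, ι (p q) = i (rename (fun s => (s, k)) q)) ∧
      ∀ j, ι (v j) = y (j, 0) + if k = 0 then 0 else y (j, k) := by
  obtain ⟨ι, h1, h2, h3⟩ := hA.lift T (i.comp (rename fun s => (s, k)))
    (fun j => y (j, 0) + if k = 0 then 0 else y (j, k))
    (fun s => by simpa using hT.X_mem (s, k)) (fun s => by simpa using hT.d_X (s, k))
    (fun j _ => by
      refine add_mem (hT.y_mem (j, 0) (Finset.mem_univ _)) ?_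
      split_ifs
      · exact zero_mem _
      · exact hT.y_mem (j, k) (Finset.mem_univ _))
    (fun j _ => by
      rw [map_add, hT.d_y _ (Finset.mem_univ _)]
      split_ifs with hk
      · simp [copyPoly, hk]
      · rw [hT.d_y _ (Finset.mem_univ _)]
        simp [copyPoly, hk])
  exact ⟨ι, h1, h2, fun j => h3 j (Finset.mem_univ j)⟩

theorem exists_tensorPower (hw : ∀ s, Even (w s)) (hA : IsExt w n f Finset.univ A p v)
    (hT : IsExt (fun s : σ × Fin r => w s.1) (fun u : J × Fin r => n u.1) (copyPoly f r)
      Finset.univ T i y) :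
    ∃ TP : TensorPower A r T, (∀ k q, TP.ι k (p q) = i (rename (fun s => (s, k)) q)) ∧
      ∀ k j, TP.ι k (v j) = y (j, 0) + if k = 0 then 0 else y (j, k) := by
  choose ι hι hιp hιv using exists_copy hA hT
  have hy : ∀ j k, y (j, k) = ι k (v j) - if k = 0 then 0 else ι 0 (v j) := fun j k => by
    by_cases hk : k = 0 <;> simp [hιv, hk]
  refine ⟨⟨ι, hι, fun B _ g hg => ?_⟩, hιp, hιv⟩
  let c : σ × Fin r → B := fun s => g s.2 (p (X s.1))
  have hc : ∀ s, c s ∈ Gr B (w s.1) := fun s => (hg _).2 _ _ (hA.X_mem _)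
  let H := polyLift (w := fun s : σ × Fin r => w s.1) (fun s => hw s.1) c hc
  have hHX : ∀ s, H (X s) = g s.2 (p (X s.1)) := polyLift_X _ hc
  have hH : ∀ k q, H (rename (fun s => (s, k)) q) = g k (p q) := fun k =>
    DFunLike.congr_fun (MvPolynomial.algHom_ext (fun s => by simp [hHX]) :
      H.comp (rename fun s => (s, k)) = (g k).comp p)
  have hv : ∀ k j, g k (v j) ∈ Gr B (n j) := fun k j =>
    (hg k).2 _ _ (hA.y_mem j (Finset.mem_univ j))
  have hdv : ∀ k j, Dd B (g k (v j)) = g k (p (f j)) := fun k j => by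
    rw [← (hg k).1, hA.d_y j (Finset.mem_univ j)]
  obtain ⟨G, hG, hGi, hGy⟩ := hT.lift B H
    (fun u => g u.2 (v u.1) - if u.2 = 0 then 0 else g 0 (v u.1))
    (fun s => by rw [hHX]; exact hc s)
    (fun s => by rw [hHX, ← (hg _).1, hA.d_X, map_zero])
    (fun u _ => by
      refine sub_mem (hv _ _) ?_
      split_ifs
      · exact zero_mem _
      · exact hv _ _)
    (fun u _ => by
      rw [copyPoly, map_sub, map_sub, hdv, hH]
      split_ifs
      · simp
      · rw [hdv, hH])
  refine ⟨G, ⟨hG, fun k => hA.algHom_eq (fun s => ?_) fun j _ => ?_⟩, fun G' ⟨_, hG'⟩ => ?_⟩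
  · rw [AlgHom.comp_apply, hιp, hGi, hH]
  · by_cases hk : k = 0 <;> simp [hιv, hGy, hk]
  · have hG'ι : ∀ k a, G' (ι k a) = g k a := fun k => DFunLike.congr_fun (hG' k)
    refine hT.algHom_eq (fun s => ?_) fun u _ => ?_
    · have := hιp s.2 (X s.1)
      rw [rename_X] at this
      rw [hGi, hHX, ← hG'ι, this]
    · rw [hGy u (Finset.mem_univ u), hy, map_sub, hG'ι]
      split_ifs
      · rw [map_zero]
      · rw [hG'ι]

end TensorPower

section KerMu

variable {A : Type} [GCDGA A] {r : ℕ} {T : Type} [GCDGA T] (TP : TensorPower A r T)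

theorem TensorPower.isDGAHom_mu : IsDGAHom TP.mu :=
  (TP.coprod A _ fun _ => isDGAHom_id A).choose_spec.1.1

theorem TensorPower.mu_ι (k : Fin r) (a : A) : TP.mu (TP.ι k a) = a :=
  DFunLike.congr_fun ((TP.coprod A _ fun _ => isDGAHom_id A).choose_spec.1.2 k) a

theorem TensorPower.mem_kerMu {t : T} : t ∈ TP.kerMu ↔ TP.mu t = 0 := Iff.rfl

end KerMu

section IdealPow

variable {A : Type} [GCDGA A]

theorem pr_mem_mul {U W : Submodule ℚ A} (hU : ∀ i, ∀ a ∈ U, pr A i a ∈ U)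
    (hW : ∀ i, ∀ a ∈ W, pr A i a ∈ W) (i : ℕ) {a : A} (ha : a ∈ U * W) : pr A i a ∈ U * W := by
  induction ha using Submodule.mul_induction_on' with
  | mem_mul_mem x hx y hy =>
    obtain ⟨M, hM⟩ := exists_sum_pr x
    obtain ⟨N, hN⟩ := exists_sum_pr y
    rw [← hM M le_rfl, ← hN N le_rfl, Finset.sum_mul_sum, map_sum]
    refine sum_mem fun j _ => ?_
    rw [map_sum]
    refine sum_mem fun k _ => ?_
    have hjk := mul_mem_gr (pr_mem j x) (pr_mem k y)
    by_cases h : j + k = i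
    · subst h
      rw [pr_same hjk]
      exact Submodule.mul_mem_mul (hU j x hx) (hW k y hy)
    · rw [pr_ne hjk h]
      exact zero_mem _
  | add x _ y _ hx hy => rw [map_add]; exact add_mem hx hy

/-- Powers of a differential graded ideal of `A` are differential graded ideals. -/
theorem exists_quotient_pow {K : Submodule ℚ A} (hl : ∀ a, ∀ k ∈ K, a * k ∈ K)
    (hr : ∀ a, ∀ k ∈ K, k * a ∈ K) (hp : ∀ i, ∀ k ∈ K, pr A i k ∈ K)
    (hpar : ∀ k ∈ K, par A k ∈ K) (hd : ∀ k ∈ K, Dd A k ∈ K) (m : ℕ) :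
    ∃ (Q : Type) (_ : GCDGA Q) (ρ : A →ₐ[ℚ] Q), IsDGAHom ρ ∧ Function.Surjective ρ ∧
      LinearMap.ker ρ.toLinearMap = K ^ (m + 1) := by
  refine exists_quotient _ (fun a k hk => ?_) (fun a k hk => ?_) (fun i => ?_) ?_
  · rw [pow_succ'] at hk ⊢
    induction hk using Submodule.mul_induction_on' with
    | mem_mul_mem x hx y hy =>
      rw [← mul_assoc]
      exact Submodule.mul_mem_mul (hl a x hx) hy
    | add x _ y _ hx hy => rw [mul_add]; exact add_mem hx hy
  · rw [pow_succ] at hk ⊢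
    induction hk using Submodule.mul_induction_on' with
    | mem_mul_mem x hx y hy =>
      rw [mul_assoc]
      exact Submodule.mul_mem_mul hx (hr a y hy)
    | add x _ y _ hx hy => rw [add_mul]; exact add_mem hx hy
  · induction m generalizing i with
    | zero => simpa using hp i
    | succ m ih =>
      intro k hk
      rw [pow_succ] at hk ⊢
      exact pr_mem_mul ih hp i hk
  · induction m with
    | zero => simpa using hd
    | succ m ih =>
      intro k hk
      rw [pow_succ'] at hk ⊢
      induction hk using Submodule.mul_induction_on' with
      | mem_mul_mem x hx y hy =>
        rw [Dd_mul']
        exact add_mem (Submodule.mul_mem_mul (hd x hx) hy)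
          (Submodule.mul_mem_mul (hpar x hx) (ih y hy))
      | add x _ y _ hx hy => rw [map_add]; exact add_mem hx hy

end IdealPow

namespace MinimalSullivan

variable {A : Type} [GCDGA A]

theorem IsPresentation.TC_le {S : MinimalSullivan A} {l : ℕ} {σ J : Type} [Fintype σ]
    [Fintype J] {w : σ → ℕ} {n : J → ℕ} {f : J → MvPolynomial σ ℚ} {κ : Finset J}
    {p : MvPolynomial σ ℚ →ₐ[ℚ] A} {v : J → A} (h : S.IsPresentation l w n f κ p v) {D : ℕ}
    (hD : (Ideal.span (Set.range X) : Ideal (MvPolynomial σ ℚ)) ^ (D + 1) ≤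
      Ideal.span (f '' κ)) {r : ℕ} (hr : 0 < r) {N : ℕ}
    (hN : (N : ℤ) = r * D + (r - 1) * (Fintype.card J - κ.card)) : TC A r ≤ N := by
  have : NeZero r := ⟨hr.ne'⟩
  obtain ⟨T, B, _, _, i, y, φ, F, hM, hF⟩ :=
    hasBoundedModel_copyPoly (r := r) h.even h.odd h.weighted h.card_le h.nilpotent hD
  rw [← hN] at hM
  obtain ⟨TP, hιp, hιv⟩ := exists_tensorPower h.even h.ext hM.ext
  have hF0 : ∀ b, b ∈ F 0 := fun b => hF 0 le_rfl ▸ Submodule.mem_top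
  have hιX : ∀ s, TP.ι s.2 (p (X s.1)) = i (X s) := fun s => by rw [hιp, rename_X]
  have hμX : ∀ s, TP.mu (i (X s)) = p (X s.1) := fun s => by rw [← hιX, TP.mu_ι]
  have hμy0 : ∀ j, TP.mu (y (j, 0)) = v j := fun j => by
    rw [← TP.mu_ι 0 (v j), hιv, if_pos rfl, add_zero]
  have hμy : ∀ j k, k ≠ 0 → TP.mu (y (j, k)) = 0 := fun j k hk => by
    have := congrArg TP.mu (hιv k j)
    rwa [TP.mu_ι, map_add, hμy0, if_neg hk, left_eq_add] at this
  let U : Subalgebra ℚ T :=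
    { carrier := {t | φ (t - TP.ι 0 (TP.mu t)) ∈ F 1}
      mul_mem' := fun {s t} hs ht => by
        have : s * t - TP.ι 0 (TP.mu (s * t)) = (s - TP.ι 0 (TP.mu s)) * t +
            TP.ι 0 (TP.mu s) * (t - TP.ι 0 (TP.mu t)) := by
          rw [map_mul, map_mul]; noncomm_ring
        change φ _ ∈ F 1
        rw [this, map_add, map_mul, map_mul]
        exact add_mem (hM.fam.mul 1 0 _ _ hs (hF0 _)) (hM.fam.mul 0 1 _ _ (hF0 _) ht)
      add_mem' := fun {s t} hs ht => by
        change φ _ ∈ F 1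
        rw [map_add, map_add, add_sub_add_comm, map_add]
        exact add_mem hs ht
      algebraMap_mem' := fun c => by
        change φ _ ∈ F 1
        rw [AlgHom.commutes, AlgHom.commutes, sub_self, map_zero]
        exact zero_mem _ }
  have hXF : ∀ s, i (X s) ∈ U := fun s => by
    change φ _ ∈ F 1
    rw [hμX, hιX (s.1, 0), map_sub]
    exact sub_mem (hM.X_mem s) (hM.X_mem _)
  have hU : ∀ t, t ∈ U := by
    refine hM.ext.gen U (fun q => ?_) fun u _ => ?_
    · induction q using MvPolynomial.induction_on with
      | C a => rw [← MvPolynomial.algebraMap_eq, AlgHom.commutes]; exact U.algebraMap_mem a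
      | add q q' hq hq' => rw [map_add]; exact add_mem hq hq'
      | mul_X q s hq => rw [map_mul]; exact mul_mem hq (hXF s)
    · obtain ⟨j, k⟩ := u
      change φ _ ∈ F 1
      by_cases hk : k = 0
      · rw [hk, hμy0, hιv, if_pos rfl, add_zero, sub_self, map_zero]
        exact zero_mem _
      · rw [hμy j k hk, map_zero, sub_zero]
        simpa [hk] using hM.y_mem (j, k) (Finset.mem_univ _)
  have hK : ∀ t ∈ TP.kerMu, φ t ∈ F 1 := fun t ht => by
    have : φ (t - TP.ι 0 (TP.mu t)) ∈ F 1 := hU t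
    rwa [TP.mem_kerMu.1 ht, map_zero, sub_zero] at this
  have hKpow : ∀ m : ℕ, ∀ t ∈ TP.kerMu ^ m, φ t ∈ F m := by
    intro m
    induction m with
    | zero => exact fun t _ => by simpa using hF0 (φ t)
    | succ m ih =>
      intro t ht
      rw [pow_succ] at ht
      induction ht using Submodule.mul_induction_on' with
      | mem_mul_mem x hx z hz =>
        rw [map_mul, Nat.cast_succ]
        exact hM.fam.mul _ _ _ _ (ih x hx) (hK z hz)
      | add x _ z _ hx hz => rw [map_add]; exact add_mem hx hz
  have hμ := TP.isDGAHom_mu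
  obtain ⟨Q, _, ρ, hρ, hρs, hρk⟩ := exists_quotient_pow (K := TP.kerMu)
    (fun a k hk => by rw [TP.mem_kerMu] at hk ⊢; rw [map_mul, hk, mul_zero])
    (fun a k hk => by rw [TP.mem_kerMu] at hk ⊢; rw [map_mul, hk, zero_mul])
    (fun j k hk => by rw [TP.mem_kerMu] at hk ⊢; rw [map_pr_alg _ hμ.2, hk, map_zero])
    (fun k hk => by rw [TP.mem_kerMu] at hk ⊢; rw [map_par _ hμ.2, hk, map_zero])
    (fun k hk => by rw [TP.mem_kerMu] at hk ⊢; rw [hμ.1, hk, map_zero]) N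
  refine Nat.sInf_le ⟨⟨T, TP, Q, ρ, hρ, hρs, hρk, ?_⟩⟩
  refine nonempty_htpyRetraction hM.hom hM.surj hM.quasi hρ hρs fun t ht => ?_
  exact hM.fam.eq_zero (N + 1 : ℕ) (by push_cast; omega) _
    (hKpow (N + 1) t (hρk ▸ (show t ∈ LinearMap.ker ρ.toLinearMap from ht)))

theorem IsPresentation.exists_nilpotency_bound {S : MinimalSullivan A} {l : ℕ} (hl : 0 < l)
    {σ J : Type} [Fintype σ] [Fintype J] {w : σ → ℕ} {n : J → ℕ} {f : J → MvPolynomial σ ℚ}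
    {κ : Finset J} {p : MvPolynomial σ ℚ →ₐ[ℚ] A} {v : J → A}
    (h : S.IsPresentation l w n f κ p v) :
    ∃ D : ℕ, (Ideal.span (Set.range X) : Ideal (MvPolynomial σ ℚ)) ^ (D + 1) ≤
      Ideal.span (f '' κ) ∧ D + (Fintype.card J - κ.card) ≤ cat A S := by
  classical
  obtain ⟨D, hD, hM⟩ := hasTopModel_base (wt := fun _ => 1) h.even h.odd h.weighted hl
    h.homogeneous κ h.card_le h.nilpotent
  refine ⟨D, hD, h.le_cat hl ?_⟩
  have hfX : ∀ j, f j ∈ (Ideal.span (Set.range X) : Ideal (MvPolynomial σ ℚ)) := fun j =>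
    Ideal.pow_le_self hl.ne' (mem_pow_of_isHomogeneous (h.homogeneous j))
  have := hM.union h.even h.odd h.weighted hfX κᶜ disjoint_compl_left fun _ _ => rfl
  rw [Finset.card_compl] at this
  convert this
  · ext j
    simp [em']
  · push_cast
    rfl

end MinimalSullivan

end

/-- For a pure elliptic minimal Sullivan model whose
differential has constant length `l ≥ 2` (`dV ⊆ Λ^l V`), one has
`TC_r(ΛV) ≤ r·cat(ΛV) + χ_π(ΛV)` for every `r ≥ 2`. -/
theorem TC_le_of_pure_elliptic_constant_length (A : Type) [GCDGA A]
    (S : MinimalSullivan A) (hpure : S.Pure) (hell : Elliptic A S)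
    (l : ℕ) (hl : 2 ≤ l) (hlen : S.ConstantLength l) (r : ℕ) (hr : 2 ≤ r) :
    (TC A r : ℤ) ≤ r * cat A S + S.chiPi := by
  obtain ⟨σ, J, _, _, w, n, f, κ, p, v, h⟩ :=
    MinimalSullivan.exists_isPresentation hpure hell (by omega : 0 < l) hlen
  obtain ⟨D, hD, hcat⟩ := h.exists_nilpotency_bound (by omega)
  have hκ := κ.card_le_univ
  have hTC := h.TC_le hD (by omega : 0 < r)
    (N := r * D + (r - 1) * (Fintype.card J - κ.card)) (by
      push_cast [Nat.cast_sub hκ, Nat.cast_sub (by omega : 1 ≤ r)]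
      ring)
  rw [MinimalSullivan.chiPi, ← h.card_even, ← h.card_odd]
  have hσ := h.card_le
  zify [hκ, (by omega : 1 ≤ r)] at hcat hTC hσ
  have := mul_le_mul_of_nonneg_left hcat (by positivity : (0 : ℤ) ≤ r)
  linarith

end RHT
end
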